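/- arXiv:1410.2626 — 3 statements merged into one kernel-verified Lean document; each statement's English description precedes it below -/
import Mathlib

section
/- For every real ε > 0 there exists δ > 0 such that for every natural number n and all permutations p, q ∈ Sym(n) with d_H(p∘q, q∘p) < δ, there exist permutations p', q' ∈ Sym(n) with p'∘q' = q'∘p', d_H(p, p') < ε and d_H(q, q') < ε. -/
open Filter Topology

/-- The normalized Hamming distance between two permutations of `Fin n`
(interpreted as `0` when `n = 0`). -/
noncomputable def dH {n : ℕ} (p q : Equiv.Perm (Fin n)) : ℝ :=
  ((Finset.univ.filter fun i => p i ≠ q i).card : ℝ) / n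

set_option linter.unusedSectionVars false

namespace ACN

open Equiv Set

/-- Unnormalized Hamming distance. -/
noncomputable def D {X : Type} (p q : Perm X) : ℕ := Set.ncard {x | p x ≠ q x}

section basic
variable {X : Type} [Finite X]

lemma D_self (p : Perm X) : D p p = 0 := by simp [D]

lemma D_comm (p q : Perm X) : D p q = D q p := by
  unfold D; congr 1; ext x; exact ne_comm

lemma D_tri (p q r : Perm X) : D p r ≤ D p q + D q r := by
  unfold D
  refine le_trans (Set.ncard_le_ncard ?_) (Set.ncard_union_le _ _)
  intro x hx
  by_contra h
  simp only [Set.mem_union, Set.mem_ofPred_eq, not_or, not_not] at h hx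
  exact hx (h.1.trans h.2)

lemma D_mul_left (r p q : Perm X) : D (r * p) (r * q) = D p q := by
  unfold D; congr 1; ext x; simp

lemma ncard_preimage_perm (r : Perm X) (S : Set X) : (r ⁻¹' S).ncard = S.ncard := by
  rw [← Equiv.image_symm_eq_preimage]
  exact Set.ncard_image_of_injective _ r.symm.injective

lemma D_mul_right (p q r : Perm X) : D (p * r) (q * r) = D p q := by
  unfold D
  rw [← ncard_preimage_perm r {x | p x ≠ q x}]
  rfl

lemma D_mul (p q p' q' : Perm X) : D (p * q) (p' * q') ≤ D p p' + D q q' := by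
  refine (D_tri _ (p' * q) _).trans ?_
  rw [D_mul_right, D_mul_left]

lemma D_inv (p q : Perm X) : D p⁻¹ q⁻¹ = D p q := by
  rw [← D_mul_left p, ← D_mul_right _ _ q]
  simp [D_comm]

lemma D_one (p q : Perm X) : D p q = D (p * q⁻¹) 1 := by
  rw [← D_mul_right p q q⁻¹]; simp

lemma D_conj (g p : Perm X) : D (g * p * g⁻¹) 1 = D p 1 := by
  rw [← D_mul_right _ _ g, ← D_mul_left g p]; simp

end basic

/-- Evaluation of words. -/
noncomputable def ev {X : Type} (p q : Perm X) : FreeGroup Bool →* Perm X :=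
  FreeGroup.lift (fun b => cond b p q)

/-- first generator -/
def ga : FreeGroup Bool := FreeGroup.of true
/-- second generator -/
def gb : FreeGroup Bool := FreeGroup.of false

@[simp] lemma ev_ga {X : Type} (p q : Perm X) : ev p q ga = p := by simp [ev, ga]
@[simp] lemma ev_gb {X : Type} (p q : Perm X) : ev p q gb = q := by simp [ev, gb]

lemma lip (w : FreeGroup Bool) : ∃ C : ℕ, ∀ (X : Type) [Finite X] (p q p1 q1 : Perm X),
    D (ev p q w) (ev p1 q1 w) ≤ C * (D p p1 + D q q1) := by
  induction w using FreeGroup.induction_on with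
  | C1 => exact ⟨0, fun X _ p q p1 q1 => by simp [D_self]⟩
  | of b =>
    refine ⟨1, fun X _ p q p1 q1 => ?_⟩
    cases b <;> simp [ev]
  | inv_of b ih =>
    obtain ⟨C, hC⟩ := ih
    refine ⟨C, fun X _ p q p1 q1 => ?_⟩
    rw [map_inv, map_inv, D_inv]
    exact hC X p q p1 q1
  | mul x y ihx ihy =>
    obtain ⟨C, hC⟩ := ihx
    obtain ⟨C', hC'⟩ := ihy
    refine ⟨C + C', fun X _ p q p1 q1 => ?_⟩
    rw [map_mul, map_mul, add_mul]
    exact (D_mul _ _ _ _).trans (add_le_add (hC X p q p1 q1) (hC' X p q p1 q1))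

/-- Words that are almost trivial for almost commuting permutations. -/
def negl : Subgroup (FreeGroup Bool) where
  carrier := {w | ∃ C : ℕ, ∀ (X : Type) [Finite X] (p q : Perm X),
    D (ev p q w) 1 ≤ C * D (p * q) (q * p)}
  one_mem' := ⟨0, fun X _ p q => by simp [D_self]⟩
  mul_mem' := by
    rintro x y ⟨C, hC⟩ ⟨C', hC'⟩
    refine ⟨C + C', fun X _ p q => ?_⟩
    rw [map_mul, add_mul]
    have := D_mul (ev p q x) (ev p q y) 1 1
    rw [one_mul] at this
    exact this.trans (add_le_add (hC X p q) (hC' X p q))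
  inv_mem' := by
    rintro x ⟨C, hC⟩
    refine ⟨C, fun X _ p q => ?_⟩
    have := D_inv (ev p q x) 1
    rw [map_inv, ← inv_one, this]
    exact hC X p q

instance negl_normal : negl.Normal where
  conj_mem := by
    rintro x ⟨C, hC⟩ g
    refine ⟨C, fun X _ p q => ?_⟩
    rw [map_mul, map_mul, map_inv, D_conj]
    exact hC X p q

lemma negl_comm : Commute (ga : FreeGroup Bool ⧸ negl) (gb : FreeGroup Bool ⧸ negl) := by
  have : (ga * gb) * (gb * ga)⁻¹ ∈ negl := by
    refine ⟨1, fun X _ p q => ?_⟩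
    rw [D_one (p * q)]; simp
  have h2 := (QuotientGroup.eq_one_iff _).2 this
  rw [QuotientGroup.mk_mul, QuotientGroup.mk_inv, mul_inv_eq_one] at h2
  exact h2

lemma negl_of_eq {w w' : FreeGroup Bool}
    (h : (w : FreeGroup Bool ⧸ negl) = w') :
    ∃ C : ℕ, ∀ (X : Type) [Finite X] (p q : Perm X),
      D (ev p q w) (ev p q w') ≤ C * D (p * q) (q * p) := by
  have : w * w'⁻¹ ∈ negl := by
    rw [← QuotientGroup.eq_one_iff, QuotientGroup.mk_mul, QuotientGroup.mk_inv, h, mul_inv_cancel]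
  obtain ⟨C, hC⟩ := this
  refine ⟨C, fun X _ p q => ?_⟩
  rw [D_one]
  simpa using hC X p q

/-- The word for a vector. -/
def wd (v : ℤ × ℤ) : FreeGroup Bool := ga ^ v.1 * gb ^ v.2

lemma comm_aux {G : Type*} [Group G] {x y : G} (h : Commute x y) (a b c d : ℤ) :
    (x ^ a * y ^ b) * (x ^ c * y ^ d) = x ^ (a + c) * y ^ (b + d) := by
  have := (h.zpow_zpow c b).eq
  rw [zpow_add, zpow_add, mul_assoc, ← mul_assoc (y ^ b), ← this]
  simp only [mul_assoc]

lemma comm_aux2 {G : Type*} [Group G] {x y : G} (h : Commute x y) (a b k : ℤ) :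
    (x ^ a * y ^ b) ^ k = x ^ (a * k) * y ^ (b * k) := by
  rw [(h.zpow_zpow a b).mul_zpow, zpow_mul, zpow_mul]

lemma wd_mul (v w : ℤ × ℤ) :
    ((wd v * wd w : FreeGroup Bool) : FreeGroup Bool ⧸ negl) = (wd (v + w) : FreeGroup Bool) := by
  simp only [wd, QuotientGroup.mk_mul, QuotientGroup.mk_zpow]
  exact comm_aux negl_comm _ _ _ _

lemma wd_zpow (v : ℤ × ℤ) (k : ℤ) :
    ((wd v ^ k : FreeGroup Bool) : FreeGroup Bool ⧸ negl) =
      (wd (v.1 * k, v.2 * k) : FreeGroup Bool) := by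
  simp only [wd, QuotientGroup.mk_mul, QuotientGroup.mk_zpow]
  exact comm_aux2 negl_comm _ _ _

lemma wd_ga : wd (1, 0) = ga := by simp [wd]
lemma wd_gb : wd (0, 1) = gb := by simp [wd]
lemma wd_zero : wd 0 = 1 := by simp [wd]

lemma D_pow_disj {X : Type} [Finite X] (k : ℕ) (S : Set X) (u : Perm X) :
    (⋃ i ∈ Finset.range k, ((u ^ i : Perm X) ⁻¹' S)).ncard ≤ k * S.ncard := by
  induction k with
  | zero => simp
  | succ k ih =>
    rw [Finset.range_add_one, Finset.set_biUnion_insert, add_mul, one_mul, add_comm]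
    refine (Set.ncard_union_le _ _).trans (add_le_add ?_ ih)
    rw [ncard_preimage_perm]

lemma conj_near {X : Type} [Finite X] (k : ℕ) (hk : 0 < k) (u u2 : Perm X) (hu : u ^ k = 1)
    (h : IsConj u u2) : ∃ s : Perm X, s * u2 = u * s ∧ D s 1 ≤ k * D u u2 := by
  classical
  have := Fintype.ofFinite X
  have hu2 : u2 ^ k = 1 := by
    have := h.pow k
    rw [hu] at this
    exact isConj_one_right.1 this
  let A : X → Prop := fun x => ∀ i : ℕ, (u ^ i) x = (u2 ^ i) x
  have hA1 : ∀ x, A x → u x = u2 x := fun x hx => by simpa using hx 1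
  have hA2 : ∀ x, A x → A (u x) := by
    intro x hx i
    have h1 := hx (i + 1)
    rw [pow_succ, pow_succ, Perm.mul_apply, Perm.mul_apply, ← hA1 x hx] at h1
    exact h1
  have hA3 : ∀ x, A x → A (u2 x) := fun x hx => hA1 x hx ▸ hA2 x hx
  have it1 : ∀ (f : Perm X), f ^ k = 1 → (∀ x, A x → A (f x)) → ∀ x, A (f x) ↔ A x := by
    intro f hf hfA x
    refine ⟨fun hx => ?_, hfA x⟩
    have : ∀ i : ℕ, A ((f ^ i) (f x)) := by
      intro i
      induction i with
      | zero => simpa using hx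
      | succ i ih => rw [pow_succ', Perm.mul_apply]; exact hfA _ ih
    have h2 := this (k - 1)
    rw [← Perm.mul_apply, ← pow_succ, Nat.sub_add_cancel hk, hf] at h2
    exact h2
  have huA := it1 u hu hA2
  have hu2A := it1 u2 hu2 hA3
  have huB : ∀ x, ¬ A (u x) ↔ ¬ A x := fun x => not_congr (huA x)
  have hu2B : ∀ x, ¬ A (u2 x) ↔ ¬ A x := fun x => not_congr (hu2A x)
  have key : ∀ (f : Perm X) (h1 : ∀ x, A (f x) ↔ A x) (h2 : ∀ x, ¬ A (f x) ↔ ¬ A x),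
      f.cycleType = (f.subtypePerm h1).cycleType + (f.subtypePerm (p := fun x => ¬ A x) h2).cycleType := by
    intro f h1 h2
    have e : f = Perm.ofSubtype (f.subtypePerm h1) * Perm.ofSubtype (f.subtypePerm (p := fun x => ¬ A x) h2) := by
      ext x
      rw [Perm.mul_apply]
      by_cases hx : A x
      · rw [Perm.ofSubtype_apply_of_not_mem (p := fun x => ¬ A x) _ (not_not.2 hx),
          Perm.ofSubtype_apply_of_mem _ hx]
        rfl
      · rw [Perm.ofSubtype_apply_of_mem (p := fun x => ¬ A x) _ hx,
          Perm.ofSubtype_apply_of_not_mem]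
        · rfl
        · exact (h2 x).2 hx
    have dj : Perm.Disjoint (Perm.ofSubtype (f.subtypePerm h1))
        (Perm.ofSubtype (f.subtypePerm (p := fun x => ¬ A x) h2)) := by
      intro x
      by_cases hx : A x
      · right
        exact Perm.ofSubtype_apply_of_not_mem (p := fun x => ¬ A x) _ (not_not.2 hx)
      · left
        exact Perm.ofSubtype_apply_of_not_mem _ hx
    conv_lhs => rw [e]
    rw [dj.cycleType_mul, Perm.cycleType_ofSubtype, Perm.cycleType_ofSubtype]
  have hct := Perm.isConj_iff_cycleType_eq.1 h
  rw [key u huA huB, key u2 hu2A hu2B] at hct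
  have hAA : u.subtypePerm huA = u2.subtypePerm hu2A := by
    ext x
    exact hA1 x.1 x.2
  rw [hAA] at hct
  have hct2 := add_left_cancel hct
  obtain ⟨c, hc⟩ := isConj_iff.1 (Perm.isConj_iff_cycleType_eq.2 hct2.symm)
  refine ⟨Perm.ofSubtype c, ?_, ?_⟩
  · ext x
    rw [Perm.mul_apply, Perm.mul_apply]
    by_cases hx : A x
    · rw [Perm.ofSubtype_apply_of_not_mem (p := fun x => ¬ A x) _ (not_not.2 hx),
        Perm.ofSubtype_apply_of_not_mem (p := fun x => ¬ A x) _ (not_not.2 (hA3 x hx)), hA1 x hx]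
    · rw [Perm.ofSubtype_apply_of_mem (p := fun x => ¬ A x) _ hx,
        Perm.ofSubtype_apply_of_mem (p := fun x => ¬ A x) _ ((hu2B x).2 hx)]
      have := congrArg (fun f => (f ⟨x, hx⟩ : X)) (mul_inv_eq_iff_eq_mul.1 hc)
      simpa using this
  · refine le_trans (Set.ncard_le_ncard ?_) (D_pow_disj k {x | u x ≠ u2 x} u)
    intro x hx
    by_contra hcon
    have h1 : ∀ i < k, u ((u ^ i) x) = u2 ((u ^ i) x) := by
      intro i hi
      by_contra h3
      apply hcon
      simp only [Set.mem_iUnion]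
      exact ⟨i, Finset.mem_range.2 hi, h3⟩
    have h2 : ∀ i, u ((u ^ i) x) = u2 ((u ^ i) x) := by
      intro i
      have := h1 (i % k) (Nat.mod_lt _ hk)
      rwa [← pow_eq_pow_mod i hu] at this
    have hAx : A x := by
      intro i
      induction i with
      | zero => rfl
      | succ i ih =>
        rw [pow_succ', pow_succ', Perm.mul_apply, Perm.mul_apply, h2, ih]
    exact hx (Perm.ofSubtype_apply_of_not_mem (p := fun x => ¬ A x) _ (not_not.2 hAx))

lemma make_periodic {X : Type} [Finite X] (k : ℕ) (u : Perm X) :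
    ∃ u' : Perm X, u' ^ k = 1 ∧ D u u' ≤ D (u ^ k) 1 := by
  classical
  have hA : ∀ x, (u ^ k) (u x) = u x ↔ (u ^ k) x = x := by
    intro x
    rw [← Perm.mul_apply, (Commute.refl u).pow_left k |>.eq, Perm.mul_apply]
    exact u.injective.eq_iff
  refine ⟨Perm.ofSubtype (u.subtypePerm (p := fun x => (u ^ k) x = x) hA), ?_, ?_⟩
  · rw [← map_pow, Perm.subtypePerm_pow]
    have e : (u ^ k).subtypePerm (p := fun x => (u ^ k) x = x)
        (fun x => (u ^ k).injective.eq_iff) = 1 := by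
      ext x
      exact x.2
    refine Eq.trans (congrArg _ ?_) (map_one Perm.ofSubtype)
    exact e
  · refine Set.ncard_le_ncard ?_
    intro x hx h
    simp only [Perm.coe_one, id] at h
    apply hx
    rw [Perm.ofSubtype_apply_of_mem (p := fun x => (u ^ k) x = x) _ h]
    rfl

lemma periodic_uv {X : Type} [Finite X] (k : ℕ) (hk : 0 < k) (u v : Perm X) :
    ∃ u' v' : Perm X, u' * v' = v' * u' ∧ D u u' ≤ D (u ^ k) 1 ∧
      D v v' ≤ k * (D (u * v) (v * u) + 2 * D (u ^ k) 1) := by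
  obtain ⟨u', h1, h2⟩ := make_periodic k u
  obtain ⟨s, hs, hs2⟩ := conj_near k hk u' (v * u' * v⁻¹) h1 (isConj_iff.2 ⟨v, rfl⟩)
  refine ⟨u', s * v, ?_, h2, ?_⟩
  · rw [← mul_assoc, ← hs]; group
  · have e1 : D v (s * v) = D s 1 := by
      have := D_mul_right 1 s v
      rw [one_mul] at this
      rw [this, D_comm]
    rw [e1]
    refine hs2.trans (Nat.mul_le_mul_left _ ?_)
    rw [← D_mul_right _ _ v, inv_mul_cancel_right]
    calc D (u' * v) (v * u') ≤ D (u' * v) (u * v) + D (u * v) (v * u') := D_tri _ _ _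
      _ ≤ D (u' * v) (u * v) + (D (u * v) (v * u) + D (v * u) (v * u')) := by
        gcongr; exact D_tri _ _ _
      _ ≤ _ := by
        rw [D_mul_right, D_mul_left, D_comm u' u]; omega

lemma periodic (v : ℤ × ℤ) (hv : v ≠ 0) : ∃ C : ℕ, ∀ (X : Type) [Finite X] (p q : Perm X),
    ∃ p' q' : Perm X, p' * q' = q' * p' ∧
      D p p' + D q q' ≤ C * (D (p * q) (q * p) + D (ev p q (wd v)) 1) := by
  obtain ⟨a, b⟩ := v
  have hk : 0 < Int.gcd a b := by
    apply Nat.pos_of_ne_zero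
    intro h
    rw [Int.gcd_eq_zero_iff] at h
    exact hv (by rw [h.1, h.2]; rfl)
  set k := Int.gcd a b with hkdef
  obtain ⟨a1, ha1⟩ : (k : ℤ) ∣ a := Int.gcd_dvd_left ..
  obtain ⟨b1, hb1⟩ : (k : ℤ) ∣ b := Int.gcd_dvd_right ..
  have hbez := Int.gcd_eq_gcd_ab a b
  rw [← hkdef] at hbez
  obtain ⟨c, d, hcd⟩ : ∃ c d : ℤ, a1 * d - b1 * c = 1 := by
    refine ⟨-Int.gcdB a b, Int.gcdA a b, ?_⟩
    have hk' : (k : ℤ) ≠ 0 := by exact_mod_cast hk.ne'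
    apply mul_left_cancel₀ hk'
    linear_combination -hbez - (Int.gcdA a b) * ha1 - (Int.gcdB a b) * hb1
  clear_value k
  -- words
  let U := wd (a1, b1)
  let V := wd (c, d)
  obtain ⟨C1, hC1⟩ := negl_of_eq (w := U * V) (w' := V * U) (by
    rw [wd_mul, wd_mul, add_comm])
  obtain ⟨C2, hC2⟩ := negl_of_eq (w := U ^ (k : ℤ)) (w' := wd (a, b)) (by
    rw [wd_zpow]; simp only [ha1, hb1, mul_comm])
  obtain ⟨C3, hC3⟩ := negl_of_eq (w := ga) (w' := U ^ d * V ^ (-b1)) (by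
    rw [QuotientGroup.mk_mul, wd_zpow, wd_zpow, ← QuotientGroup.mk_mul, wd_mul, ← wd_ga]
    congr 2
    ext <;> simp <;> linarith)
  obtain ⟨C4, hC4⟩ := negl_of_eq (w := gb) (w' := U ^ (-c) * V ^ a1) (by
    rw [QuotientGroup.mk_mul, wd_zpow, wd_zpow, ← QuotientGroup.mk_mul, wd_mul, ← wd_gb]
    congr 2
    ext <;> simp <;> linarith)
  obtain ⟨C5, hC5⟩ := lip (ga ^ d * gb ^ (-b1))
  obtain ⟨C6, hC6⟩ := lip (ga ^ (-c) * gb ^ a1)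
  refine ⟨C3 + C4 + (C5 + C6) * ((1 + 2 * k) * (C2 + 1) + k * C1), fun X _ p q => ?_⟩
  specialize hC1 X p q
  specialize hC2 X p q
  specialize hC3 X p q
  specialize hC4 X p q
  obtain ⟨u', v', hcomm, h1, h2⟩ := periodic_uv k hk (ev p q U) (ev p q V)
  specialize hC5 X (ev p q U) (ev p q V) u' v'
  specialize hC6 X (ev p q U) (ev p q V) u' v'
  simp only [map_mul, map_zpow, ev_ga, ev_gb, zpow_natCast, map_pow] at hC1 hC2 hC3 hC4 hC5 hC6
  have hc : Commute u' v' := hcomm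
  refine ⟨u' ^ d * v' ^ (-b1), u' ^ (-c) * v' ^ a1, ?_, ?_⟩
  · rw [comm_aux hc, comm_aux hc, add_comm, add_comm a1]
  · have t1 := D_tri p _ (u' ^ d * v' ^ (-b1)) |>.trans (add_le_add hC3 hC5)
    have t2 := D_tri q _ (u' ^ (-c) * v' ^ a1) |>.trans (add_le_add hC4 hC6)
    have t3 := D_tri (ev p q U ^ k) (ev p q (wd (a, b))) 1
    set t := D (p * q) (q * p)
    set s := D (ev p q (wd (a, b))) 1
    have t4 : D (ev p q U ^ k) 1 ≤ (C2 + 1) * (t + s) := by nlinarith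
    have t5 : D (ev p q U) u' + D (ev p q V) v' ≤ ((1 + 2 * k) * (C2 + 1) + k * C1) * (t + s) := by
      calc _ ≤ D (ev p q U ^ k) 1 +
            k * (D (ev p q U * ev p q V) (ev p q V * ev p q U) + 2 * D (ev p q U ^ k) 1) :=
            add_le_add h1 h2
        _ ≤ (C2 + 1) * (t + s) + k * (C1 * (t + s) + 2 * ((C2 + 1) * (t + s))) := by
            gcongr
            exact hC1.trans (Nat.mul_le_mul_left _ (Nat.le_add_right _ _))
        _ = _ := by ring
    calc _ ≤ (C3 * t + C5 * (D (ev p q U) u' + D (ev p q V) v')) +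
          (C4 * t + C6 * (D (ev p q U) u' + D (ev p q V) v')) := add_le_add t1 t2
      _ ≤ (C3 * (t + s) + C5 * (((1 + 2 * k) * (C2 + 1) + k * C1) * (t + s))) +
          (C4 * (t + s) + C6 * (((1 + 2 * k) * (C2 + 1) + k * C1) * (t + s))) := by
          gcongr <;> exact Nat.le_add_right _ _
      _ = _ := by ring

/-- The action of a vector. -/
noncomputable def act {X : Type} (p q : Perm X) (v : ℤ × ℤ) : Perm X := ev p q (wd v)

lemma act_zero {X : Type} (p q : Perm X) : act p q 0 = 1 := by simp [act, wd_zero]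
lemma act_e1 {X : Type} (p q : Perm X) : act p q (1, 0) = p := by simp [act, wd_ga]
lemma act_e2 {X : Type} (p q : Perm X) : act p q (0, 1) = q := by simp [act, wd_gb]

/-- Boxes in the plane. -/
noncomputable def box (r : ℕ) : Finset (ℤ × ℤ) := Finset.Icc (-(r : ℤ)) r ×ˢ Finset.Icc (-(r : ℤ)) r

lemma mem_box {r : ℕ} {v : ℤ × ℤ} :
    v ∈ box r ↔ (-(r : ℤ) ≤ v.1 ∧ v.1 ≤ r) ∧ (-(r : ℤ) ≤ v.2 ∧ v.2 ≤ r) := by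
  simp [box, Finset.mem_product]

lemma card_box (r : ℕ) : (box r).card = (2 * r + 1) ^ 2 := by
  have : ((r : ℤ) + 1 - -(r : ℤ)).toNat = 2 * r + 1 := by omega
  rw [box, Finset.card_product, Int.card_Icc, this, sq]

lemma box_mono {r s : ℕ} (h : r ≤ s) {v : ℤ × ℤ} (hv : v ∈ box r) : v ∈ box s := by
  rw [mem_box] at *; omega

lemma box_add {r s : ℕ} {v w : ℤ × ℤ} (hv : v ∈ box r) (hw : w ∈ box s) :
    v + w ∈ box (r + s) := by
  rw [mem_box] at *; simp only [Prod.fst_add, Prod.snd_add]; omega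

lemma box_neg {r : ℕ} {v : ℤ × ℤ} (hv : v ∈ box r) : -v ∈ box r := by
  rw [mem_box] at *; simp only [Prod.fst_neg, Prod.snd_neg]; omega

lemma box_zero (r : ℕ) : (0 : ℤ × ℤ) ∈ box r := by
  rw [mem_box]; simp

/-- Good points: locally the action is a free action. -/
def Good {X : Type} (p q : Perm X) (M : ℕ) (x : X) : Prop :=
  (∀ v ∈ box M, ∀ w ∈ box M, act p q w (act p q v x) = act p q (v + w) x) ∧
  (∀ v ∈ box M, ∀ w ∈ box M, act p q v x = act p q w x → v = w)

lemma carve {X : Type} [DecidableEq X] (p q : Perm X) (N K M : ℕ) (hM : N * K + N ≤ M)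
    (ε : ℝ) (hε : 0 < ε) (hK : ((2 * (N * K : ℕ) + 1 : ℕ) ^ 2 : ℝ) < (1 + ε) ^ K) (n : ℕ) :
    ∀ U : Finset X, U.card = n → (∀ x ∈ U, Good p q M x) →
      ∃ B : Finset X, ∃ c : X → X × (ℤ × ℤ), B ⊆ U ∧ (B.card : ℝ) ≤ ε * U.card ∧
        (∀ y ∈ U \ B, act p q (c y).2 (c y).1 = y) ∧
        (∀ y ∈ U \ B, ∀ z ∈ U \ B, ∀ w ∈ box N, act p q w y = z →
          (c z).1 = (c y).1 ∧ (c z).2 = (c y).2 + w) := by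
  classical
  induction n using Nat.strong_induction_on with
  | _ n ih =>
  intro U hUn hU
  rcases U.eq_empty_or_nonempty with rfl | ⟨x, hx⟩
  · exact ⟨∅, fun x => (x, 0), by simp⟩
  let ball : ℕ → Finset X := fun r => U.filter (fun y => ∃ v ∈ box r, act p q v x = y)
  have hxball : ∀ r, x ∈ ball r := fun r =>
    Finset.mem_filter.2 ⟨hx, 0, box_zero r, by rw [act_zero]; rfl⟩
  have hballcard : ∀ r, (ball r).card ≤ (2 * r + 1) ^ 2 := by
    intro r
    rw [← card_box]
    refine le_trans (Finset.card_le_card (t := (box r).image (fun v => act p q v x)) ?_)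
      Finset.card_image_le
    intro y hy
    obtain ⟨_, v, hv, h⟩ := Finset.mem_filter.1 hy
    exact Finset.mem_image.2 ⟨v, hv, h⟩
  obtain ⟨k, hkK, hk⟩ : ∃ k < K, ((ball (N * (k + 1))).card : ℝ) ≤
      (1 + ε) * (ball (N * k)).card := by
    by_contra hcon
    push Not at hcon
    have : ∀ k ≤ K, (1 + ε) ^ k ≤ ((ball (N * k)).card : ℝ) := by
      intro k
      induction k with
      | zero =>
        intro _
        have : 0 < (ball (N * 0)).card := Finset.card_pos.2 ⟨x, hxball _⟩
        rw [pow_zero]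
        exact_mod_cast this
      | succ k ihk =>
        intro hk
        have h1 := ihk (by omega)
        have h2 := hcon k (by omega)
        rw [pow_succ']
        have : (1 + ε) * (1 + ε) ^ k ≤ (1 + ε) * ((ball (N * k)).card : ℝ) := by gcongr
        linarith
    have h1 := this K le_rfl
    have h2 : ((ball (N * K)).card : ℝ) ≤ ((2 * (N * K : ℕ) + 1 : ℕ) ^ 2 : ℝ) := by
      exact_mod_cast hballcard (N * K)
    linarith
  have hNk : N * (k + 1) = N * k + N := by ring
  have hNM : N * k + N ≤ M := by
    have : N * k ≤ N * K := Nat.mul_le_mul_left _ hkK.le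
    omega
  set B1 := ball (N * (k + 1)) with hB1
  set B0 := ball (N * k) with hB0
  have hB01 : B0 ⊆ B1 := by
    intro y hy
    obtain ⟨h0, v, hv, h⟩ := Finset.mem_filter.1 hy
    exact Finset.mem_filter.2 ⟨h0, v, box_mono (by omega) hv, h⟩
  have hB1U : B1 ⊆ U := Finset.filter_subset _ _
  have hlt : (U \ B1).card < n := by
    rw [← hUn]
    apply Finset.card_lt_card
    refine ⟨Finset.sdiff_subset, fun h => ?_⟩
    exact (Finset.mem_sdiff.1 (h hx)).2 (hxball _)
  obtain ⟨B', c', hB'U, hB'card, h1, h2⟩ := ih _ hlt (U \ B1) rfl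
    (fun y hy => hU y (Finset.mem_sdiff.1 hy).1)
  have hch : ∀ y ∈ B0, ∃ v ∈ box (N * k), act p q v x = y := fun y hy =>
    (Finset.mem_filter.1 hy).2
  choose! f hfbox hf using hch
  have hgx := hU x hx
  have hcases : ∀ y ∈ U \ (B' ∪ (B1 \ B0)), y ∈ B0 ∨ (y ∉ B0 ∧ y ∉ B1 ∧ y ∈ (U \ B1) \ B') := by
    intro y hy
    simp only [Finset.mem_sdiff, Finset.mem_union, not_or, not_and, not_not] at hy ⊢
    by_cases h : y ∈ B0
    · exact Or.inl h
    · have : y ∉ B1 := fun h' => h (hy.2.2 h')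
      exact Or.inr ⟨h, this, ⟨hy.1, this⟩, hy.2.1⟩
  refine ⟨B' ∪ (B1 \ B0), fun y => if y ∈ B0 then (x, f y) else c' y, ?_, ?_, ?_, ?_⟩
  · exact Finset.union_subset (hB'U.trans Finset.sdiff_subset) (Finset.sdiff_subset.trans hB1U)
  · have e1 : ((B' ∪ (B1 \ B0)).card : ℝ) ≤ B'.card + (B1 \ B0).card := by
      exact_mod_cast Finset.card_union_le _ _
    have e2 : ((B1 \ B0).card : ℝ) + B0.card = B1.card := by
      exact_mod_cast Finset.card_sdiff_add_card_eq_card hB01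
    have e3 : ((U \ B1).card : ℝ) + B1.card = U.card := by
      exact_mod_cast Finset.card_sdiff_add_card_eq_card hB1U
    have e4 : (B0.card : ℝ) ≤ B1.card := by exact_mod_cast Finset.card_le_card hB01
    rw [← e3]
    nlinarith
  · intro y hy
    rcases hcases y hy with h | ⟨h, _, h'⟩
    · simp only [if_pos h]; exact hf y h
    · simp only [if_neg h]; exact h1 y h'
  · intro y hy z hz w hw hyz
    have hzU : z ∈ U := (Finset.mem_sdiff.1 hz).1
    have hyU : y ∈ U := (Finset.mem_sdiff.1 hy).1
    have hwM : w ∈ box M := box_mono (by omega) hw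
    rcases hcases y hy with h | ⟨h, hh, h'⟩
    · have hv := hfbox y h
      have hz' : act p q (f y + w) x = z := by
        rw [← hgx.1 _ (box_mono (by omega) hv) _ hwM, hf y h, hyz]
      have hzB1 : z ∈ B1 :=
        Finset.mem_filter.2 ⟨hzU, _, by rw [hNk]; exact box_add hv hw, hz'⟩
      rcases hcases z hz with g | ⟨_, g, _⟩
      · simp only [if_pos h, if_pos g, true_and]
        apply hgx.2 _ (box_mono (by omega) (hfbox z g)) _ (box_mono hNM (box_add hv hw))
        rw [hf z g, hz']
      · exact absurd hzB1 g
    · rcases hcases z hz with g | ⟨g, gg, g'⟩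
      · exfalso
        apply hh
        have hv := hfbox z g
        refine Finset.mem_filter.2 ⟨hyU, f z + -w, by rw [hNk]; exact box_add hv (box_neg hw), ?_⟩
        rw [← hgx.1 _ (box_mono (by omega) hv) _ (box_neg hwM), hf z g, ← hyz,
          (hU y hyU).1 _ hwM _ (box_neg hwM), add_neg_cancel, act_zero]
        rfl
      · simp only [if_neg h, if_neg g]
        exact h2 y h' z g' w hw hyz

lemma exists_K (N : ℕ) (ε : ℝ) (hε : 0 < ε) :
    ∃ K : ℕ, ((2 * (N * K : ℕ) + 1 : ℕ) ^ 2 : ℝ) < (1 + ε) ^ K := by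
  have h := tendsto_pow_const_div_const_pow_of_one_lt 2 (show (1 : ℝ) < 1 + ε by linarith)
  have h2 := h.eventually (gt_mem_nhds (show (0 : ℝ) < 1 / (2 * N + 1) ^ 2 by positivity))
  obtain ⟨K, hK, hK1⟩ := (h2.and (Filter.eventually_ge_atTop 1)).exists
  refine ⟨K, ?_⟩
  have hp : (0 : ℝ) < (1 + ε) ^ K := by positivity
  rw [div_lt_div_iff₀ hp (by positivity)] at hK
  have hK1' : (1 : ℝ) ≤ K := by exact_mod_cast hK1
  calc ((2 * (N * K : ℕ) + 1 : ℕ) ^ 2 : ℝ) = (2 * (N * K) + 1) ^ 2 := by push_cast; ring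
    _ ≤ (2 * (N * K) + K) ^ 2 := by gcongr
    _ = K ^ 2 * (2 * N + 1) ^ 2 := by ring
    _ < _ := by linarith

lemma ncard_biUnion_le {X I : Type*} [Finite X] [DecidableEq I] (s : Finset I) (f : I → Set X)
    (g : I → ℕ) (h : ∀ i ∈ s, (f i).ncard ≤ g i) :
    (⋃ i ∈ s, f i).ncard ≤ ∑ i ∈ s, g i := by
  induction s using Finset.induction_on with
  | empty => simp
  | insert a s ha ih =>
    rw [Finset.set_biUnion_insert, Finset.sum_insert ha]
    exact (Set.ncard_union_le _ _).trans
      (add_le_add (h a (Finset.mem_insert_self _ _))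
        (ih fun i hi => h i (Finset.mem_insert_of_mem hi)))

lemma torus {X T : Type} [Finite X] [Finite T] (m : ℕ) (p q : Perm X)
    (e : T × (Fin (m + 1) × Fin (m + 1)) ↪ X)
    (hp : ∀ t i j, i ≠ Fin.last m → p (e (t, i, j)) = e (t, i + 1, j))
    (hq : ∀ t i j, j ≠ Fin.last m → q (e (t, i, j)) = e (t, i, j + 1)) :
    ∃ p' q' : Perm X, p' * q' = q' * p' ∧
      (D p p' : ℝ) ≤ (Set.range e)ᶜ.ncard + (Nat.card X : ℝ) / (m + 1) ∧
      (D q q' : ℝ) ≤ (Set.range e)ᶜ.ncard + (Nat.card X : ℝ) / (m + 1) := by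
  let p0 : Perm (T × (Fin (m + 1) × Fin (m + 1))) :=
    Equiv.prodCongr (Equiv.refl T) (Equiv.prodCongr (finRotate (m + 1)) (Equiv.refl _))
  let q0 : Perm (T × (Fin (m + 1) × Fin (m + 1))) :=
    Equiv.prodCongr (Equiv.refl T) (Equiv.prodCongr (Equiv.refl _) (finRotate (m + 1)))
  have hcard : (Nat.card T * (m + 1)) * (m + 1) ≤ Nat.card X := by
    have := Nat.card_le_card_of_injective e e.injective
    simpa [Nat.card_prod, mul_assoc] using this
  have hcardR : ((Nat.card T * (m + 1) : ℕ) : ℝ) ≤ (Nat.card X : ℝ) / (m + 1) := by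
    rw [le_div_iff₀ (by positivity)]
    exact_mod_cast hcard
  have key : ∀ (f : Perm X) (f0 : Perm (T × (Fin (m + 1) × Fin (m + 1))))
      (S : Set (Fin (m + 1) × Fin (m + 1))), S.ncard ≤ m + 1 →
      (∀ t s, s ∉ S → f (e (t, s)) = e (f0 (t, s))) →
      (D f (Perm.viaEmbeddingHom e f0) : ℝ) ≤
        (Set.range e)ᶜ.ncard + (Nat.card X : ℝ) / (m + 1) := by
    intro f f0 S hS hf
    have h1 : D f (Perm.viaEmbeddingHom e f0) ≤
        (Set.range e)ᶜ.ncard + (e '' (Set.univ ×ˢ S)).ncard := by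
      refine le_trans (Set.ncard_le_ncard ?_) (Set.ncard_union_le _ _)
      intro x hx
      by_cases hxe : x ∈ Set.range e
      · right
        obtain ⟨⟨t, s⟩, rfl⟩ := hxe
        refine ⟨(t, s), ⟨Set.mem_univ _, ?_⟩, rfl⟩
        by_contra hs
        apply hx
        rw [Perm.viaEmbeddingHom_apply, Perm.viaEmbedding_apply, hf t s hs]
      · exact Or.inl hxe
    have h2 : (e '' (Set.univ ×ˢ S)).ncard ≤ Nat.card T * (m + 1) := by
      rw [Set.ncard_image_of_injective _ e.injective, Set.ncard_prod, Set.ncard_univ]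
      exact Nat.mul_le_mul_left _ hS
    have h3 : (D f (Perm.viaEmbeddingHom e f0) : ℝ) ≤
        (Set.range e)ᶜ.ncard + (Nat.card T * (m + 1) : ℕ) := by
      exact_mod_cast h1.trans (Nat.add_le_add_left h2 _)
    linarith
  refine ⟨Perm.viaEmbeddingHom e p0, Perm.viaEmbeddingHom e q0, ?_, ?_, ?_⟩
  · rw [← map_mul, ← map_mul]
    congr 1
  · refine key p p0 ({Fin.last m} ×ˢ Set.univ) ?_ ?_
    · rw [Set.ncard_prod, Set.ncard_univ]; simp
    · rintro t ⟨i, j⟩ hs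
      have : i ≠ Fin.last m := by simpa using hs
      rw [hp t i j this]
      simp [p0]
  · refine key q q0 (Set.univ ×ˢ {Fin.last m}) ?_ ?_
    · rw [Set.ncard_prod, Set.ncard_univ]; simp
    · rintro t ⟨i, j⟩ hs
      have : j ≠ Fin.last m := by simpa using hs
      rw [hq t i j this]
      simp [q0]

lemma tiled {X : Type} [Fintype X] [DecidableEq X] (p q : Perm X) (m K M : ℕ)
    (hM : (m + 1) * K + (m + 1) ≤ M)
    (ε : ℝ) (hε : 0 < ε) (hK : ((2 * ((m + 1) * K : ℕ) + 1 : ℕ) ^ 2 : ℝ) < (1 + ε) ^ K)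
    (U : Finset X) (hU : ∀ x ∈ U, Good p q M x) :
    ∃ p' q' : Perm X, p' * q' = q' * p' ∧
      (D p p' : ℝ) ≤ (box (m + 1)).card * (Uᶜ.card + ε * Fintype.card X) +
        (Nat.card X : ℝ) / (m + 1) ∧
      (D q q' : ℝ) ≤ (box (m + 1)).card * (Uᶜ.card + ε * Fintype.card X) +
        (Nat.card X : ℝ) / (m + 1) := by
  classical
  obtain ⟨B, c, hBU, hBcard, h1, h2⟩ := carve p q (m + 1) K M hM ε hε hK _ U rfl hU
  set W := U \ B with hW
  have hWU : ∀ x ∈ W, x ∈ U := fun x hx => (Finset.mem_sdiff.1 hx).1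
  let T := {t : X // t ∈ W ∧ ((m + 1 : ℕ) : ℤ) ∣ (c t).2.1 ∧ ((m + 1 : ℕ) : ℤ) ∣ (c t).2.2 ∧
    ∀ i j : Fin (m + 1), act p q ((i : ℕ), (j : ℕ)) t ∈ W}
  have hbox : ∀ i j : Fin (m + 1), (((i : ℕ) : ℤ), ((j : ℕ) : ℤ)) ∈ box (m + 1) := by
    intro i j
    have := i.2
    have := j.2
    rw [mem_box]
    simp only
    omega
  have hinj : Function.Injective (fun z : T × (Fin (m + 1) × Fin (m + 1)) =>
      act p q (((z.2.1 : ℕ) : ℤ), ((z.2.2 : ℕ) : ℤ)) z.1.1) := by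
    rintro ⟨⟨t, ht, htd1, htd2, htW⟩, i, j⟩ ⟨⟨t', ht', htd1', htd2', htW'⟩, i', j'⟩ h
    simp only at h
    obtain ⟨a1, a2⟩ := h2 t ht _ (htW i j) _ (hbox i j) rfl
    obtain ⟨b1, b2⟩ := h2 t' ht' _ (htW' i' j') _ (hbox i' j') rfl
    rw [h, b1] at a1
    rw [h, b2] at a2
    have e1 := congrArg Prod.fst a2
    have e2 := congrArg Prod.snd a2
    simp only [Prod.fst_add, Prod.snd_add] at e1 e2
    obtain ⟨x1, hx1⟩ := htd1
    obtain ⟨x2, hx2⟩ := htd2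
    obtain ⟨y1, hy1⟩ := htd1'
    obtain ⟨y2, hy2⟩ := htd2'
    have aux : ∀ (x y : ℤ) (k l : Fin (m + 1)),
        ((m + 1 : ℕ) : ℤ) * y + (k : ℕ) = ((m + 1 : ℕ) : ℤ) * x + (l : ℕ) → k = l := by
      intro x y k l hkl
      have := congrArg (· % ((m + 1 : ℕ) : ℤ)) hkl
      simp only [Int.mul_add_emod_self_left] at this
      rw [Int.emod_eq_of_lt (by omega) (by exact_mod_cast k.2),
        Int.emod_eq_of_lt (by omega) (by exact_mod_cast l.2)] at this
      ext
      exact_mod_cast this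
    have hi : i' = i := aux x1 y1 i' i (by rw [← hy1, ← hx1]; exact e1)
    have hj : j' = j := aux x2 y2 j' j (by rw [← hy2, ← hx2]; exact e2)
    subst hi hj
    have hct : (c t').2 = (c t).2 := add_right_cancel a2
    have : t = t' := by rw [← h1 t ht, ← h1 t' ht', a1, hct]
    subst this
    rfl
  let e : T × (Fin (m + 1) × Fin (m + 1)) ↪ X := ⟨_, hinj⟩
  have hM1 : 1 ≤ M := by omega
  have hMm : m + 1 ≤ M := by omega
  have hcover : (Set.range e)ᶜ.ncard ≤ (box (m + 1)).card * Wᶜ.card := by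
    have : (Set.range e)ᶜ ⊆ ⋃ w ∈ box (m + 1), (act p q w) ⁻¹' ((Wᶜ : Finset X) : Set X) := by
      intro z hz
      by_contra hcon
      have hall : ∀ w ∈ box (m + 1), act p q w z ∈ W := by
        intro w hw
        by_contra hw'
        apply hcon
        simp only [Set.mem_iUnion]
        exact ⟨w, hw, by simpa using hw'⟩
      apply hz
      have hzW : z ∈ W := by
        have := hall 0 (box_zero _)
        rwa [act_zero] at this
      have hgz := hU z (hWU z hzW)
      have aux : ∀ a : ℤ, ∃ i : Fin (m + 1), ((m + 1 : ℕ) : ℤ) ∣ a - (i : ℕ) := by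
        intro a
        have hpos : (0 : ℤ) < ((m + 1 : ℕ) : ℤ) := by positivity
        have n0 := Int.emod_nonneg a hpos.ne'
        have n1 := Int.emod_lt_of_pos a hpos
        refine ⟨⟨(a % ((m + 1 : ℕ) : ℤ)).toNat, by omega⟩, ?_⟩
        simp only
        rw [Int.toNat_of_nonneg n0]
        exact Int.dvd_self_sub_emod
      obtain ⟨i, hi⟩ := aux (c z).2.1
      obtain ⟨j, hj⟩ := aux (c z).2.2
      set w : ℤ × ℤ := (((i : ℕ) : ℤ), ((j : ℕ) : ℤ)) with hw
      have hwb : w ∈ box (m + 1) := hbox i j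
      have htW := hall (-w) (box_neg hwb)
      obtain ⟨_, ht⟩ := h2 z hzW _ htW (-w) (box_neg hwb) rfl
      refine ⟨(⟨act p q (-w) z, htW, ?_, ?_, ?_⟩, i, j), ?_⟩
      · rw [ht]; simpa [hw, sub_eq_add_neg] using hi
      · rw [ht]; simpa [hw, sub_eq_add_neg] using hj
      · intro i' j'
        rw [hgz.1 _ (box_mono hMm (box_neg hwb)) _ (box_mono hMm (hbox i' j'))]
        apply hall
        have := i.2
        have := j.2
        have := i'.2
        have := j'.2
        rw [mem_box]
        simp only [hw, Prod.fst_add, Prod.snd_add, Prod.fst_neg, Prod.snd_neg]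
        omega
      · change act p q w (act p q (-w) z) = z
        rw [hgz.1 _ (box_mono hMm (box_neg hwb)) _ (box_mono hMm hwb), neg_add_cancel, act_zero]
        rfl
    refine (Set.ncard_le_ncard this).trans ?_
    refine (ncard_biUnion_le _ _ (fun _ => Wᶜ.card) ?_).trans ?_
    · intro w _
      rw [ncard_preimage_perm, Set.ncard_coe_finset]
    · simp
  have hWc : (Wᶜ.card : ℝ) ≤ Uᶜ.card + ε * Fintype.card X := by
    have e1 : Wᶜ ⊆ Uᶜ ∪ B := by
      intro x hx
      simp only [hW, Finset.mem_compl, Finset.mem_sdiff, not_and, not_not, Finset.mem_union] at hx ⊢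
      tauto
    have e2 : (Wᶜ.card : ℝ) ≤ Uᶜ.card + B.card := by
      exact_mod_cast (Finset.card_le_card e1).trans (Finset.card_union_le _ _)
    have e3 : (U.card : ℝ) ≤ Fintype.card X := by exact_mod_cast Finset.card_le_univ U
    have : ε * U.card ≤ ε * Fintype.card X := by gcongr
    linarith
  have hcover' : ((Set.range e)ᶜ.ncard : ℝ) ≤
      (box (m + 1)).card * (Uᶜ.card + ε * Fintype.card X) := by
    have : ((Set.range e)ᶜ.ncard : ℝ) ≤ (box (m + 1)).card * Wᶜ.card := by exact_mod_cast hcover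
    refine this.trans ?_
    gcongr
  have hstep : ∀ (t : T) (i j : Fin (m + 1)) (w : ℤ × ℤ), w ∈ box M →
      act p q w (act p q (((i : ℕ) : ℤ), ((j : ℕ) : ℤ)) t.1) =
        act p q ((((i : ℕ) : ℤ), ((j : ℕ) : ℤ)) + w) t.1 := by
    intro t i j w hw
    exact (hU _ (hWU _ t.2.1)).1 _ (box_mono hMm (hbox i j)) _ hw
  obtain ⟨p', q', hc, hp, hq⟩ := torus m p q e (by
    intro t i j hi
    have := hstep t i j (1, 0) (by rw [mem_box]; simp only; omega)
    rw [act_e1] at this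
    change p (act p q (((i : ℕ) : ℤ), ((j : ℕ) : ℤ)) t.1) = act p q _ t.1
    rw [this]
    simp only [Prod.mk_add_mk, add_zero, Fin.val_add_one_of_lt (Fin.lt_last_iff_ne_last.2 hi)]
    push_cast
    rfl) (by
    intro t i j hj
    have := hstep t i j (0, 1) (by rw [mem_box]; simp only; omega)
    rw [act_e2] at this
    change q (act p q (((i : ℕ) : ℤ), ((j : ℕ) : ℤ)) t.1) = act p q _ t.1
    rw [this]
    simp only [Prod.mk_add_mk, add_zero, Fin.val_add_one_of_lt (Fin.lt_last_iff_ne_last.2 hj)]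
    push_cast
    rfl)
  exact ⟨p', q', hc, by linarith, by linarith⟩

lemma free (ε : ℝ) (hε : 0 < ε) : ∃ L C : ℕ, ∀ (X : Type) [Finite X] (p q : Perm X) (E : Set X),
    (∀ x, x ∉ E → p (q x) = q (p x)) →
    (∀ x, x ∉ E → ∀ v ∈ box L, act p q v x = x → v = 0) →
    ∃ p' q' : Perm X, p' * q' = q' * p' ∧
      ((D p p' + D q q' : ℕ) : ℝ) ≤ ε * Nat.card X + C * E.ncard := by
  classical
  obtain ⟨m, hm⟩ := exists_nat_one_div_lt (show 0 < ε / 4 by linarith)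
  set b := (box (m + 1)).card with hb
  have hbpos : 0 < b := by rw [hb, card_box]; positivity
  have hbpos' : (0 : ℝ) < b := by exact_mod_cast hbpos
  obtain ⟨K, hK⟩ := exists_K (m + 1) (ε / 4 / b) (by positivity)
  set M := (m + 1) * K + (m + 1) with hM
  have hneg : ∀ vw : (ℤ × ℤ) × (ℤ × ℤ), ∃ C : ℕ, ∀ (X : Type) [Finite X] (p q : Perm X),
      D (act p q vw.2 * act p q vw.1) (act p q (vw.1 + vw.2)) ≤ C * D (p * q) (q * p) := by
    rintro ⟨v, w⟩
    obtain ⟨C, hC⟩ := negl_of_eq (w := wd w * wd v) (w' := wd (v + w)) (by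
      rw [wd_mul, add_comm])
    refine ⟨C, fun X _ p q => ?_⟩
    have := hC X p q
    rw [map_mul] at this
    exact this
  choose C0 hC0 using hneg
  set CC := ∑ vw ∈ box M ×ˢ box M, C0 vw with hCC
  refine ⟨2 * M, 2 * (b * (CC + 1)), fun X _ p q E hE1 hE2 => ?_⟩
  have := Fintype.ofFinite X
  set U : Finset X := Finset.univ.filter (Good p q M) with hUdef
  have hDE : D (p * q) (q * p) ≤ E.ncard := by
    refine Set.ncard_le_ncard ?_
    intro x hx
    by_contra h
    exact hx (hE1 x h)
  have hUc : Uᶜ.card ≤ (CC + 1) * E.ncard := by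
    rw [← Set.ncard_coe_finset]
    have hsub : ((Uᶜ : Finset X) : Set X) ⊆ (⋃ vw ∈ box M ×ˢ box M,
        {x | (act p q vw.2 * act p q vw.1) x ≠ act p q (vw.1 + vw.2) x}) ∪ E := by
      intro x hx
      by_contra hcon
      rw [Set.mem_union, not_or] at hcon
      have hmul : ∀ v ∈ box M, ∀ w ∈ box M,
          act p q w (act p q v x) = act p q (v + w) x := by
        intro v hv w hw
        by_contra h
        apply hcon.1
        simp only [Set.mem_iUnion]
        exact ⟨(v, w), Finset.mem_product.2 ⟨hv, hw⟩, h⟩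
      have hg : Good p q M x := by
        refine ⟨hmul, fun v hv w hw h => ?_⟩
        have h3 := hmul v hv (-w) (box_neg hw)
        rw [h, hmul w hw (-w) (box_neg hw), add_neg_cancel, act_zero] at h3
        have h4 := hE2 x hcon.2 (v + -w) (by
          rw [two_mul]; exact box_add hv (box_neg hw)) h3.symm
        rwa [← sub_eq_add_neg, sub_eq_zero] at h4
      simp [hUdef, hg] at hx
    refine (Set.ncard_le_ncard hsub).trans ((Set.ncard_union_le _ _).trans ?_)
    rw [add_mul, one_mul]
    gcongr
    refine (ncard_biUnion_le _ _ (fun vw => C0 vw * E.ncard) ?_).trans ?_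
    · intro vw _
      exact (hC0 vw X p q).trans (Nat.mul_le_mul_left _ hDE)
    · rw [hCC, Finset.sum_mul]
  obtain ⟨p', q', hc, hp, hq⟩ := tiled p q m K M le_rfl (ε / 4 / b) (by positivity) hK U
    (fun x hx => (Finset.mem_filter.1 hx).2)
  refine ⟨p', q', hc, ?_⟩
  rw [← hb] at hp hq
  have hUc' : (Uᶜ.card : ℝ) ≤ (CC + 1) * E.ncard := by exact_mod_cast hUc
  rw [← Nat.card_eq_fintype_card] at hp hq
  have hX : (0 : ℝ) ≤ Nat.card X := by positivity
  have k1 : (b : ℝ) * (Uᶜ.card + ε / 4 / b * Nat.card X) ≤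
      b * ((CC + 1) * E.ncard) + ε / 4 * Nat.card X := by
    have : (b : ℝ) * (ε / 4 / b * Nat.card X) = ε / 4 * Nat.card X := by field_simp
    rw [mul_add, this]
    gcongr
  have k2 : (Nat.card X : ℝ) / (m + 1) ≤ ε / 4 * Nat.card X := by
    rw [div_eq_mul_one_div, mul_comm]
    gcongr
  push_cast
  linarith

/-- Gluing permutations of the fibres. -/
def glue {X T : Type} (κ : X → T) (f : ∀ τ, Perm {x // κ x = τ}) : Perm X :=
  (Equiv.sigmaFiberEquiv κ).permCongr (Equiv.Perm.sigmaCongrRight f)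

lemma glue_apply {X T : Type} (κ : X → T) (f : ∀ τ, Perm {x // κ x = τ}) {τ : T}
    (x : {x // κ x = τ}) : glue κ f x.1 = (f τ x).1 := by
  obtain ⟨x, rfl⟩ := x
  rfl

lemma sum_fiber {X T : Type} [Finite X] [Fintype T] (κ : X → T) (A : Set X) :
    ∑ τ, {s : {x // κ x = τ} | s.1 ∈ A}.ncard = A.ncard := by
  classical
  have := Fintype.ofFinite X
  rw [← Nat.card_coe_set_eq A, Nat.card_congr (Equiv.sigmaFiberEquiv (fun a : A => κ a.1)).symm,
    Nat.card_sigma]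
  refine Finset.sum_congr rfl fun τ _ => ?_
  rw [← Nat.card_coe_set_eq]
  refine Nat.card_congr ⟨fun s => ⟨⟨s.1.1, s.2⟩, s.1.2⟩, fun a => ⟨⟨a.1.1, a.2⟩, a.1.2⟩, ?_, ?_⟩
  · intro s; rfl
  · intro s; rfl

lemma make_inv {X T : Type} [Finite X] (κ : X → T) (p : Perm X) :
    ∃ p1 : Perm X, (∀ x, κ (p1 x) = κ x) ∧ D p p1 ≤ {x | κ (p x) ≠ κ x}.ncard := by
  classical
  have := Fintype.ofFinite X
  have h : ∀ τ, ∃ f : Perm {x // κ x = τ}, ∀ x, κ (p x.1) = τ → (f x).1 = p x.1 := by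
    intro τ
    let e : {s : {x // κ x = τ} // κ (p s.1) = τ} ≃ {s : {x // κ x = τ} // κ (p.symm s.1) = τ} :=
      ⟨fun s => ⟨⟨p s.1.1, s.2⟩, by simpa using s.1.2⟩,
       fun s => ⟨⟨p.symm s.1.1, s.2⟩, by simpa using s.1.2⟩,
       fun s => by ext; simp, fun s => by ext; simp⟩
    refine ⟨e.extendSubtype, fun x hx => ?_⟩
    rw [Equiv.extendSubtype_apply_of_mem e x hx]
    rfl
  choose f hf using h
  refine ⟨glue κ f, fun x => ?_, Set.ncard_le_ncard ?_⟩
  · rw [glue_apply κ f ⟨x, rfl⟩]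
    exact (f (κ x) ⟨x, rfl⟩).2
  · intro x hx h
    apply hx
    rw [glue_apply κ f ⟨x, rfl⟩, hf _ _ h]

lemma ev_equivariant {S X : Type} (f : S → X) (p q : Perm S) (p1 q1 : Perm X)
    (hp : ∀ s, f (p s) = p1 (f s)) (hq : ∀ s, f (q s) = q1 (f s)) (w : FreeGroup Bool) :
    ∀ s, f (ev p q w s) = ev p1 q1 w (f s) := by
  induction w using FreeGroup.induction_on with
  | C1 => intro s; simp
  | of b => intro s; cases b <;> simp [ev, hp, hq]
  | inv_of b ih =>
    intro s
    rw [map_inv, map_inv, Perm.eq_inv_iff_eq, ← ih]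
    simp
  | mul x y hx hy =>
    intro s
    rw [map_mul, map_mul, Perm.mul_apply, Perm.mul_apply, hx, hy]

lemma main_lemma (ε : ℝ) (hε : 0 < ε) : ∃ C : ℕ, ∀ (X : Type) [Finite X] (p q : Perm X),
    ∃ p' q' : Perm X, p' * q' = q' * p' ∧
      ((D p p' + D q q' : ℕ) : ℝ) ≤ ε * Nat.card X + C * D (p * q) (q * p) := by
  classical
  obtain ⟨L, Cf, hfree⟩ := free ε hε
  have hper : ∀ v : ℤ × ℤ, ∃ C : ℕ, v ≠ 0 → ∀ (X : Type) [Finite X] (p q : Perm X),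
    ∃ p' q' : Perm X, p' * q' = q' * p' ∧
      D p p' + D q q' ≤ C * (D (p * q) (q * p) + D (ev p q (wd v)) 1) := by
    intro v
    by_cases hv : v = 0
    · exact ⟨0, fun h => absurd hv h⟩
    · obtain ⟨C, hC⟩ := periodic v hv
      exact ⟨C, fun _ => hC⟩
  choose Cv hCv using hper
  have hn1 : ∀ v : ℤ × ℤ, ∃ C : ℕ, ∀ (X : Type) [Finite X] (p q : Perm X),
      D (act p q v * p) (p * act p q v) ≤ C * D (p * q) (q * p) := by
    intro v
    obtain ⟨C, hC⟩ := negl_of_eq (w := wd v * ga) (w' := ga * wd v) (by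
      rw [← wd_ga, wd_mul, wd_mul, add_comm])
    refine ⟨C, fun X _ p q => ?_⟩
    have := hC X p q
    rw [map_mul, map_mul, ev_ga] at this
    exact this
  have hn2 : ∀ v : ℤ × ℤ, ∃ C : ℕ, ∀ (X : Type) [Finite X] (p q : Perm X),
      D (act p q v * q) (q * act p q v) ≤ C * D (p * q) (q * p) := by
    intro v
    obtain ⟨C, hC⟩ := negl_of_eq (w := wd v * gb) (w' := gb * wd v) (by
      rw [← wd_gb, wd_mul, wd_mul, add_comm])
    refine ⟨C, fun X _ p q => ?_⟩
    have := hC X p q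
    rw [map_mul, map_mul, ev_gb] at this
    exact this
  choose N1 hN1 using hn1
  choose N2 hN2 using hn2
  have hl : ∀ v : ℤ × ℤ, ∃ C : ℕ, ∀ (X : Type) [Finite X] (p q p1 q1 : Perm X),
      D (act p q v) (act p1 q1 v) ≤ C * (D p p1 + D q q1) := fun v => lip (wd v)
  choose Cl hCl using hl
  set S1 := ∑ v ∈ box L, N1 v with hS1
  set S2 := ∑ v ∈ box L, N2 v with hS2
  set S3 := ∑ v ∈ box L, Cl v with hS3
  set S4 := ∑ v ∈ box L, Cv v with hS4
  set C2 := 2 * (S1 + S2) + 1 + S3 * (S1 + S2) with hC2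
  refine ⟨S1 + S2 + (Cf + 2 * S4) * C2, fun X _ p q => ?_⟩
  set t := D (p * q) (q * p) with ht
  have := Fintype.ofFinite X
  let κ : X → Set ↥(box L) := fun x => {v | act p q v.1 x = x}
  have hbad : ∀ (r : Perm X) (Nr : ℤ × ℤ → ℕ),
      (∀ v, D (act p q v * r) (r * act p q v) ≤ Nr v * t) →
      {x | κ (r x) ≠ κ x}.ncard ≤ (∑ v ∈ box L, Nr v) * t := by
    intro r Nr hr
    have hsub : {x | κ (r x) ≠ κ x} ⊆
        ⋃ v ∈ box L, {x | (act p q v * r) x ≠ (r * act p q v) x} := by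
      intro x hx
      by_contra hcon
      apply hx
      ext ⟨v, hv⟩
      have : act p q v (r x) = r (act p q v x) := by
        by_contra h
        apply hcon
        simp only [Set.mem_iUnion]
        exact ⟨v, hv, h⟩
      change act p q v (r x) = r x ↔ act p q v x = x
      rw [this]
      exact r.injective.eq_iff
    refine (Set.ncard_le_ncard hsub).trans ?_
    rw [Finset.sum_mul]
    exact ncard_biUnion_le _ _ _ (fun v _ => hr v)
  obtain ⟨p1, hp1, hp1D⟩ := make_inv κ p
  obtain ⟨q1, hq1, hq1D⟩ := make_inv κ q
  replace hp1D := hp1D.trans (hbad p N1 (fun v => hN1 v X p q))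
  replace hq1D := hq1D.trans (hbad q N2 (fun v => hN2 v X p q))
  rw [← hS1] at hp1D
  rw [← hS2] at hq1D
  -- the exceptional set
  let E : Set X := {x | (p1 * q1) x ≠ (q1 * p1) x} ∪
    ⋃ v ∈ box L, {x | act p q v x ≠ act p1 q1 v x}
  have hE : E.ncard ≤ C2 * t := by
    have e1 : D (p1 * q1) (q1 * p1) ≤ (2 * (S1 + S2) + 1) * t := by
      have a1 := D_tri (p1 * q1) (p * q) (q1 * p1)
      have a2 := D_tri (p * q) (q * p) (q1 * p1)
      have a3 := D_mul p1 q1 p q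
      have a4 := D_mul q p q1 p1
      rw [D_comm p1, D_comm q1] at a3
      calc _ ≤ 2 * (D p p1 + D q q1) + t := by omega
        _ ≤ 2 * (S1 * t + S2 * t) + t := by gcongr
        _ = _ := by ring
    have e2 : (⋃ v ∈ box L, {x | act p q v x ≠ act p1 q1 v x}).ncard ≤ S3 * (S1 + S2) * t := by
      refine (ncard_biUnion_le _ _ (fun v => Cl v * (D p p1 + D q q1))
        (fun v _ => hCl v X p q p1 q1)).trans ?_
      rw [← Finset.sum_mul, mul_assoc, add_mul]
      gcongr
    calc _ ≤ _ := Set.ncard_union_le _ _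
      _ ≤ (2 * (S1 + S2) + 1) * t + S3 * (S1 + S2) * t := add_le_add e1 e2
      _ = _ := by rw [hC2]; ring
  have hE1 : ∀ x, x ∉ E → p1 (q1 x) = q1 (p1 x) := by
    intro x hx
    by_contra h
    exact hx (Or.inl h)
  have hE2 : ∀ x, x ∉ E → ∀ v ∈ box L, act p q v x = act p1 q1 v x := by
    intro x hx v hv
    by_contra h
    apply hx
    right
    simp only [Set.mem_iUnion]
    exact ⟨v, hv, h⟩
  have hclass : ∀ τ : Set ↥(box L), ∃ f : Perm {x // κ x = τ} × Perm {x // κ x = τ},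
      f.1 * f.2 = f.2 * f.1 ∧
      (({s : {x // κ x = τ} | s.1 ∈ {x | (f.1 s).1 ≠ p1 s.1}}.ncard +
        {s : {x // κ x = τ} | s.1 ∈ {x | (f.2 s).1 ≠ q1 s.1}}.ncard : ℕ) : ℝ) ≤
        ε * {s : {x // κ x = τ} | s.1 ∈ (Set.univ : Set X)}.ncard +
        (Cf + 2 * S4 : ℕ) * {s : {x // κ x = τ} | s.1 ∈ E}.ncard := by
    intro τ
    let pt : Perm {x // κ x = τ} := p1.subtypePerm (fun x => by rw [hp1])
    let qt : Perm {x // κ x = τ} := q1.subtypePerm (fun x => by rw [hq1])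
    let Et : Set {x // κ x = τ} := {s | s.1 ∈ E}
    have hact : ∀ v s, (act pt qt v s).1 = act p1 q1 v s.1 := fun v s =>
      ev_equivariant Subtype.val pt qt p1 q1 (fun _ => rfl) (fun _ => rfl) (wd v) s
    have hEt : ∀ s, s ∉ Et → pt (qt s) = qt (pt s) := by
      intro s hs
      ext
      exact hE1 s.1 hs
    have hDs : ∀ f g : Perm {x // κ x = τ}, {s : {x // κ x = τ} | (f s).1 ≠ (g s).1}.ncard
        = D g f := by
      intro f g
      rw [D_comm]
      unfold D
      congr 1
      ext s
      exact not_congr Subtype.ext_iff.symm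
    have huniv : {s : {x // κ x = τ} | s.1 ∈ (Set.univ : Set X)}.ncard =
        Nat.card {x // κ x = τ} := by
      rw [← Set.ncard_univ]; congr 1
    suffices hs : ∃ f1 f2 : Perm {x // κ x = τ}, f1 * f2 = f2 * f1 ∧
        ((D pt f1 + D qt f2 : ℕ) : ℝ) ≤ ε * Nat.card {x // κ x = τ} +
          (Cf + 2 * S4 : ℕ) * Et.ncard by
      obtain ⟨f1, f2, hc, hb⟩ := hs
      refine ⟨(f1, f2), hc, ?_⟩
      rw [huniv]
      rw [← hDs, ← hDs] at hb
      exact hb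
    by_cases hτ : ∃ v ∈ τ, v.1 ≠ 0
    · obtain ⟨⟨v, hv⟩, hvτ, hv0⟩ := hτ
      obtain ⟨f1, f2, hc, hb⟩ := hCv v hv0 _ pt qt
      refine ⟨f1, f2, hc, ?_⟩
      have d1 : D (pt * qt) (qt * pt) ≤ Et.ncard := by
        refine Set.ncard_le_ncard ?_
        intro s hs
        by_contra h
        exact hs (hEt s h)
      have d2 : D (ev pt qt (wd v)) 1 ≤ Et.ncard := by
        refine Set.ncard_le_ncard ?_
        intro s hs
        by_contra h
        apply hs
        have h2 := hE2 s.1 h v hv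
        have h3 : (⟨v, hv⟩ : ↥(box L)) ∈ κ s.1 := by rw [s.2]; exact hvτ
        have h4 : act p q v s.1 = s.1 := h3
        ext
        rw [← hact v s] at h2
        exact h2.symm.trans h4
      have d3 : Cv v ≤ S4 := Finset.single_le_sum (f := Cv) (fun _ _ => Nat.zero_le _) hv
      have d4 : D pt f1 + D qt f2 ≤ (Cf + 2 * S4) * Et.ncard := by
        calc _ ≤ _ := hb
          _ ≤ S4 * (Et.ncard + Et.ncard) := by gcongr
          _ ≤ Cf * Et.ncard + S4 * (Et.ncard + Et.ncard) := Nat.le_add_left _ _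
          _ = _ := by ring
      have d5 : ((D pt f1 + D qt f2 : ℕ) : ℝ) ≤ (Cf + 2 * S4 : ℕ) * Et.ncard := by
        exact_mod_cast d4
      have : 0 ≤ ε * Nat.card {x // κ x = τ} := by positivity
      linarith
    · obtain ⟨f1, f2, hc, hb⟩ := hfree _ pt qt Et hEt (by
        intro s hs v hv hvs
        by_contra hv0
        apply hτ
        refine ⟨⟨v, hv⟩, ?_, hv0⟩
        rw [← s.2]
        change act p q v s.1 = s.1
        rw [hE2 s.1 hs v hv, ← hact, hvs])
      refine ⟨f1, f2, hc, hb.trans ?_⟩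
      gcongr
      exact Nat.le_add_right _ _
  choose f hfc hfb using hclass
  let p' := glue κ (fun τ => (f τ).1)
  let q' := glue κ (fun τ => (f τ).2)
  refine ⟨p', q', ?_, ?_⟩
  · ext x
    have h1 := glue_apply κ (fun τ => (f τ).1) (⟨x, rfl⟩ : {y // κ y = κ x})
    have h2 := glue_apply κ (fun τ => (f τ).2) (⟨x, rfl⟩ : {y // κ y = κ x})
    change glue κ _ (glue κ _ x) = glue κ _ (glue κ _ x)
    simp only at h1 h2
    rw [h1, h2, glue_apply, glue_apply]
    exact congrArg (fun g : Perm {y // κ y = κ x} => (g ⟨x, rfl⟩).1) (hfc (κ x))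
  · have g1 : D p1 p' = ∑ τ, {s : {x // κ x = τ} | s.1 ∈ {x | ((f τ).1 s).1 ≠ p1 s.1}}.ncard := by
      unfold D
      rw [← sum_fiber κ]
      refine Finset.sum_congr rfl fun τ _ => ?_
      congr 1
      ext s
      change p1 s.1 ≠ glue κ _ s.1 ↔ _
      rw [glue_apply]
      exact ne_comm
    have g2 : D q1 q' = ∑ τ, {s : {x // κ x = τ} | s.1 ∈ {x | ((f τ).2 s).1 ≠ q1 s.1}}.ncard := by
      unfold D
      rw [← sum_fiber κ]
      refine Finset.sum_congr rfl fun τ _ => ?_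
      congr 1
      ext s
      change q1 s.1 ≠ glue κ _ s.1 ↔ _
      rw [glue_apply]
      exact ne_comm
    have g3 : ((D p1 p' + D q1 q' : ℕ) : ℝ) ≤
        ε * Nat.card X + (Cf + 2 * S4 : ℕ) * E.ncard := by
      rw [g1, g2, ← Finset.sum_add_distrib, ← Set.ncard_univ, ← sum_fiber κ Set.univ,
        ← sum_fiber κ E]
      rw [Nat.cast_sum, Nat.cast_sum, Nat.cast_sum, Finset.mul_sum, Finset.mul_sum,
        ← Finset.sum_add_distrib]
      exact Finset.sum_le_sum fun τ _ => hfb τ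
    have g4 : (((Cf + 2 * S4) * E.ncard : ℕ) : ℝ) ≤ ((Cf + 2 * S4) * (C2 * t) : ℕ) := by
      exact_mod_cast Nat.mul_le_mul_left _ hE
    have g5 : ((D p p' + D q q' : ℕ) : ℝ) ≤
        (S1 * t + S2 * t + (D p1 p' + D q1 q') : ℕ) := by
      have a1 := D_tri p p1 p'
      have a2 := D_tri q q1 q'
      exact_mod_cast (by omega)
    push_cast at g3 g4 g5 ⊢
    linarith

lemma dH_eq {n : ℕ} (p q : Perm (Fin n)) : dH p q = (D p q : ℝ) / n := by
  unfold dH D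
  rw [← Set.ncard_coe_finset]
  simp

end ACN

/-- Almost commuting permutations are near commuting permutations. -/
theorem almost_commuting_near_commuting :
    ∀ ε : ℝ, 0 < ε → ∃ δ : ℝ, 0 < δ ∧
      ∀ (n : ℕ) (p q : Equiv.Perm (Fin n)),
        dH (p * q) (q * p) < δ →
        ∃ p' q' : Equiv.Perm (Fin n),
          p' * q' = q' * p' ∧ dH p p' < ε ∧ dH q q' < ε := by
  intro ε hε
  obtain ⟨C, hC⟩ := ACN.main_lemma (ε / 2) (by linarith)
  refine ⟨ε / 2 / (C + 1), by positivity, fun n p q h => ?_⟩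
  rcases Nat.eq_zero_or_pos n with rfl | hn
  · exact ⟨1, 1, rfl, by simpa [dH] using hε, by simpa [dH] using hε⟩
  have hn' : (0 : ℝ) < n := by exact_mod_cast hn
  obtain ⟨p', q', hc, hb⟩ := hC (Fin n) p q
  rw [ACN.dH_eq, div_lt_iff₀ hn'] at h
  rw [Nat.card_eq_fintype_card, Fintype.card_fin] at hb
  set t : ℝ := (ACN.D (p * q) (q * p) : ℝ)
  have ht : 0 ≤ t := Nat.cast_nonneg _
  have h1 : (C + 1) * t < ε / 2 * n := by
    have : (C + 1 : ℝ) * (ε / 2 / (C + 1) * n) = ε / 2 * n := by field_simp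
    rw [← this]
    gcongr
  have hp : (0 : ℝ) ≤ ACN.D p p' := Nat.cast_nonneg _
  have hq : (0 : ℝ) ≤ ACN.D q q' := Nat.cast_nonneg _
  push_cast at hb
  refine ⟨p', q', hc, ?_, ?_⟩
  · rw [ACN.dH_eq, div_lt_iff₀ hn']; linarith
  · rw [ACN.dH_eq, div_lt_iff₀ hn']; linarith
end

section
/- For every k ≥ 2 and every real ε > 0 there exists δ > 0 such that for every natural number n and every tuple of permutations p_1, …, p_k ∈ Sym(n) satisfying d_H(p_i∘p_j, p_j∘p_i) < δ for all i, j ∈ {1, …, k}, there exist permutations q_1, …, q_k ∈ Sym(n) that pairwise commute (q_i∘q_j = q_j∘q_i for all i, j) and satisfy d_H(p_i, q_i) < ε for every i. -/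
open Filter Topology

open scoped Pointwise

/-- Finite quotients with almost invariant transversals. -/
def HasTiles (G : Type) [CommGroup G] : Prop :=
  ∀ (S : Finset G) (ε : ℝ), 0 < ε → ∃ (Q : Type) (_ : CommGroup Q) (_ : Finite Q)
    (π : G →* Q) (σ : Q → G), (∀ q, π (σ q) = q) ∧
    (Set.ncard {q | ∃ s ∈ S, σ q * s ≠ σ (q * π s)} : ℝ) ≤ ε * Nat.card Q

theorem HasTiles.of_equiv {G H : Type} [CommGroup G] [CommGroup H] (e : G ≃* H)
    (hH : HasTiles H) : HasTiles G := by
  classical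
  intro S ε hε
  obtain ⟨Q, i1, i2, π, σ, h1, h2⟩ := hH (S.image e) ε hε
  refine ⟨Q, i1, i2, π.comp e.toMonoidHom, fun q => e.symm (σ q), by simp [h1], ?_⟩
  refine le_trans ?_ h2
  norm_cast
  apply Set.ncard_le_ncard _ (Set.toFinite _)
  rintro q ⟨s, hs, h⟩
  refine ⟨e s, Finset.mem_image_of_mem _ hs, ?_⟩
  contrapose! h
  apply e.injective
  simpa using h

theorem HasTiles.of_finite (G : Type) [CommGroup G] [Finite G] : HasTiles G := by
  intro S ε hε
  refine ⟨G, inferInstance, inferInstance, MonoidHom.id G, id, by simp, ?_⟩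
  simp
  positivity

theorem HasTiles.prod {G H : Type} [CommGroup G] [CommGroup H] (hG : HasTiles G)
    (hH : HasTiles H) : HasTiles (G × H) := by
  classical
  intro S ε hε
  obtain ⟨Q, i1, i2, π, σ, h1, h2⟩ := hG (S.image Prod.fst) (ε/2) (by positivity)
  obtain ⟨Q', i1', i2', π', σ', h1', h2'⟩ := hH (S.image Prod.snd) (ε/2) (by positivity)
  refine ⟨Q × Q', inferInstance, inferInstance, π.prodMap π', fun q => (σ q.1, σ' q.2), ?_, ?_⟩
  · rintro ⟨a, b⟩; simp [h1, h1']
  set B := {q | ∃ s ∈ S.image Prod.fst, σ q * s ≠ σ (q * π s)}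
  set B' := {q | ∃ s ∈ S.image Prod.snd, σ' q * s ≠ σ' (q * π' s)}
  have hsub : {q : Q × Q' | ∃ s ∈ S, (σ q.1, σ' q.2) * s ≠
      (σ (q * π.prodMap π' s).1, σ' (q * π.prodMap π' s).2)} ⊆ B ×ˢ Set.univ ∪ Set.univ ×ˢ B' := by
    rintro ⟨a, b⟩ ⟨⟨s, t⟩, hs, h⟩
    by_contra hc
    simp only [Set.mem_union, Set.mem_prod, Set.mem_univ, and_true, true_and, not_or] at hc
    obtain ⟨c1, c2⟩ := hc
    apply h
    have e1 : σ a * s = σ (a * π s) := by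
      by_contra h'; exact c1 ⟨s, Finset.mem_image_of_mem Prod.fst hs, h'⟩
    have e2 : σ' b * t = σ' (b * π' t) := by
      by_contra h'; exact c2 ⟨t, Finset.mem_image_of_mem Prod.snd hs, h'⟩
    simp [e1, e2]
  have hc := (Set.ncard_le_ncard hsub (Set.toFinite _)).trans (Set.ncard_union_le _ _)
  rw [Set.ncard_prod, Set.ncard_prod, Set.ncard_univ, Set.ncard_univ] at hc
  have hc' : ((Set.ncard {q : Q × Q' | ∃ s ∈ S, (σ q.1, σ' q.2) * s ≠
      (σ (q * π.prodMap π' s).1, σ' (q * π.prodMap π' s).2)} : ℕ) : ℝ) ≤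
      B.ncard * Nat.card Q' + Nat.card Q * B'.ncard := by exact_mod_cast hc
  refine hc'.trans ?_
  rw [Nat.card_prod]
  push_cast
  have p1 : (0:ℝ) ≤ Nat.card Q := by positivity
  have p2 : (0:ℝ) ≤ Nat.card Q' := by positivity
  nlinarith [mul_le_mul_of_nonneg_right h2 p2, mul_le_mul_of_nonneg_left h2' p1]

theorem HasTiles.int : HasTiles (Multiplicative ℤ) := by
  classical
  intro S ε hε
  set m : ℕ := S.sup (fun s => (Multiplicative.toAdd s).natAbs) with hm
  obtain ⟨N, hN⟩ := exists_nat_gt ((2 * m : ℝ) / ε)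
  have hN0 : 0 < N := by
    have : (0:ℝ) < N := lt_of_le_of_lt (by positivity) hN
    exact_mod_cast this
  have : NeZero N := ⟨hN0.ne'⟩
  refine ⟨Multiplicative (ZMod N), inferInstance, inferInstance,
    AddMonoidHom.toMultiplicative (Int.castAddHom (ZMod N)),
    fun q => Multiplicative.ofAdd ((Multiplicative.toAdd q).val : ℤ), ?_, ?_⟩
  · intro q
    apply Multiplicative.toAdd.injective
    simp
  have hsub : {q : Multiplicative (ZMod N) | ∃ s ∈ S,
      Multiplicative.ofAdd ((Multiplicative.toAdd q).val : ℤ) * s ≠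
      Multiplicative.ofAdd ((Multiplicative.toAdd
        (q * AddMonoidHom.toMultiplicative (Int.castAddHom (ZMod N)) s)).val : ℤ)} ⊆
      (((Finset.range m ∪ Finset.Ico (N - m) N).image
        (fun j : ℕ => Multiplicative.ofAdd (j : ZMod N)) : Finset _) : Set _) := by
    rintro q ⟨s, hs, h⟩
    have hsm : (Multiplicative.toAdd s).natAbs ≤ m :=
      Finset.le_sup (f := fun s => (Multiplicative.toAdd s).natAbs) hs
    have hlt := ZMod.val_lt (Multiplicative.toAdd q)
    rw [Finset.coe_image]
    refine ⟨(Multiplicative.toAdd q).val, ?_, ?_⟩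
    · by_contra hc
      simp only [Finset.coe_union, Finset.coe_range, Finset.coe_Ico, Set.mem_union, Set.mem_Iio,
        Set.mem_Ico, not_or, not_and, not_lt] at hc
      apply h
      apply Multiplicative.toAdd.injective
      obtain ⟨c1, c2⟩ := hc
      have c3 : (Multiplicative.toAdd q).val < N - m := by
        by_contra h'; have := c2 (by omega); omega
      simp only [toAdd_mul, toAdd_ofAdd]
      set z := Multiplicative.toAdd s
      set a := (Multiplicative.toAdd q)
      have : (a + ((z : ℤ) : ZMod N)) = (((a.val : ℤ) + z : ℤ) : ZMod N) := by simp
      have h2 : ((a + ((z : ℤ) : ZMod N)).val : ℤ) = a.val + z := by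
        rw [this, ZMod.val_intCast, Int.emod_eq_of_lt] <;> omega
      exact h2.symm
    · simp
  have hc := Set.ncard_le_ncard hsub (Set.toFinite _)
  rw [Set.ncard_coe_finset] at hc
  have h1 := hc.trans (Finset.card_image_le.trans (Finset.card_union_le _ _))
  rw [Finset.card_range, Nat.card_Ico] at h1
  have h2 : ((Set.ncard _ : ℕ) : ℝ) ≤ ((2 * m : ℕ) : ℝ) := Nat.cast_le.2 (h1.trans (by omega))
  refine h2.trans ?_
  rw [div_lt_iff₀ hε] at hN
  have : (Nat.card (Multiplicative (ZMod N)) : ℝ) = N := by simp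
  rw [this]; push_cast; linarith

theorem HasTiles.pi_int (n : ℕ) : HasTiles (Fin n → Multiplicative ℤ) := by
  induction n with
  | zero => exact HasTiles.of_finite _
  | succ n ih =>
    refine HasTiles.of_equiv (H := Multiplicative ℤ × (Fin n → Multiplicative ℤ)) ?_
      (HasTiles.int.prod ih)
    exact { toFun := fun f => (f 0, fun i => f i.succ)
            invFun := fun f => Fin.cons f.1 f.2
            left_inv := fun f => by ext i; refine Fin.cases ?_ (fun j => ?_) i <;> simp
            right_inv := fun f => by simp
            map_mul' := fun f g => rfl }

theorem HasTiles.of_fg (G : Type) [CommGroup G] [Group.FG G] : HasTiles G := by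
  obtain ⟨ι, j, _, _, p, hp, e, ⟨f⟩⟩ := CommGroup.equiv_free_prod_prod_multiplicative_zmod G
  have : ∀ i, NeZero (p i ^ e i) := fun i => ⟨pow_ne_zero _ (hp i).ne_zero⟩
  refine HasTiles.of_equiv f (HasTiles.prod ?_ (HasTiles.of_finite _))
  refine HasTiles.of_equiv ?_ (HasTiles.pi_int (Fintype.card j))
  exact { (Equiv.arrowCongr (Fintype.equivFin j) (Equiv.refl _)) with map_mul' := fun f g => rfl }

/-- Subexponential growth of abelian groups. -/
theorem exists_pow_card_lt {A : Type} [CommGroup A] [DecidableEq A] (U : Finset A) (η : ℝ)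
    (hη : 0 < η) : ∃ r : ℕ, (((U : Finset A) ^ r).card : ℝ) < (1 + η) ^ r := by
  have hb : ∀ r : ℕ, (U ^ r).card ≤ (r + 1) ^ U.card := by
    intro r
    have hsub : U ^ r ⊆ (Finset.univ : Finset (U → Fin (r+1))).image
        (fun f => ∏ u : U, (u : A) ^ (f u : ℕ)) := by
      induction r with
      | zero =>
        intro a ha
        rw [pow_zero, Finset.mem_one] at ha
        subst ha
        simp
      | succ r ih =>
        intro a ha
        rw [pow_succ, Finset.mem_mul] at ha
        obtain ⟨b, hb, u, hu, rfl⟩ := ha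
        obtain ⟨f, -, rfl⟩ := Finset.mem_image.1 (ih hb)
        refine Finset.mem_image.2 ⟨fun v => if v = ⟨u, hu⟩ then (f v).succ else (f v).castSucc,
          Finset.mem_univ _, ?_⟩
        have : ∀ v : U, (v : A) ^ (((if v = ⟨u, hu⟩ then (f v).succ else (f v).castSucc) :
            Fin (r+2)) : ℕ) = (v : A) ^ (f v : ℕ) * (if v = ⟨u, hu⟩ then (v : A) else 1) := by
          intro v; split_ifs <;> simp [pow_succ]
        simp only [this, Finset.prod_mul_distrib, Finset.prod_ite_eq', Finset.mem_univ, if_true]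
    refine (Finset.card_le_card hsub).trans (Finset.card_image_le.trans ?_)
    simp
  have ht := tendsto_pow_const_div_const_pow_of_one_lt U.card (r := 1 + η) (by linarith)
  have ht2 := (ht.comp (tendsto_add_atTop_nat 1)).eventually (gt_mem_nhds (show (0:ℝ) < (1+η)⁻¹ by positivity))
  obtain ⟨r, hr⟩ := ht2.exists
  refine ⟨r, lt_of_le_of_lt (b := ((r + 1 : ℕ) : ℝ) ^ U.card) (by exact_mod_cast hb r) ?_⟩
  have hpos : (0:ℝ) < 1 + η := by linarith
  simp only [Function.comp] at hr
  rw [div_lt_iff₀ (by positivity), pow_succ] at hr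
  calc _ < _ := hr
    _ = _ := by field_simp

/-- `x` looks locally like the base point of `A ⧸ Λ`, on the window `W`. -/
def GoodPt {A X : Type} [CommGroup A] (ρ : A → Equiv.Perm X) (Λ : Subgroup A) (W : Finset A)
    (x : X) : Prop :=
  (∀ a ∈ W, ∀ b ∈ W, ρ a (ρ b x) = ρ (a * b) x) ∧ ∀ w ∈ W, (ρ w x = x ↔ w ∈ Λ)

theorem card_arith (ε : ℝ) (hε : 0 ≤ ε) (pb pf p qb c q : ℕ) (h1 : pb = qb * c)
    (h2 : pf = q * c) (h3 : pf ≤ p) (h4 : (qb : ℝ) ≤ ε * q) : (pb : ℝ) ≤ ε * p := by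
  have h3' : (pf : ℝ) ≤ p := by exact_mod_cast h3
  calc (pb : ℝ) = qb * c := by rw [h1]; push_cast; ring
    _ ≤ ε * q * c := by gcongr
    _ = ε * pf := by rw [h2]; push_cast; ring
    _ ≤ ε * p := by gcongr

set_option maxHeartbeats 1000000 in
open Classical in
theorem piece_lemma {A X : Type} [CommGroup A] (Λ : Subgroup A) {Q : Type}
    [CommGroup Q] [Finite Q] (π : A ⧸ Λ →* Q) (σ : Q → A ⧸ Λ) (hσ : ∀ q, π (σ q) = q)
    (Sg : Finset A) (ε : ℝ)
    (hbad : (Set.ncard {q | ∃ s ∈ Sg, σ q * (s : A ⧸ Λ) ≠ σ (q * π s)} : ℝ) ≤ ε * Nat.card Q)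
    (U : Finset A) (hU1 : 1 ∈ U) (hUinv : ∀ u ∈ U, u⁻¹ ∈ U) (hSg : Sg ⊆ U)
    (hUD : ∀ q q' : Q, ∃ u ∈ U, (u : A ⧸ Λ) = (σ q')⁻¹ * σ q)
    (r : ℕ) (ρ : A → Equiv.Perm X) (x : X) (hx : GoodPt ρ Λ (U ^ (2 * r + 2)) x)
    (P : Finset X) (hP : ∀ p ∈ P, ∃ v ∈ U ^ r, p = ρ v x) :
    ∃ f : A → X → X, (∀ a, ∀ p ∈ P, f a p ∈ P) ∧ (∀ p ∈ P, f 1 p = p) ∧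
      (∀ a b, ∀ p ∈ P, f (a * b) p = f a (f b p)) ∧
      ((P.filter fun p => ∃ s ∈ Sg, f s p ≠ ρ s p).card : ℝ) ≤
        ε * P.card + (P.filter fun p => ∃ u ∈ U, ρ u p ∉ P).card := by
  choose! v hv hvx using hP
  obtain ⟨hx1, hx2⟩ := hx
  have hmono : ∀ m n : ℕ, m ≤ n → U ^ m ⊆ U ^ n := fun m n h => Finset.pow_subset_pow_right hU1 h
  have hinv : ∀ n : ℕ, ∀ a ∈ U ^ n, a⁻¹ ∈ U ^ n := by
    intro n
    induction n with
    | zero => intro a ha; simpa using ha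
    | succ n ih =>
      intro a ha
      rw [pow_succ, Finset.mem_mul] at ha
      obtain ⟨b, hb, u, hu, rfl⟩ := ha
      rw [mul_inv, pow_succ]
      exact Finset.mul_mem_mul (ih b hb) (hUinv u hu)
  have hkey : ∀ a ∈ U ^ (r+1), ∀ b ∈ U ^ (r+1), (ρ a x = ρ b x ↔ (a : A ⧸ Λ) = b) := by
    intro a ha b hb
    have hab : a⁻¹ * b ∈ U ^ (2 * r + 2) := by
      have : 2 * r + 2 = (r+1) + (r+1) := by ring
      rw [this, pow_add]
      exact Finset.mul_mem_mul (hinv _ a ha) hb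
    have h1 := hx1 a (hmono _ _ (by omega) ha) _ hab
    rw [mul_inv_cancel_left] at h1
    rw [QuotientGroup.eq, ← hx2 _ hab, ← h1, (ρ a).injective.eq_iff, eq_comm]
  have hvr : ∀ p ∈ P, v p ∈ U ^ (r+1) := fun p hp => hmono _ _ (by omega) (hv p hp)
  have huv : ∀ u ∈ U, ∀ p ∈ P, u * v p ∈ U ^ (r+1) := fun u hu p hp => by
    rw [pow_succ']; exact Finset.mul_mem_mul hu (hv p hp)
  have hact : ∀ u ∈ U, ∀ p ∈ P, ρ u p = ρ (u * v p) x := by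
    intro u hu p hp
    conv_lhs => rw [hvx p hp]
    refine hx1 u (hmono 1 _ (by omega) (by simpa using hu)) _ (hmono r _ (by omega) (hv p hp))
  set φ : X → A ⧸ Λ := fun p => (v p : A ⧸ Λ) with hφ
  have hφinj : ∀ p ∈ P, ∀ p' ∈ P, φ p = φ p' → p = p' := by
    intro p hp p' hp' h
    rw [hvx p hp, hvx p' hp']
    exact (hkey _ (hvr p hp) _ (hvr p' hp')).2 h
  -- translation compatibility
  have htr : ∀ u ∈ U, ∀ p ∈ P, ∀ p' ∈ P, (φ p' = φ p * (u : A ⧸ Λ) ↔ p' = ρ u p) := by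
    intro u hu p hp p' hp'
    rw [hact u hu p hp]
    conv_rhs => rw [hvx p' hp']
    rw [hkey _ (hvr p' hp') _ (huv u hu p hp), mul_comm u]
    rfl
  set full : X → Prop := fun p => ∀ q : Q, ∃ p' ∈ P, φ p' = φ p * (σ (π (φ p)))⁻¹ * σ q with hfull
  set f : A → X → X := fun a p => if h : full p then (h (π (φ p) * π a)).choose else p with hf
  have hfP : ∀ a p, full p → f a p ∈ P := by
    intro a p h
    simp only [hf, dif_pos h]
    exact (h (π (φ p) * π a)).choose_spec.1
  have hfφ : ∀ a p, full p → φ (f a p) = φ p * (σ (π (φ p)))⁻¹ * σ (π (φ p) * π a) := by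
    intro a p h
    simp only [hf, dif_pos h]
    exact (h (π (φ p) * π a)).choose_spec.2
  have hfn : ∀ a p, ¬ full p → f a p = p := by
    intro a p h
    simp only [hf, dif_neg h]
  have hfπ : ∀ a p, full p → π (φ (f a p)) = π (φ p) * π a := by
    intro a p h
    rw [hfφ a p h, map_mul, map_mul, map_inv, hσ, hσ, mul_inv_cancel, one_mul]
  have hff : ∀ a p, full p → full (f a p) := by
    intro a p h q
    obtain ⟨p', hp', e⟩ := h q
    refine ⟨p', hp', ?_⟩
    rw [hfπ a p h, hfφ a p h, e, mul_inv_cancel_right]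
  have hPf : ∀ a, ∀ p ∈ P, f a p ∈ P := by
    intro a p hp
    by_cases h : full p
    · exact hfP a p h
    · rwa [hfn a p h]
  have hf1 : ∀ p ∈ P, f 1 p = p := by
    intro p hp
    by_cases h : full p
    · apply hφinj _ (hPf 1 p hp) _ hp
      rw [hfφ 1 p h]
      simp
    · exact hfn 1 p h
  have hfm : ∀ a b, ∀ p ∈ P, f (a * b) p = f a (f b p) := by
    intro a b p hp
    by_cases h : full p
    · apply hφinj _ (hPf _ p hp) _ (hPf _ _ (hPf _ p hp))
      rw [hfφ _ p h, hfφ a _ (hff b p h), hfπ b p h, hfφ b p h, mul_inv_cancel_right,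
        QuotientGroup.mk_mul, map_mul, mul_comm (π (a : A ⧸ Λ)), mul_assoc (π (φ p))]
    · rw [hfn _ p h, hfn b p h, hfn a p h]
  refine ⟨f, hPf, hf1, hfm, ?_⟩
  have : Fintype Q := Fintype.ofFinite Q
  set Qb : Finset Q := Finset.univ.filter fun q => ∃ s ∈ Sg, σ q * (s : A ⧸ Λ) ≠ σ (q * π s) with hQb
  have hQbc : (Qb.card : ℝ) ≤ ε * Fintype.card Q := by
    rw [Nat.card_eq_fintype_card] at hbad
    convert hbad
    rw [← Set.ncard_coe_finset]
    congr 1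
    ext q; simp [hQb]
  set F : Q → Finset X := fun q => P.filter fun p => full p ∧ π (φ p) = q with hF
  have hFle : ∀ q q', (F q).card ≤ (F q').card := by
    intro q q'
    obtain ⟨a, ha⟩ := QuotientGroup.mk_surjective (σ (q⁻¹ * q'))
    refine Finset.card_le_card_of_injOn (f a) ?_ ?_
    · intro p hp
      simp only [hF, Finset.coe_filter, Set.mem_ofPred_eq] at hp ⊢
      obtain ⟨h1, h2, h3⟩ := hp
      refine ⟨hPf a p h1, hff a p h2, ?_⟩
      rw [hfπ a p h2, h3, ha, hσ, mul_inv_cancel_left]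
    · intro p hp p' hp' e
      simp only [hF, Finset.coe_filter, Set.mem_ofPred_eq] at hp hp'
      have := congrArg (f a⁻¹) e
      rwa [← hfm _ _ _ hp.1, ← hfm _ _ _ hp'.1, inv_mul_cancel, hf1 _ hp.1, hf1 _ hp'.1] at this
  set c := (F 1).card with hc
  have hFc : ∀ q, (F q).card = c := fun q => le_antisymm (hFle _ _) (hFle _ _)
  set Pf := P.filter full with hPfull
  have hPfc : Pf.card = Fintype.card Q * c := by
    rw [Finset.card_eq_sum_card_fiberwise (f := fun p => π (φ p)) (t := Finset.univ) (by simp)]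
    rw [Finset.sum_congr rfl (g := fun _ => c)]
    · simp
    · intro q _
      rw [← hFc q, hF, hPfull, Finset.filter_filter]
  set Pb := Pf.filter (fun p => π (φ p) ∈ Qb) with hPb
  have hPbc : Pb.card = Qb.card * c := by
    rw [Finset.card_eq_sum_card_fiberwise (f := fun p => π (φ p)) (t := Qb)
      (by intro p hp; exact (Finset.mem_filter.1 hp).2)]
    rw [Finset.sum_congr rfl (g := fun _ => c)]
    · simp
    · intro q hq
      rw [← hFc q, hF, hPb, hPfull]
      congr 1
      ext p
      simp only [Finset.mem_filter]
      constructor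
      · rintro ⟨⟨⟨h1, h2⟩, -⟩, h3⟩; exact ⟨h1, h2, h3⟩
      · rintro ⟨h1, h2, h3⟩; exact ⟨⟨⟨h1, h2⟩, h3 ▸ hq⟩, h3⟩
  have hsub : (P.filter fun p => ∃ s ∈ Sg, f s p ≠ ρ s p) ⊆
      Pb ∪ (P.filter fun p => ∃ u ∈ U, ρ u p ∉ P) := by
    intro p hp
    obtain ⟨hpP, s, hs, hne⟩ := Finset.mem_filter.1 hp
    rw [Finset.mem_union]
    by_cases h : full p
    · left
      rw [hPb, Finset.mem_filter]
      refine ⟨Finset.mem_filter.2 ⟨hpP, h⟩, ?_⟩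
      rw [hQb, Finset.mem_filter]
      refine ⟨Finset.mem_univ _, s, hs, fun he => hne ?_⟩
      apply (htr s (hSg hs) p hpP _ (hPf s p hpP)).1
      rw [hfφ s p h, ← he, mul_assoc, inv_mul_cancel_left]
    · right
      refine Finset.mem_filter.2 ⟨hpP, ?_⟩
      simp only [hfull] at h
      push Not at h
      obtain ⟨q, hq⟩ := h
      obtain ⟨u, hu, hue⟩ := hUD q (π (φ p))
      refine ⟨u, hu, fun hup => hq _ hup ?_⟩
      rw [(htr u hu p hpP _ hup).2 rfl, hue, mul_assoc]
  have h1 := (Finset.card_le_card hsub).trans (Finset.card_union_le _ _)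
  have h2 : ((P.filter fun p => ∃ s ∈ Sg, f s p ≠ ρ s p).card : ℝ) ≤
     Pb.card + (P.filter fun p => ∃ u ∈ U, ρ u p ∉ P).card := by exact_mod_cast h1
  refine h2.trans (add_le_add_left ?_ _)
  have hε : 0 ≤ ε := by
    have h0 : (0:ℝ) < Fintype.card Q := by exact_mod_cast Fintype.card_pos
    by_contra hneg
    push Not at hneg
    have : (0:ℝ) ≤ Qb.card := by positivity
    nlinarith
  have hPfle : Pf.card ≤ P.card := Finset.card_le_card (Finset.filter_subset _ _)
  clear_value Pb Pf Qb c
  exact card_arith ε hε _ _ _ _ _ _ hPbc hPfc hPfle hQbc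

open Classical in
theorem grow_lemma {A X : Type} [CommGroup A] (U : Finset A) (hU1 : 1 ∈ U) (r : ℕ) (η : ℝ)
    (hη : 0 < η) (hr : ((U ^ r).card : ℝ) < (1 + η) ^ r) (ρ : A → Equiv.Perm X) (Y : Finset X)
    (hY : ∀ y ∈ Y, ρ 1 y = y) (x : X) (hxY : x ∈ Y)
    (hx : ∀ u ∈ U, ∀ v ∈ U ^ r, ρ u (ρ v x) = ρ (u * v) x) :
    ∃ P N : Finset X, P ⊆ Y ∧ N ⊆ Y ∧ Disjoint P N ∧ x ∈ P ∧ (N.card : ℝ) ≤ η * P.card ∧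
      (∀ p ∈ P, ∀ u ∈ U, ρ u p ∈ Y → ρ u p ∈ P ∪ N) ∧ ∀ p ∈ P, ∃ v ∈ U ^ r, p = ρ v x := by
  set B : ℕ → Finset X := fun j => Nat.rec {x}
    (fun _ b => Y.filter fun y => ∃ u ∈ U, ∃ z ∈ b, y = ρ u z) j with hB
  have hB0 : B 0 = {x} := rfl
  have hBs : ∀ j, B (j+1) = Y.filter fun y => ∃ u ∈ U, ∃ z ∈ B j, y = ρ u z := fun j => rfl
  have hBY : ∀ j, B j ⊆ Y := by
    intro j
    cases j with
    | zero => rw [hB0]; simpa using hxY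
    | succ j => rw [hBs]; exact Finset.filter_subset _ _
  have hBm : ∀ j, B j ⊆ B (j+1) := by
    intro j y hy
    rw [hBs, Finset.mem_filter]
    exact ⟨hBY j hy, 1, hU1, y, hy, (hY y (hBY j hy)).symm⟩
  have hxB : ∀ j, x ∈ B j := by
    intro j
    induction j with
    | zero => simp [hB0]
    | succ j ih => exact hBm j ih
  have hBU : ∀ j ≤ r, ∀ p ∈ B j, ∃ v ∈ U ^ j, p = ρ v x := by
    intro j
    induction j with
    | zero =>
      intro _ p hp
      rw [hB0, Finset.mem_singleton] at hp
      exact ⟨1, by simp, by rw [hp, hY x hxY]⟩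
    | succ j ih =>
      intro hj p hp
      rw [hBs, Finset.mem_filter] at hp
      obtain ⟨-, u, hu, z, hz, rfl⟩ := hp
      obtain ⟨v, hv, rfl⟩ := ih (by omega) z hz
      refine ⟨u * v, by rw [pow_succ']; exact Finset.mul_mem_mul hu hv, ?_⟩
      exact hx u hu v (Finset.pow_subset_pow_right hU1 (by omega) hv)
  have hex : ∃ j < r, ((B (j+1)).card : ℝ) ≤ (1 + η) * (B j).card := by
    by_contra hcon
    push Not at hcon
    have hge : ∀ j ≤ r, (1 + η) ^ j ≤ ((B j).card : ℝ) := by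
      intro j
      induction j with
      | zero => intro _; simp [hB0]
      | succ j ih =>
        intro hj
        have h1 := ih (by omega)
        have h2 := hcon j (by omega)
        rw [pow_succ']
        have : (1 + η) * (1+η)^j ≤ (1+η) * (B j).card := by gcongr
        linarith
    have h1 := hge r le_rfl
    have h2 : (B r).card ≤ (U ^ r).card := by
      have : B r ⊆ (U ^ r).image fun v => ρ v x := by
        intro p hp
        obtain ⟨v, hv, e⟩ := hBU r le_rfl p hp
        exact Finset.mem_image.2 ⟨v, hv, e.symm⟩
      exact (Finset.card_le_card this).trans Finset.card_image_le
    have h3 : ((B r).card : ℝ) ≤ (U ^ r).card := by exact_mod_cast h2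
    linarith
  obtain ⟨j, hj, hjc⟩ := hex
  refine ⟨B j, B (j+1) \ B j, hBY j, Finset.sdiff_subset.trans (hBY (j+1)), Finset.disjoint_sdiff,
    hxB j, ?_, ?_, ?_⟩
  · have := Finset.card_sdiff_add_card_eq_card (hBm j)
    have h2 : ((B (j+1) \ B j).card : ℝ) + (B j).card = (B (j+1)).card := by exact_mod_cast this
    linarith
  · intro p hp u hu hY'
    rw [Finset.union_sdiff_of_subset (hBm j), hBs, Finset.mem_filter]
    exact ⟨hY', u, hu, p, hp, rfl⟩
  · intro p hp
    obtain ⟨v, hv, e⟩ := hBU j hj.le p hp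
    exact ⟨v, Finset.pow_subset_pow_right hU1 hj.le hv, e⟩

set_option maxHeartbeats 1000000 in
open Classical in
theorem type_lemma {A : Type} [CommGroup A] [Group.FG A] (Λ : Subgroup A) (Sg : Finset A)
    (ε : ℝ) (hε : 0 < ε) : ∃ (U : Finset A) (r : ℕ), 1 ∈ U ∧ ∀ (X : Type) (ρ : A → Equiv.Perm X)
      (Y : Finset X), (∀ y ∈ Y, GoodPt ρ Λ (U ^ (2 * r + 2)) y) →
    ∃ f : A → X → X, (∀ a, ∀ p ∈ Y, f a p ∈ Y) ∧ (∀ p ∈ Y, f 1 p = p) ∧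
      (∀ a b, ∀ p ∈ Y, f (a * b) p = f a (f b p)) ∧
      ((Y.filter fun p => ∃ s ∈ Sg, f s p ≠ ρ s p).card : ℝ) ≤
        2 * ε * Y.card + (Y.filter fun p => ∃ u ∈ U, ρ u p ∉ Y).card := by
  obtain ⟨Q, _, _, π, σ, hσ, hbad⟩ := HasTiles.of_fg (A ⧸ Λ) (Sg.image (fun a => (a : A ⧸ Λ))) ε hε
  have : Fintype Q := Fintype.ofFinite Q
  have hbad' : (Set.ncard {q | ∃ s ∈ Sg, σ q * (s : A ⧸ Λ) ≠ σ (q * π s)} : ℝ) ≤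
      ε * Nat.card Q := by
    convert hbad using 3
    ext q
    simp
  set U0 : Finset A := insert 1 (Sg ∪ (Finset.univ : Finset (Q × Q)).image
    fun t => ((σ t.2)⁻¹ * σ t.1).out) with hU0
  set U : Finset A := U0 ∪ U0⁻¹ with hU
  have hU1 : 1 ∈ U := by simp [hU, hU0]
  have hUinv : ∀ u ∈ U, u⁻¹ ∈ U := by
    intro u hu
    rw [hU, Finset.mem_union, Finset.mem_inv'] at hu ⊢
    rw [inv_inv]; exact hu.symm
  have hSg : Sg ⊆ U := by
    intro s hs
    simp [hU, hU0, hs]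
  have hUD : ∀ q q' : Q, ∃ u ∈ U, (u : A ⧸ Λ) = (σ q')⁻¹ * σ q := by
    intro q q'
    refine ⟨((σ q')⁻¹ * σ q).out, ?_, QuotientGroup.out_eq' _⟩
    refine Finset.mem_union_left _ (Finset.mem_insert_of_mem (Finset.mem_union_right _ ?_))
    exact Finset.mem_image.2 ⟨(q, q'), Finset.mem_univ _, rfl⟩
  clear_value U
  set η : ℝ := ε / (2 * U.card + 1) with hηd
  have hη : 0 < η := by positivity
  obtain ⟨r, hr⟩ := exists_pow_card_lt U η hη
  refine ⟨U, r, hU1, fun X ρ Y => ?_⟩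
  have hUW : U ⊆ U ^ (2 * r + 2) := by
    have := Finset.pow_subset_pow_right hU1 (show 1 ≤ 2 * r + 2 by omega)
    rwa [pow_one] at this
  induction Y using Finset.strongInduction with
  | H Y ih =>
  intro hY
  have hY1 : ∀ y ∈ Y, ρ 1 y = y := fun y hy => ((hY y hy).2 1 (hUW hU1)).2 Λ.one_mem
  rcases Y.eq_empty_or_nonempty with rfl | ⟨x, hxY⟩
  · exact ⟨fun _ x => x, by simp, by simp, by simp, by simp⟩
  obtain ⟨P, N, hPY, hNY, hPN, hxP, hNc, hPU, hPr⟩ := grow_lemma U hU1 r η hη hr ρ Y hY1 x hxY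
    (fun u hu v hv => (hY x hxY).1 u (hUW hu) v (Finset.pow_subset_pow_right hU1 (by omega) hv))
  obtain ⟨f0, f0P, f01, f0m, f0c⟩ := piece_lemma Λ π σ hσ Sg ε hbad' U hU1 hUinv hSg hUD r ρ x
    (hY x hxY) P hPr
  set Y' := Y \ (P ∪ N) with hY'
  have hYY : Y' ⊆ Y := Finset.sdiff_subset
  have hss : Y' ⊂ Y := by
    refine (Finset.ssubset_iff_of_subset hYY).2 ⟨x, hxY, ?_⟩
    simp [hY', hxP]
  have hdis : ∀ y ∈ Y', y ∉ P := by
    intro y hy hp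
    simp [hY', hp] at hy
  have hdisN : ∀ y ∈ Y', y ∉ N := by
    intro y hy hp
    simp [hY', hp] at hy
  obtain ⟨f1, f1P, f11, f1m, f1c⟩ := ih Y' hss (fun y hy => hY y (hYY hy))
  set f : A → X → X := fun a y => if y ∈ P then f0 a y else if y ∈ Y' then f1 a y else y with hf
  have hfP : ∀ a, ∀ y ∈ P, f a y = f0 a y := fun a y hy => by simp only [hf, if_pos hy]
  have hfY : ∀ a, ∀ y ∈ Y', f a y = f1 a y := fun a y hy => by
    simp only [hf, if_neg (hdis y hy), if_pos hy]
  have hfN : ∀ a, ∀ y, y ∉ P → y ∉ Y' → f a y = y := fun a y h1 h2 => by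
    simp only [hf, if_neg h1, if_neg h2]
  refine ⟨f, ?_, ?_, ?_, ?_⟩
  · intro a p hp
    by_cases h1 : p ∈ P
    · rw [hfP a p h1]; exact hPY (f0P a p h1)
    by_cases h2 : p ∈ Y'
    · rw [hfY a p h2]; exact hYY (f1P a p h2)
    rwa [hfN a p h1 h2]
  · intro p hp
    by_cases h1 : p ∈ P
    · rw [hfP _ p h1]; exact f01 p h1
    by_cases h2 : p ∈ Y'
    · rw [hfY _ p h2]; exact f11 p h2
    rw [hfN _ p h1 h2]
  · intro a b p hp
    by_cases h1 : p ∈ P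
    · rw [hfP _ p h1, hfP _ p h1, hfP _ _ (f0P b p h1)]; exact f0m a b p h1
    by_cases h2 : p ∈ Y'
    · rw [hfY _ p h2, hfY _ p h2, hfY _ _ (f1P b p h2)]; exact f1m a b p h2
    rw [hfN _ p h1 h2, hfN _ p h1 h2, hfN _ p h1 h2]
  set NU : Finset X := U.biUnion fun u => N.image fun y => (ρ u).symm y with hNU
  have hNUc : NU.card ≤ U.card * N.card :=
    Finset.card_biUnion_le_card_mul _ _ _ (fun u _ => Finset.card_image_le)
  have hNUm : ∀ u ∈ U, ∀ y, ρ u y ∈ N → y ∈ NU := by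
    intro u hu y hy
    rw [hNU, Finset.mem_biUnion]
    exact ⟨u, hu, Finset.mem_image.2 ⟨_, hy, by simp⟩⟩
  have c1 : (Y.filter fun p => ∃ s ∈ Sg, f s p ≠ ρ s p) ⊆
      ((P.filter fun p => ∃ s ∈ Sg, f0 s p ≠ ρ s p) ∪ N) ∪
      (Y'.filter fun p => ∃ s ∈ Sg, f1 s p ≠ ρ s p) := by
    intro y hy
    obtain ⟨hyY, s, hs, hne⟩ := Finset.mem_filter.1 hy
    rw [Finset.mem_union, Finset.mem_union, Finset.mem_filter, Finset.mem_filter]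
    by_cases h1 : y ∈ P
    · left; left; exact ⟨h1, s, hs, by rwa [hfP s y h1] at hne⟩
    by_cases h2 : y ∈ Y'
    · right; exact ⟨h2, s, hs, by rwa [hfY s y h2] at hne⟩
    left; right
    by_contra h3
    exact h2 (by simp [hY', hyY, h1, h3])
  have c2 : (P.filter fun p => ∃ u ∈ U, ρ u p ∉ P) ⊆
      (P.filter fun p => ∃ u ∈ U, ρ u p ∉ Y) ∪ NU := by
    intro y hy
    obtain ⟨hyP, u, hu, hne⟩ := Finset.mem_filter.1 hy
    rw [Finset.mem_union, Finset.mem_filter]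
    by_cases h : ρ u y ∈ Y
    · right
      rcases Finset.mem_union.1 (hPU y hyP u hu h) with h' | h'
      · exact absurd h' hne
      · exact hNUm u hu y h'
    · left; exact ⟨hyP, u, hu, h⟩
  have c3 : (Y'.filter fun p => ∃ u ∈ U, ρ u p ∉ Y') ⊆
      (Y'.filter fun p => ∃ u ∈ U, ρ u p ∉ Y) ∪ NU := by
    intro y hy
    obtain ⟨hyY', u, hu, hne⟩ := Finset.mem_filter.1 hy
    rw [Finset.mem_union, Finset.mem_filter]
    by_cases h : ρ u y ∈ Y
    · right
      by_cases hN : ρ u y ∈ N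
      · exact hNUm u hu y hN
      exfalso
      have hP : ρ u y ∈ P := by
        by_contra h3
        exact hne (by simp [hY', h, hN, h3])
      have e : ρ u⁻¹ (ρ u y) = y := by
        rw [(hY y (hYY hyY')).1 u⁻¹ (hUW (hUinv u hu)) u (hUW hu), inv_mul_cancel,
          hY1 y (hYY hyY')]
      have := hPU _ hP u⁻¹ (hUinv u hu) (by rw [e]; exact hYY hyY')
      rw [e, Finset.mem_union] at this
      exact this.elim (hdis y hyY') (hdisN y hyY')
    · left; exact ⟨hyY', u, hu, h⟩
  have c4 : (P.filter fun p => ∃ u ∈ U, ρ u p ∉ Y).card +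
      (Y'.filter fun p => ∃ u ∈ U, ρ u p ∉ Y).card ≤
      (Y.filter fun p => ∃ u ∈ U, ρ u p ∉ Y).card := by
    rw [← Finset.card_union_of_disjoint]
    · apply Finset.card_le_card
      exact Finset.union_subset (Finset.filter_subset_filter _ hPY)
        (Finset.filter_subset_filter _ hYY)
    · rw [Finset.disjoint_left]
      intro y h1 h2
      exact hdis y (Finset.mem_filter.1 h2).1 (Finset.mem_filter.1 h1).1
  have c5 : P.card + Y'.card ≤ Y.card := by
    rw [← Finset.card_union_of_disjoint]
    · exact Finset.card_le_card (Finset.union_subset hPY hYY)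
    · rw [Finset.disjoint_left]
      intro y h1 h2
      exact hdis y h2 h1
  have d1 := (Finset.card_le_card c1).trans ((Finset.card_union_le _ _).trans
    (Nat.add_le_add_right (Finset.card_union_le _ _) _))
  have d2 := (Finset.card_le_card c2).trans (Finset.card_union_le _ _)
  have d3 := (Finset.card_le_card c3).trans (Finset.card_union_le _ _)
  have hNc' : (2 * U.card + 1) * (N.card : ℝ) ≤ ε * P.card := by
    calc (2 * U.card + 1) * (N.card : ℝ) ≤ (2 * U.card + 1) * (η * P.card) := by gcongr
      _ = ε * P.card := by rw [hηd]; field_simp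
  generalize (P.filter fun p => ∃ u ∈ U, ρ u p ∉ Y).card = n1 at *
  generalize (Y'.filter fun p => ∃ u ∈ U, ρ u p ∉ Y).card = n2 at *
  generalize (Y.filter fun p => ∃ u ∈ U, ρ u p ∉ Y).card = n3 at *
  generalize (P.filter fun p => ∃ u ∈ U, ρ u p ∉ P).card = n4 at *
  generalize (Y'.filter fun p => ∃ u ∈ U, ρ u p ∉ Y').card = n5 at *
  generalize (Y.filter fun p => ∃ s ∈ Sg, f s p ≠ ρ s p).card = n6 at *
  generalize (P.filter fun p => ∃ s ∈ Sg, f0 s p ≠ ρ s p).card = n7 at *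
  generalize (Y'.filter fun p => ∃ s ∈ Sg, f1 s p ≠ ρ s p).card = n8 at *
  have d1' : (n6 : ℝ) ≤ n7 + N.card + n8 := by exact_mod_cast d1
  have d2' : (n4 : ℝ) ≤ n1 + NU.card := by exact_mod_cast d2
  have d3' : (n5 : ℝ) ≤ n2 + NU.card := by exact_mod_cast d3
  have c4' : (n1 : ℝ) + n2 ≤ n3 := by exact_mod_cast c4
  have c5' : (P.card : ℝ) + Y'.card ≤ Y.card := by exact_mod_cast c5
  have hNUc' : (NU.card : ℝ) ≤ U.card * N.card := by exact_mod_cast hNUc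
  have c5'' := mul_le_mul_of_nonneg_left c5' hε.le
  linarith

theorem compact_lemma {A : Type} [CommGroup A] (W : Subgroup A → Finset A) :
    ∃ (L : Finset (Subgroup A)) (M : Finset A), ∀ S : Set A, 1 ∈ S →
      (∀ a ∈ M, ∀ b ∈ M, a ∈ S → b ∈ S → a * b⁻¹ ∈ S) →
      ∃ Λ ∈ L, ∀ w ∈ W Λ, (w ∈ S ↔ w ∈ Λ) := by
  classical
  let O : (Subgroup A) ⊕ (Option (A × A)) → Set (A → Bool) := fun i => match i with
    | Sum.inl Λ => {f | ∀ w ∈ W Λ, f w = decide (w ∈ Λ)}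
    | Sum.inr none => {f | f 1 = false}
    | Sum.inr (some (a, b)) => {f | f a = true ∧ f b = true ∧ f (a * b⁻¹) = false}
  have hev : ∀ (a : A) (c : Bool), IsOpen {f : A → Bool | f a = c} := fun a c => by
    have h : Continuous (fun f : A → Bool => f a) := continuous_apply a
    exact (isOpen_discrete ({c} : Set Bool)).preimage h
  have hO : ∀ i, IsOpen (O i) := by
    rintro (Λ | _ | ⟨a, b⟩)
    · have : O (Sum.inl Λ) = ⋂ w ∈ W Λ, {f | f w = decide (w ∈ Λ)} := by
        ext f; simp [O]
      rw [this]
      exact isOpen_biInter_finset fun w _ => hev w _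
    · exact hev 1 false
    · exact (hev a true).inter ((hev b true).inter (hev _ false))
  have hcov : (Set.univ : Set (A → Bool)) ⊆ ⋃ i, O i := by
    intro f _
    rw [Set.mem_iUnion]
    by_contra hcon
    push Not at hcon
    have h1 : f 1 = true := by
      have := hcon (Sum.inr none)
      simpa [O] using this
    have h2 : ∀ a b, f a = true → f b = true → f (a * b⁻¹) = true := by
      intro a b ha hb
      have := hcon (Sum.inr (some (a, b)))
      simpa [O, ha, hb] using this
    let Λ : Subgroup A := Subgroup.ofDiv {a | f a = true} ⟨1, h1⟩ (fun a ha b hb => h2 a b ha hb)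
    apply hcon (Sum.inl Λ)
    intro w _
    have : w ∈ Λ ↔ f w = true := Iff.rfl
    simp [this]
  obtain ⟨t, ht⟩ := isCompact_univ.elim_finite_subcover O hO hcov
  refine ⟨t.toLeft, t.toRight.biUnion fun o => match o with
    | none => ∅
    | some (a, b) => {a, b}, ?_⟩
  intro S h1 hS
  have := ht (Set.mem_univ (fun a => decide (a ∈ S)))
  rw [Set.mem_iUnion₂] at this
  obtain ⟨i, hi, hf⟩ := this
  rcases i with (Λ | _ | ⟨a, b⟩)
  · refine ⟨Λ, by simpa using hi, ?_⟩
    intro w hw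
    have := hf w hw
    simpa using this
  · exfalso
    simp [O, h1] at hf
  · exfalso
    have hm : some (a, b) ∈ t.toRight := by simpa using hi
    simp only [O, Set.mem_ofPred_eq, decide_eq_true_eq, decide_eq_false_iff_not] at hf
    refine hf.2.2 (hS a ?_ b ?_ hf.1 hf.2.1)
    · exact Finset.mem_biUnion.2 ⟨_, hm, by simp⟩
    · exact Finset.mem_biUnion.2 ⟨_, hm, by simp⟩

theorem final_arith (ε : ℝ) (hε : 0 < ε) (c n bad tot e y u : ℝ) (hc : c = 1 + u) (hc0 : 0 < c)
    (hbad : bad ≤ ε / (2 * c) * n) (h2 : tot ≤ bad + e) (h4 : e ≤ 2 * (ε / 4) * y + u * bad)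
    (h5 : y ≤ n) : tot ≤ ε * n := by
  have h6 : c * bad ≤ ε / 2 * n := by
    calc c * bad ≤ c * (ε / (2 * c) * n) := by gcongr
      _ = ε / 2 * n := by field_simp
  have h7 := mul_le_mul_of_nonneg_left h5 (show 0 ≤ 2 * (ε / 4) by positivity)
  rw [hc, add_mul, one_mul] at h6
  linarith

set_option maxHeartbeats 1000000 in
open Classical in
theorem main_abelian {A : Type} [CommGroup A] [Group.FG A] (Sg : Finset A) (ε : ℝ) (hε : 0 < ε) :
    ∃ (M : Finset A) (η : ℝ), 0 < η ∧ ∀ (n : ℕ) (ρ : A → Equiv.Perm (Fin n)),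
      ∀ Bad : Finset (Fin n), (Bad.card : ℝ) ≤ η * n →
      (∀ x, x ∉ Bad → ∀ a ∈ M, ∀ b ∈ M, ρ a (ρ b x) = ρ (a * b) x) →
      ∃ (q : A →* Equiv.Perm (Fin n)) (E : Finset (Fin n)), (E.card : ℝ) ≤ ε * n ∧
        ∀ x, x ∉ E → ∀ s ∈ Sg, q s x = ρ s x := by
  have hT := fun Λ : Subgroup A => type_lemma Λ Sg (ε / 4) (by positivity)
  choose U r hU1 hTf using hT
  set W : Subgroup A → Finset A := fun Λ => U Λ ^ (2 * r Λ + 2) with hW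
  have hUW : ∀ Λ, U Λ ⊆ W Λ := by
    intro Λ
    have := Finset.pow_subset_pow_right (hU1 Λ) (show 1 ≤ 2 * r Λ + 2 by omega)
    rwa [pow_one] at this
  obtain ⟨L, M0, hL⟩ := compact_lemma W
  set Wt : Finset A := L.biUnion W with hWt
  set M : Finset A := insert 1 (Wt ∪ M0 ∪ M0 * M0⁻¹) with hM
  have hWM : Wt ⊆ M := fun a ha =>
    Finset.mem_insert_of_mem (Finset.mem_union_left _ (Finset.mem_union_left _ ha))
  have h1M : 1 ∈ M := Finset.mem_insert_self _ _
  have hM0M : M0 ⊆ M := fun a ha =>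
    Finset.mem_insert_of_mem (Finset.mem_union_left _ (Finset.mem_union_right _ ha))
  have hM2M : M0 * M0⁻¹ ⊆ M := fun a ha =>
    Finset.mem_insert_of_mem (Finset.mem_union_right _ ha)
  clear_value M
  set c : ℝ := 1 + ∑ Λ ∈ L, ((U Λ).card : ℝ) with hc
  have hc0 : 0 < c := add_pos_of_pos_of_nonneg one_pos
    (Finset.sum_nonneg fun _ _ => Nat.cast_nonneg _)
  refine ⟨M, ε / (2 * c), div_pos hε (mul_pos two_pos hc0), fun n ρ Bad hbad hgood => ?_⟩
  set τ : Finset A → Subgroup A := fun S =>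
    if h : ∃ Λ ∈ L, ∀ w ∈ W Λ, (w ∈ S ↔ w ∈ Λ) then h.choose else ⊥ with hτ
  set st : Fin n → Finset A := fun x => Wt.filter fun w => ρ w x = x with hst
  set tp : Fin n → Subgroup A := fun x => τ (st x) with htp
  have htpg : ∀ x, x ∉ Bad → tp x ∈ L ∧ ∀ w ∈ W (tp x), (ρ w x = x ↔ w ∈ tp x) := by
    intro x hx
    have h1 : ρ 1 x = x := by
      have := hgood x hx 1 h1M 1 h1M
      rw [mul_one] at this
      exact (ρ 1).injective this
    obtain ⟨Λ, hΛ, hw⟩ := hL {a | ρ a x = x} h1 (by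
      intro a ha b hb hax hbx
      have hax' : ρ a x = x := hax
      have hbx' : ρ b x = x := hbx
      have := hgood x hx (a * b⁻¹) (hM2M (Finset.mul_mem_mul ha (Finset.inv_mem_inv hb))) b (hM0M hb)
      rw [inv_mul_cancel_right, hbx', hax'] at this
      exact this)
    have hex : ∃ Λ ∈ L, ∀ w ∈ W Λ, (w ∈ st x ↔ w ∈ Λ) := by
      refine ⟨Λ, hΛ, fun w hw' => ?_⟩
      rw [← hw w hw', hst, Finset.mem_filter]
      exact ⟨fun h => h.2, fun h => ⟨Finset.mem_biUnion.2 ⟨Λ, hΛ, hw'⟩, h⟩⟩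
    have htx : tp x = hex.choose := by
      simp only [htp, hτ]
      rw [dif_pos hex]
    have hs := hex.choose_spec
    rw [← htx] at hs
    refine ⟨hs.1, fun w hw' => ?_⟩
    rw [← hs.2 w hw', hst, Finset.mem_filter]
    exact ⟨fun h => ⟨Finset.mem_biUnion.2 ⟨_, hs.1, hw'⟩, h⟩, fun h => h.2⟩
  have htpc : ∀ x, x ∉ Bad → ∀ u ∈ Wt, tp (ρ u x) = tp x := by
    intro x hx u hu
    have : st (ρ u x) = st x := by
      simp only [hst]
      apply Finset.filter_congr
      intro w hw
      rw [hgood x hx w (hWM hw) u (hWM hu), mul_comm, ← hgood x hx u (hWM hu) w (hWM hw)]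
      exact (ρ u).injective.eq_iff
    simp only [htp, this]
  clear_value tp
  set Y : Subgroup A → Finset (Fin n) := fun Λ =>
    Finset.univ.filter fun x => x ∉ Bad ∧ tp x = Λ with hY
  have hYm : ∀ Λ x, x ∈ Y Λ ↔ x ∉ Bad ∧ tp x = Λ := by intro Λ x; simp [hY]
  have hYgood : ∀ Λ, ∀ y ∈ Y Λ, GoodPt ρ Λ (W Λ) y := by
    intro Λ y hy
    obtain ⟨h1, rfl⟩ := (hYm Λ y).1 hy
    obtain ⟨h2, h3⟩ := htpg y h1
    have hsub : W (tp y) ⊆ M := (Finset.subset_biUnion_of_mem W h2).trans hWM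
    exact ⟨fun a ha b hb => hgood y h1 a (hsub ha) b (hsub hb), h3⟩
  have hF := fun Λ => hTf Λ (Fin n) ρ (Y Λ) (hYgood Λ)
  choose F FY F1 Fm Fc using hF
  set f : A → Fin n → Fin n := fun a x => if x ∈ Bad then x else F (tp x) a x with hf
  have hfb : ∀ a x, x ∈ Bad → f a x = x := fun a x h => by simp only [hf, if_pos h]
  have hfg : ∀ a x, x ∉ Bad → f a x = F (tp x) a x := fun a x h => by simp only [hf, if_neg h]
  have hf1 : ∀ x, f 1 x = x := by
    intro x
    by_cases h : x ∈ Bad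
    · exact hfb 1 x h
    · rw [hfg 1 x h]; exact F1 _ x ((hYm _ _).2 ⟨h, rfl⟩)
  have hfm : ∀ a b x, f (a * b) x = f a (f b x) := by
    intro a b x
    by_cases h : x ∈ Bad
    · rw [hfb _ x h, hfb _ x h, hfb _ x h]
    · have hx : x ∈ Y (tp x) := (hYm _ _).2 ⟨h, rfl⟩
      obtain ⟨h1, h2⟩ := (hYm _ _).1 (FY _ b x hx)
      rw [hfg _ x h, hfg b x h, hfg a _ h1, h2]
      exact Fm _ a b x hx
  let act : MulAction A (Fin n) :=
    { smul := fun a x => f a x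
      one_smul := hf1
      mul_smul := hfm }
  have hq : ∀ a x, MulAction.toPermHom A (Fin n) a x = f a x := fun a x => rfl
  set E : Subgroup A → Finset (Fin n) := fun Λ =>
    (Y Λ).filter fun p => ∃ s ∈ Sg, F Λ s p ≠ ρ s p with hE
  refine ⟨MulAction.toPermHom A (Fin n), Bad ∪ L.biUnion E, ?_, ?_⟩
  swap
  · intro x hx s hs
    rw [hq]
    by_contra hne
    apply hx
    rw [Finset.mem_union]
    by_cases h : x ∈ Bad
    · exact Or.inl h
    right
    refine Finset.mem_biUnion.2 ⟨tp x, (htpg x h).1, ?_⟩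
    refine Finset.mem_filter.2 ⟨(hYm _ _).2 ⟨h, rfl⟩, s, hs, ?_⟩
    rwa [hfg s x h] at hne
  have hbd : ∀ Λ ∈ L, ((Y Λ).filter fun p => ∃ u ∈ U Λ, ρ u p ∉ Y Λ).card ≤
      (U Λ).card * Bad.card := by
    intro Λ hΛ
    have hs : ((Y Λ).filter fun p => ∃ u ∈ U Λ, ρ u p ∉ Y Λ) ⊆
        (U Λ).biUnion fun u => Bad.image fun y => (ρ u).symm y := by
      intro y hy
      obtain ⟨hyY, u, hu, hne⟩ := Finset.mem_filter.1 hy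
      refine Finset.mem_biUnion.2 ⟨u, hu, Finset.mem_image.2 ⟨ρ u y, ?_, by simp⟩⟩
      by_contra hb
      obtain ⟨h1, h2⟩ := (hYm _ _).1 hyY
      exact hne ((hYm _ _).2 ⟨hb, by
        rw [htpc y h1 u (Finset.mem_biUnion.2 ⟨Λ, hΛ, hUW Λ hu⟩), h2]⟩)
    exact (Finset.card_le_card hs).trans
      (Finset.card_biUnion_le_card_mul _ _ _ (fun u _ => Finset.card_image_le))
  have hYsum : ∑ Λ ∈ L, (Y Λ).card ≤ n := by
    rw [← Finset.card_biUnion]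
    · exact (Finset.card_le_univ _).trans (by simp)
    · intro a _ b _ hab
      refine Finset.disjoint_left.2 ?_
      intro x h1 h2
      exact hab (((hYm _ _).1 h1).2.symm.trans ((hYm _ _).1 h2).2)
  have h1 := (Finset.card_union_le Bad (L.biUnion E)).trans
    (Nat.add_le_add_left Finset.card_biUnion_le _)
  have h2 : ((Bad ∪ L.biUnion E).card : ℝ) ≤
      Bad.card + ∑ Λ ∈ L, ((E Λ).card : ℝ) := by exact_mod_cast h1
  have h3 : ∀ Λ ∈ L, ((E Λ).card : ℝ) ≤ 2 * (ε / 4) * (Y Λ).card + (U Λ).card * Bad.card := by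
    intro Λ hΛ
    have hFc : ((E Λ).card : ℝ) ≤ 2 * (ε / 4) * (Y Λ).card +
        (((Y Λ).filter fun p => ∃ u ∈ U Λ, ρ u p ∉ Y Λ).card : ℕ) := by convert Fc Λ
    have hbd' := (Nat.cast_le (α := ℝ)).2 (hbd Λ hΛ)
    rw [Nat.cast_mul] at hbd'
    exact hFc.trans (add_le_add_right hbd' _)
  have h4 := Finset.sum_le_sum h3
  rw [Finset.sum_add_distrib, ← Finset.mul_sum, ← Finset.sum_mul] at h4
  have h5 : (∑ Λ ∈ L, ((Y Λ).card : ℝ)) ≤ n := by exact_mod_cast hYsum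
  exact final_arith ε hε c n _ _ _ _ _ hc hc0 hbad h2 h4 h5

open scoped commutatorElement

/-- Words of the free group that are close to the identity whenever the generators almost
commute. -/
def smallWords (k : ℕ) : Subgroup (FreeGroup (Fin k)) where
  carrier := {w | ∃ C : ℕ, ∀ (n : ℕ) (p : Fin k → Equiv.Perm (Fin n)) (D : ℝ),
    (∀ i j, ((⁅p i, p j⁆ : Equiv.Perm (Fin n)).support.card : ℝ) ≤ D) →
    ((FreeGroup.lift p w).support.card : ℝ) ≤ C * D}
  one_mem' := ⟨0, by simp⟩
  mul_mem' := by
    rintro a b ⟨C, hC⟩ ⟨C', hC'⟩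
    refine ⟨C + C', fun n p D h => ?_⟩
    have h1 := hC n p D h
    have h2 := hC' n p D h
    rw [map_mul]
    have h3 := (Finset.card_le_card (Equiv.Perm.support_mul_le (FreeGroup.lift p a)
      (FreeGroup.lift p b))).trans (Finset.card_union_le _ _)
    have h4 : ((FreeGroup.lift p a * FreeGroup.lift p b).support.card : ℝ) ≤
      (FreeGroup.lift p a).support.card + (FreeGroup.lift p b).support.card := by
      exact_mod_cast h3
    push_cast
    linarith
  inv_mem' := by
    rintro a ⟨C, hC⟩
    refine ⟨C, fun n p D h => ?_⟩
    rw [map_inv, Equiv.Perm.support_inv]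
    exact hC n p D h

instance smallWords_normal (k : ℕ) : (smallWords k).Normal where
  conj_mem := by
    rintro a ⟨C, hC⟩ g
    refine ⟨C, fun n p D h => ?_⟩
    rw [map_mul, map_mul, map_inv, Equiv.Perm.card_support_conj]
    exact hC n p D h

theorem commutator_le_smallWords (k : ℕ) :
    commutator (FreeGroup (Fin k)) ≤ smallWords k := by
  have hgen : ∀ i j, ⁅(FreeGroup.of i : FreeGroup (Fin k)), FreeGroup.of j⁆ ∈ smallWords k := by
    intro i j
    refine ⟨1, fun n p D h => ?_⟩
    rw [map_commutatorElement]
    simpa using h i j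
  set m := QuotientGroup.mk' (smallWords k)
  have hm : ∀ a b, ⁅a, b⁆ ∈ smallWords k ↔ Commute (m a) (m b) := by
    intro a b
    rw [← commutatorElement_eq_one_iff_commute, ← map_commutatorElement,
      ← MonoidHom.mem_ker, QuotientGroup.ker_mk']
  have h1 : ∀ i b, Commute (m (FreeGroup.of i)) (m b) := by
    intro i b
    induction b using FreeGroup.induction_on with
    | C1 => simp
    | of j => exact (hm _ _).1 (hgen i j)
    | inv_of j h => rw [map_inv]; exact h.inv_right
    | mul a b ha hb => rw [map_mul]; exact ha.mul_right hb
  have h2 : ∀ a b, Commute (m a) (m b) := by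
    intro a b
    induction a using FreeGroup.induction_on with
    | C1 => simp
    | of j => exact h1 j b
    | inv_of j h => rw [map_inv]; exact h.inv_left
    | mul a b ha hb => rw [map_mul]; exact ha.mul_left hb
  rw [commutator_def, Subgroup.commutator_le]
  intro a _ b _
  exact (hm a b).2 (h2 a b)

theorem dH_eq_support {n : ℕ} (p q : Equiv.Perm (Fin n)) :
    dH p q = ((q⁻¹ * p).support.card : ℝ) / n := by
  unfold dH
  congr 3
  ext x
  rw [Equiv.Perm.mem_support, Equiv.Perm.mul_apply, Ne, Equiv.Perm.inv_eq_iff_eq]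
  simp

theorem final_of_abelian (k : ℕ) {A : Type} [CommGroup A] [Group.FG A]
    (φ : FreeGroup (Fin k) →* A) (hφ : Function.Surjective φ) (hker : φ.ker ≤ smallWords k) :
    ∀ ε : ℝ, 0 < ε → ∃ δ : ℝ, 0 < δ ∧
      ∀ (n : ℕ) (p : Fin k → Equiv.Perm (Fin n)),
        (∀ i j, dH (p i * p j) (p j * p i) < δ) →
        ∃ q : Fin k → Equiv.Perm (Fin n),
          (∀ i j, q i * q j = q j * q i) ∧ ∀ i, dH (p i) (q i) < ε := by
  classical
  intro ε hε
  have hker' : ∀ w, φ w = 1 → w ∈ smallWords k := fun w hw => hker hw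
  let e : Fin k → A := fun i => φ (FreeGroup.of i)
  choose out hout using hφ
  obtain ⟨M, η, hη, hmain⟩ := main_abelian (A := A) (Finset.univ.image e) (ε / 4) (by positivity)
  have hCab : ∀ a b : A, (out (a * b))⁻¹ * (out a * out b) ∈ smallWords k := by
    intro a b
    apply hker'
    rw [map_mul, map_mul, map_inv, hout, hout, hout, inv_mul_cancel]
  have hCe : ∀ i, (out (e i))⁻¹ * FreeGroup.of i ∈ smallWords k := by
    intro i
    apply hker'
    rw [map_mul, map_inv, hout]
    exact inv_mul_cancel _
  choose C hC using hCab
  choose C' hC' using hCe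
  set c : ℝ := ∑ t ∈ M ×ˢ M, (C t.1 t.2 : ℝ) with hc
  have hc0 : 0 ≤ c := by positivity
  set c' : ℝ := ∑ i, (C' i : ℝ) with hc'
  have hc'0 : 0 ≤ c' := by positivity
  refine ⟨min (η / (c + 1)) (ε / (4 * (c' + 1))), by positivity, fun n p hp => ?_⟩
  set δ := min (η / (c + 1)) (ε / (4 * (c' + 1))) with hδ
  have hδ0 : 0 < δ := by positivity
  have hδ1 : c * δ ≤ η := by
    have : δ ≤ η / (c + 1) := min_le_left _ _
    rw [le_div_iff₀ (by positivity)] at this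
    linarith
  have hδ2 : c' * δ ≤ ε / 4 := by
    have : δ ≤ ε / (4 * (c' + 1)) := min_le_right _ _
    rw [le_div_iff₀ (by positivity)] at this
    linarith
  rcases Nat.eq_zero_or_pos n with rfl | hn
  · exact ⟨p, fun i j => Subsingleton.elim _ _, fun i => by simpa [dH] using hε⟩
  have hn' : (0:ℝ) < n := by exact_mod_cast hn
  have hD : ∀ i j, ((⁅p i, p j⁆ : Equiv.Perm (Fin n)).support.card : ℝ) ≤ δ * n := by
    intro i j
    have h := hp i j
    rw [dH_eq_support, div_lt_iff₀ hn'] at h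
    have hc : (⁅p i, p j⁆ : Equiv.Perm (Fin n)) =
        (p j * p i) * ((p j * p i)⁻¹ * (p i * p j)) * (p j * p i)⁻¹ := by
      rw [commutatorElement_def]; group
    rw [hc, Equiv.Perm.card_support_conj]
    exact h.le
  set ρ : A → Equiv.Perm (Fin n) := fun a => FreeGroup.lift p (out a) with hρ
  set Bad : Finset (Fin n) := (M ×ˢ M).biUnion fun t =>
    (FreeGroup.lift p ((out (t.1 * t.2))⁻¹ * (out t.1 * out t.2))).support with hBad
  have hbad : (Bad.card : ℝ) ≤ η * n := by
    have h1 : Bad.card ≤ _ := Finset.card_biUnion_le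
    have h2 : (Bad.card : ℝ) ≤ ∑ t ∈ M ×ˢ M,
        ((FreeGroup.lift p ((out (t.1 * t.2))⁻¹ * (out t.1 * out t.2))).support.card : ℝ) := by
      exact_mod_cast h1
    refine h2.trans ((Finset.sum_le_sum fun t _ => hC t.1 t.2 n p _ hD).trans ?_)
    rw [← Finset.sum_mul, ← hc, ← mul_assoc]
    gcongr
  obtain ⟨q, E, hEc, hq⟩ := hmain n ρ Bad hbad (by
    intro x hx a ha b hb
    by_contra hne
    apply hx
    refine Finset.mem_biUnion.2 ⟨(a, b), Finset.mem_product.2 ⟨ha, hb⟩, ?_⟩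
    rw [Equiv.Perm.mem_support, map_mul, map_mul, map_inv]
    intro h
    apply hne
    rw [Equiv.Perm.mul_apply, Equiv.Perm.inv_eq_iff_eq] at h
    exact h)
  refine ⟨fun i => q (e i), fun i j => by
    show q (e i) * q (e j) = q (e j) * q (e i)
    rw [← map_mul q, ← map_mul q, mul_comm], fun i => ?_⟩
  have hs : (Finset.univ.filter fun x => p i x ≠ q (e i) x) ⊆
      E ∪
      (FreeGroup.lift p ((out (e i))⁻¹ * FreeGroup.of i)).support := by
    intro x hx
    rw [Finset.mem_union]
    by_cases h : q (e i) x = ρ (e i) x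
    · right
      rw [Equiv.Perm.mem_support, map_mul, map_inv, FreeGroup.lift_apply_of]
      intro h'
      rw [Equiv.Perm.mul_apply, Equiv.Perm.inv_eq_iff_eq] at h'
      exact (Finset.mem_filter.1 hx).2 (h'.trans h.symm)
    · left
      by_contra hE
      exact h (hq x hE _ (Finset.mem_image_of_mem _ (Finset.mem_univ _)))
  have h1 := (Finset.card_le_card hs).trans (Finset.card_union_le _ _)
  have h2 : ((Finset.univ.filter fun x => p i x ≠ q (e i) x).card : ℝ) ≤
      E.card +
      (FreeGroup.lift p ((out (e i))⁻¹ * FreeGroup.of i)).support.card := by exact_mod_cast h1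
  have h3 := hC' i n p _ hD
  have h4 : (C' i : ℝ) ≤ c' := Finset.single_le_sum (f := fun i => (C' i : ℝ))
    (fun _ _ => by positivity) (Finset.mem_univ i)
  have h5 : (C' i : ℝ) * (δ * n) ≤ ε / 4 * n := by
    calc (C' i : ℝ) * (δ * n) ≤ c' * (δ * n) := by gcongr
      _ = c' * δ * n := by ring
      _ ≤ _ := by gcongr
  have h7 : dH (p i) (q (e i)) < ε ↔ _ := div_lt_iff₀ hn'
  refine h7.2 ?_
  have h6 : 0 < ε * n := by positivity
  linarith

theorem almost_commuting_tuples_near_commuting (k : ℕ) (hk : 2 ≤ k) :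
    ∀ ε : ℝ, 0 < ε → ∃ δ : ℝ, 0 < δ ∧
      ∀ (n : ℕ) (p : Fin k → Equiv.Perm (Fin n)),
        (∀ i j, dH (p i * p j) (p j * p i) < δ) →
        ∃ q : Fin k → Equiv.Perm (Fin n),
          (∀ i j, q i * q j = q j * q i) ∧ ∀ i, dH (p i) (q i) < ε := by
  have : Group.FG (Abelianization (FreeGroup (Fin k))) :=
    inferInstanceAs (Group.FG (FreeGroup (Fin k) ⧸ commutator (FreeGroup (Fin k))))
  refine final_of_abelian k Abelianization.of (QuotientGroup.mk_surjective) ?_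
  rw [Abelianization.ker_of]
  exact commutator_le_smallWords k
end

section
/- For every k ≥ 2 and every real ε > 0 there exists δ > 0 such that for every natural number n and every tuple of even permutations p_1, …, p_k ∈ Alt(n) satisfying d_H(p_i∘p_j, p_j∘p_i) < δ for all i, j ∈ {1, …, k}, there exist even permutations q_1, …, q_k ∈ Alt(n) that pairwise commute (q_i∘q_j = q_j∘q_i for all i, j) and satisfy d_H(p_i, q_i) < ε for every i. -/
open Filter Topology

namespace ACE

/-- Greedy carving of a finite set into separated cells. -/
lemma carve {X : Type} [DecidableEq X] (B : ℕ → X → Finset X) (η : ℝ) (hη : 0 < η) (M : ℕ)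
    (h0 : ∀ x, x ∈ B 0 x) (hmono : ∀ t x, B t x ⊆ B (t + 1) x)
    (hM : ∀ x, ((B M x).card : ℝ) < (1 + η) ^ M) :
    ∀ (m : ℕ) (Y : Finset X), Y.card = m →
    ∃ (c : X → Option X) (t : X → ℕ),
      (∀ y x, c y = some x → y ∈ Y ∧ x ∈ Y ∧ y ∈ B (t x) x ∧ t x < M) ∧
      (∀ y x y' x', c y = some x → c y' = some x' → y' ∈ B (t x + 1) x → y ∈ B (t x' + 1) x' →
        x = x') ∧
      ((Y.filter (fun y => c y = none)).card : ℝ) ≤ η * Y.card := by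
  intro m
  induction m using Nat.strong_induction_on with
  | _ m ih =>
  intro Y hY
  rcases Y.eq_empty_or_nonempty with rfl | ⟨x, hx⟩
  · exact ⟨fun _ => none, fun _ => 0, by simp, by simp, by simp⟩
  have hB : ∀ t, x ∈ B t x := by
    intro t
    induction t with
    | zero => exact h0 x
    | succ t iht => exact hmono t x iht
  -- find a radius
  obtain ⟨t, htM, ht⟩ : ∃ t < M, ((B (t + 1) x ∩ Y).card : ℝ) ≤ (1 + η) * (B t x ∩ Y).card := by
    by_contra! hcon
    have key : ∀ t ≤ M, (1 + η) ^ t ≤ ((B t x ∩ Y).card : ℝ) := by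
      intro t
      induction t with
      | zero =>
        intro _
        have : 0 < (B 0 x ∩ Y).card := Finset.card_pos.2 ⟨x, Finset.mem_inter.2 ⟨h0 x, hx⟩⟩
        simp only [pow_zero]
        exact_mod_cast this
      | succ t iht =>
        intro h
        have h1 := iht (by omega)
        have h2 := hcon t (by omega)
        rw [pow_succ]
        nlinarith
    have h1 := key M le_rfl
    have h2 := hM x
    have h3 : ((B M x ∩ Y).card : ℝ) ≤ (B M x).card := by
      exact_mod_cast Finset.card_le_card Finset.inter_subset_left
    linarith
  set Y' := Y \ B (t + 1) x with hY'
  have hYlt : Y'.card < m := by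
    rw [← hY]
    apply Finset.card_lt_card
    refine ⟨Finset.sdiff_subset, fun h => ?_⟩
    have := h hx
    rw [hY', Finset.mem_sdiff] at this
    exact this.2 (hB _)
  obtain ⟨c, r, hc1, hc2, hc3⟩ := ih _ hYlt Y' rfl
  have hxY' : x ∉ Y' := by
    rw [hY', Finset.mem_sdiff]
    exact fun h => h.2 (hB _)
  refine ⟨fun y => if y ∈ B t x ∩ Y then some x else if y ∈ Y' then c y else none,
    fun z => if z = x then t else r z, ?_, ?_, ?_⟩
  · intro y z hyz
    dsimp only at hyz
    split_ifs at hyz with h1 h2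
    · obtain rfl : x = z := by simpa using hyz
      rw [Finset.mem_inter] at h1
      simp [h1.1, h1.2, hx, htM]
    · obtain ⟨a1, a2, a3, a4⟩ := hc1 y z hyz
      have hne : z ≠ x := fun h => hxY' (h ▸ a2)
      simp only [hne, if_false]
      exact ⟨(Finset.mem_sdiff.1 a1).1, (Finset.mem_sdiff.1 a2).1, a3, a4⟩
  · intro y z y' z' hyz hyz' hb hb'
    dsimp only at hyz hyz' hb hb'
    split_ifs at hyz with h1 h2 <;> split_ifs at hyz' with h3 h4
    · simp_all
    · obtain rfl : x = z := by simpa using hyz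
      simp only [if_true] at hb
      exact absurd hb (Finset.mem_sdiff.1 h4).2
    · obtain rfl : x = z' := by simpa using hyz'
      simp only [if_true] at hb'
      exact absurd hb' (Finset.mem_sdiff.1 h2).2
    · obtain ⟨a1, a2, a3, a4⟩ := hc1 y z hyz
      obtain ⟨b1, b2, b3, b4⟩ := hc1 y' z' hyz'
      have hne : z ≠ x := fun h => hxY' (h ▸ a2)
      have hne' : z' ≠ x := fun h => hxY' (h ▸ b2)
      simp only [hne, hne', if_false] at hb hb'
      exact hc2 y z y' z' hyz hyz' hb hb'
  · have hsub : (Y.filter (fun y => (if y ∈ B t x ∩ Y then some x else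
        if y ∈ Y' then c y else none) = none)) ⊆
        ((B (t + 1) x ∩ Y) \ (B t x ∩ Y)) ∪ Y'.filter (fun y => c y = none) := by
      intro y hy
      rw [Finset.mem_filter] at hy
      obtain ⟨hyY, hy⟩ := hy
      split_ifs at hy with h1 h2
      · exact Finset.mem_union_right _ (Finset.mem_filter.2 ⟨h2, hy⟩)
      · apply Finset.mem_union_left
        rw [Finset.mem_sdiff]
        refine ⟨?_, h1⟩
        rw [hY', Finset.mem_sdiff] at h2
        rw [Finset.mem_inter]
        tauto
    have hss : B t x ∩ Y ⊆ B (t + 1) x ∩ Y := Finset.inter_subset_inter (hmono t x) subset_rfl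
    have e1 : (((B (t + 1) x ∩ Y) \ (B t x ∩ Y)).card : ℝ) =
        (B (t + 1) x ∩ Y).card - (B t x ∩ Y).card := by
      rw [Finset.card_sdiff_of_subset hss, Nat.cast_sub (Finset.card_le_card hss)]
    have e2 : ((B (t + 1) x ∩ Y).card : ℝ) + Y'.card = Y.card := by
      have := Finset.card_inter_add_card_sdiff Y (B (t+1) x)
      rw [Finset.inter_comm] at this
      exact_mod_cast this
    have e3 : ((B t x ∩ Y).card : ℝ) ≤ (B (t + 1) x ∩ Y).card := by
      exact_mod_cast Finset.card_le_card hss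
    have e4 := (Finset.card_le_card hsub).trans (Finset.card_union_le _ _)
    have e5 : ((Y.filter (fun y => (if y ∈ B t x ∩ Y then some x else
        if y ∈ Y' then c y else none) = none)).card : ℝ) ≤
        ((B (t + 1) x ∩ Y) \ (B t x ∩ Y)).card + (Y'.filter (fun y => c y = none)).card := by
      exact_mod_cast e4
    refine e5.trans ?_
    rw [e1]
    nlinarith

/-- Iterated sumsets. -/
def ball {A : Type} [AddCommGroup A] [DecidableEq A] (E : Finset A) : ℕ → Finset A
  | 0 => {0}
  | t + 1 => Finset.image₂ (fun a b => a + b) E (ball E t)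

lemma ball_mono_succ {A : Type} [AddCommGroup A] [DecidableEq A] (E : Finset A) (h0 : 0 ∈ E)
    (t : ℕ) : ball E t ⊆ ball E (t + 1) := by
  intro v hv
  exact Finset.mem_image₂.2 ⟨0, h0, v, hv, zero_add v⟩

lemma ball_mono {A : Type} [AddCommGroup A] [DecidableEq A] (E : Finset A) (h0 : 0 ∈ E) :
    Monotone (ball E) := monotone_nat_of_le_succ (ball_mono_succ E h0)

lemma ball_card {A : Type} [AddCommGroup A] [DecidableEq A] (E : Finset A) (t : ℕ) :
    (ball E t).card ≤ (t + 1) ^ E.card := by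
  have key : ∀ t, ∀ v ∈ ball E t, ∃ f : E → ℕ, (∀ e, f e ≤ t) ∧ v = ∑ e, f e • (e : A) := by
    intro t
    induction t with
    | zero =>
      intro v hv
      simp only [ball, Finset.mem_singleton] at hv
      exact ⟨fun _ => 0, by simp, by simp [hv]⟩
    | succ t ih =>
      intro v hv
      obtain ⟨a, ha, b, hb, rfl⟩ := Finset.mem_image₂.1 hv
      obtain ⟨f, hf, rfl⟩ := ih b hb
      refine ⟨fun e => f e + if e = ⟨a, ha⟩ then 1 else 0, ?_, ?_⟩
      · intro e
        have := hf e
        dsimp only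
        split_ifs <;> omega
      · simp [add_smul, Finset.sum_add_distrib, add_comm, ite_smul]
  have hsub : ball E t ⊆ (Finset.univ : Finset (E → Fin (t + 1))).image
      (fun f => ∑ e : E, (f e : ℕ) • (e : A)) := by
    intro v hv
    obtain ⟨f, hf, rfl⟩ := key t v hv
    exact Finset.mem_image.2 ⟨fun e => ⟨f e, Nat.lt_succ_of_le (hf e)⟩, Finset.mem_univ _, rfl⟩
  refine (Finset.card_le_card hsub).trans (Finset.card_image_le.trans ?_)
  simp

lemma exists_radius {A : Type} [AddCommGroup A] [DecidableEq A] (E : Finset A) (η : ℝ)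
    (hη : 0 < η) : ∃ M, ((ball E M).card : ℝ) < (1 + η) ^ M := by
  have h := tendsto_pow_const_div_const_pow_of_one_lt E.card (show 1 < 1 + η by linarith)
  have h' := (tendsto_add_atTop_iff_nat 1).2 h
  have h1 : (0 : ℝ) < 1 / (1 + η) := by positivity
  obtain ⟨M, hM⟩ := (h'.eventually (gt_mem_nhds h1)).exists
  refine ⟨M, ?_⟩
  have h2 : ((ball E M).card : ℝ) ≤ ((M + 1 : ℕ) : ℝ) ^ E.card := by exact_mod_cast ball_card E M
  refine h2.trans_lt ?_
  have hp : (0 : ℝ) < (1 + η) ^ (M + 1) := by positivity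
  rw [div_lt_iff₀ hp, pow_succ] at hM
  have : 1 / (1 + η) * ((1 + η) ^ M * (1 + η)) = (1 + η) ^ M := by field_simp
  rwa [this] at hM

/-- Finite quotients of an abelian group with almost invariant transversals. -/
def Tileable (k : ℕ) (Q : Type) [AddCommGroup Q] : Prop :=
  ∀ (s : Fin k → Q) (ε : ℝ), 0 < ε →
    ∃ (H : Type) (_ : AddCommGroup H) (_ : Fintype H) (ρ : Q →+ H) (τ : H → Q) (U : Finset H),
      (∀ h, ρ (τ h) = h) ∧ (∀ h ∉ U, ∀ i, τ (h + ρ (s i)) = τ h + s i) ∧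
      (U.card : ℝ) ≤ ε * Fintype.card H

lemma Tileable.of_finite (k : ℕ) (Q : Type) [AddCommGroup Q] [Finite Q] : Tileable k Q := by
  intro s ε hε
  have := Fintype.ofFinite Q
  refine ⟨Q, inferInstance, inferInstance, AddMonoidHom.id Q, id, ∅, by simp, by simp, ?_⟩
  simp
  positivity

lemma Tileable.of_equiv {k : ℕ} {Q R : Type} [AddCommGroup Q] [AddCommGroup R] (f : Q ≃+ R)
    (h : Tileable k R) : Tileable k Q := by
  intro s ε hε
  obtain ⟨H, i1, i2, ρ, τ, U, h1, h2, h3⟩ := h (fun i => f (s i)) ε hε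
  refine ⟨H, i1, i2, ρ.comp f.toAddMonoidHom, fun h => f.symm (τ h), U, by simp [h1], ?_, h3⟩
  intro h hh i
  have : f.toAddMonoidHom (s i) = f (s i) := rfl
  dsimp only
  rw [AddMonoidHom.comp_apply, this, h2 h hh i]
  simp

lemma Tileable.prod {k : ℕ} {Q R : Type} [AddCommGroup Q] [AddCommGroup R]
    (hQ : Tileable k Q) (hR : Tileable k R) : Tileable k (Q × R) := by
  classical
  intro s ε hε
  obtain ⟨H, i1, i2, ρ, τ, U, h1, h2, h3⟩ := hQ (fun i => (s i).1) (ε / 2) (by positivity)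
  obtain ⟨H', i1', i2', ρ', τ', U', h1', h2', h3'⟩ := hR (fun i => (s i).2) (ε / 2) (by positivity)
  refine ⟨H × H', inferInstance, inferInstance, ρ.prodMap ρ', fun h => (τ h.1, τ' h.2),
    U ×ˢ Finset.univ ∪ Finset.univ ×ˢ U', by simp [h1, h1'], ?_, ?_⟩
  · intro h hh i
    simp only [Finset.mem_union, Finset.mem_product, Finset.mem_univ, and_true, true_and,
      not_or] at hh
    have d1 := h2 h.1 hh.1 i
    have d2 := h2' h.2 hh.2 i
    ext <;> simp [d1, d2]
  have e := Finset.card_union_le (U ×ˢ (Finset.univ : Finset H')) ((Finset.univ : Finset H) ×ˢ U')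
  rw [Finset.card_product, Finset.card_product, Finset.card_univ, Finset.card_univ] at e
  have e' : ((U ×ˢ (Finset.univ : Finset H') ∪ (Finset.univ : Finset H) ×ˢ U').card : ℝ) ≤
      U.card * Fintype.card H' + Fintype.card H * U'.card := by exact_mod_cast e
  refine e'.trans ?_
  rw [Fintype.card_prod]
  push_cast
  have p1 : (0 : ℝ) ≤ Fintype.card H := by positivity
  have p2 : (0 : ℝ) ≤ Fintype.card H' := by positivity
  nlinarith [mul_le_mul_of_nonneg_right h3 p2, mul_le_mul_of_nonneg_left h3' p1]

lemma Tileable.int (k : ℕ) : Tileable k ℤ := by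
  classical
  intro s ε hε
  set S : ℕ := ∑ i, (s i).natAbs with hS
  obtain ⟨N, hN⟩ := exists_nat_gt (2 * S / ε)
  have hN0 : N ≠ 0 := by
    rintro rfl
    have : (0 : ℝ) ≤ 2 * S / ε := by positivity
    simp at hN
    linarith
  have : NeZero N := ⟨hN0⟩
  refine ⟨ZMod N, inferInstance, inferInstance, Int.castAddHom (ZMod N), fun h => (h.val : ℤ),
    Finset.univ.filter (fun h : ZMod N => h.val < S ∨ N - S ≤ h.val), by simp, ?_, ?_⟩
  · intro h hh i
    simp only [Finset.mem_filter, Finset.mem_univ, true_and, not_or, not_lt, not_le] at hh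
    have hl := ZMod.val_lt h
    have hsi : (s i).natAbs ≤ S := Finset.single_le_sum (f := fun i => (s i).natAbs)
      (fun _ _ => Nat.zero_le _) (Finset.mem_univ i)
    have : h + Int.castAddHom (ZMod N) (s i) = (((h.val : ℤ) + s i : ℤ) : ZMod N) := by
      simp
    dsimp only
    rw [this, ZMod.val_intCast]
    apply Int.emod_eq_of_lt <;> omega
  rw [div_lt_iff₀ hε] at hN
  have hc : (Finset.univ.filter (fun h : ZMod N => h.val < S ∨ N - S ≤ h.val)).card ≤
      (Finset.range S ∪ Finset.Ico (N - S) N).card := by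
    apply Finset.card_le_card_of_injOn (fun h => h.val)
    · intro h hh
      have hl := ZMod.val_lt h
      simp at hh ⊢
      tauto
    · intro a _ b _ hab
      exact ZMod.val_injective N hab
  have hc' := hc.trans (Finset.card_union_le _ _)
  rw [Finset.card_range, Nat.card_Ico] at hc'
  have hc2 : (Finset.univ.filter (fun h : ZMod N => h.val < S ∨ N - S ≤ h.val)).card ≤ 2 * S := by
    omega
  rw [ZMod.card]
  have hc3 : ((Finset.univ.filter (fun h : ZMod N => h.val < S ∨ N - S ≤ h.val)).card : ℝ) ≤
      2 * S := by exact_mod_cast hc2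
  linarith

lemma Tileable.pi_int (k m : ℕ) : Tileable k (Fin m → ℤ) := by
  induction m with
  | zero => exact Tileable.of_finite k _
  | succ m ih =>
    exact Tileable.of_equiv (Fin.consLinearEquiv ℤ (fun _ : Fin (m + 1) => ℤ)).symm.toAddEquiv
      ((Tileable.int k).prod ih)

lemma Tileable.of_fg (k : ℕ) (Q : Type) [AddCommGroup Q] [AddGroup.FG Q] : Tileable k Q := by
  obtain ⟨n, ι, _, p, hp, e, ⟨f⟩⟩ := AddCommGroup.equiv_free_prod_directSum_zmod Q
  have : ∀ i, NeZero (p i ^ e i) := fun i => ⟨pow_ne_zero _ (hp i).ne_zero⟩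
  have : Finite (DirectSum ι fun i => ZMod (p i ^ e i)) := by
    classical
    exact Finite.of_equiv _ (DirectSum.addEquivProd (fun i => ZMod (p i ^ e i))).symm.toEquiv
  exact Tileable.of_equiv f
    ((Tileable.of_equiv (Finsupp.linearEquivFunOnFinite ℤ ℤ (Fin n)).toAddEquiv
      (Tileable.pi_int k n)).prod (Tileable.of_finite k _))

/-- The relations `P v (P w x) = P (v + w) x` hold at `x` for all `v, w ∈ F`. -/
def Good {A X : Type} [Add A] (F : Finset A) (P : A → Equiv.Perm X) (x : X) : Prop :=
  ∀ v ∈ F, ∀ w ∈ F, P v (P w x) = P (v + w) x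

/-- An exact commuting system inside `Y` agreeing with `P` outside a set of size at most `r`. -/
def Covers {k : ℕ} {A X : Type} (P : A → Equiv.Perm X) (e : Fin k → A) (Y : Finset X)
    (r : ℝ) : Prop :=
  ∃ (S : Type) (f : Fin k → Equiv.Perm S) (Φ : S → X) (D : Finset X),
    Function.Injective Φ ∧ (∀ i j, f i * f j = f j * f i) ∧ (∀ s, Φ s ∈ Y) ∧
    (∀ y ∈ Y, y ∉ D → ∃ s, Φ s = y ∧ ∀ i, P (e i) y = Φ (f i s)) ∧ (D.card : ℝ) ≤ r

set_option maxHeartbeats 1000000 in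
lemma local_subgroup {k : ℕ} {A : Type} [AddCommGroup A] [AddGroup.FG A] (e : Fin k → A)
    (L : AddSubgroup A) (ε : ℝ) (hε : 0 < ε) :
    ∃ F : Finset A, ∀ (X : Type) [Fintype X] (P : A → Equiv.Perm X), P 0 = 1 →
      ∀ Y Z : Finset X, (∀ y ∈ Y, Good F P y) → (∀ y ∈ Y, ∀ a ∈ F, P a y = y ↔ a ∈ L) →
        (∀ y ∈ Y, y ∉ Z → ∀ v ∈ F, P v y ∈ Y) → Covers P e Y (ε * Y.card + Z.card) := by
  classical
  have hfs : ∀ a b c : ℝ, 0 < a → a * (b / a * c) = b * c := by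
    intro a b c ha
    field_simp
  let π : A →+ A ⧸ L := QuotientAddGroup.mk' L
  have hFG : AddGroup.FG (A ⧸ L) := inferInstance
  obtain ⟨H, _, _, ρ, τ, U, hρτ, hU, hUc⟩ :=
    Tileable.of_fg k (A ⧸ L) (fun i => π (e i)) (ε / 2) (by positivity)
  let σ : A ⧸ L → A := Quotient.out
  have hσ : ∀ g, π (σ g) = g := fun g => Quotient.out_eq g
  have hπL : ∀ v w : A, π v = π w → v - w ∈ L := by
    intro v w h
    rw [← QuotientAddGroup.eq_zero_iff]
    have : π (v - w) = 0 := by rw [map_sub, h, sub_self]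
    exact this
  have hLπ : ∀ v w : A, v - w ∈ L → π v = π w := by
    intro v w h
    rw [← QuotientAddGroup.eq_zero_iff] at h
    have : π (v - w) = 0 := h
    rw [map_sub] at this
    exact sub_eq_zero.1 this
  let E0 : Finset A := {0} ∪ Finset.univ.image e ∪
    Finset.univ.image (fun hh : H × H => σ (τ hh.2 - τ hh.1))
  obtain ⟨E, hE⟩ : ∃ E : Finset A, E = E0 ∪ E0.image (fun a => -a) := ⟨_, rfl⟩
  have h0E : (0 : A) ∈ E := by simp [hE, E0]
  have heE : ∀ i, e i ∈ E := by simp [hE, E0]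
  have hτE : ∀ h h', σ (τ h' - τ h) ∈ E := by
    intro h h'
    rw [hE]
    apply Finset.mem_union_left
    apply Finset.mem_union_right
    exact Finset.mem_image.2 ⟨(h, h'), Finset.mem_univ _, rfl⟩
  have hnegE : ∀ a ∈ E, -a ∈ E := by
    intro a ha
    rw [hE, Finset.mem_union, Finset.mem_image] at ha ⊢
    rcases ha with ha | ⟨b, hb, rfl⟩
    · right
      exact ⟨a, ha, rfl⟩
    · left
      rwa [neg_neg]
  have hEpos : (0 : ℝ) < E.card := by
    have : 0 < E.card := Finset.card_pos.2 ⟨0, h0E⟩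
    exact_mod_cast this
  obtain ⟨M, hM⟩ := exists_radius E (ε / 2 / E.card) (by positivity)
  let V := ball E (M + 1)
  obtain ⟨W, hW⟩ : ∃ W : Finset (A ⧸ L), W = (ball E M).image (fun v => π v - τ (ρ (π v))) :=
    ⟨_, rfl⟩
  let R := Finset.image₂ (fun (c : A ⧸ L) (h : H) => σ (c + τ h)) W Finset.univ
  let K := V ∪ R
  obtain ⟨F, hF⟩ : ∃ F : Finset A, F = K ∪ Finset.image₂ (fun a b => a - b) K K := ⟨_, rfl⟩
  have hKF : ∀ v ∈ K, v ∈ F := fun v hv => hF ▸ Finset.mem_union_left _ hv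
  have hKKF : ∀ v ∈ K, ∀ w ∈ K, v - w ∈ F := fun v hv w hw =>
    hF ▸ Finset.mem_union_right _ (Finset.mem_image₂.2 ⟨v, hv, w, hw, rfl⟩)
  have hVK : ∀ t ≤ M + 1, ∀ v ∈ ball E t, v ∈ K := fun t ht v hv =>
    Finset.mem_union_left _ (ball_mono E h0E ht hv)
  have hEK : ∀ v ∈ E, v ∈ K := by
    intro v hv
    apply hVK 1 (by omega)
    exact Finset.mem_image₂.2 ⟨v, hv, 0, by simp [ball], by simp⟩
  have hRK : ∀ c ∈ W, ∀ h, σ (c + τ h) ∈ K := fun c hc h =>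
    Finset.mem_union_right _ (Finset.mem_image₂.2 ⟨c, hc, h, Finset.mem_univ _, rfl⟩)
  refine ⟨F, ?_⟩
  intro X _ P hP0 Y Z hG hS hZ
  have hinj : ∀ x ∈ Y, ∀ v ∈ K, ∀ w ∈ K, P v x = P w x ↔ v - w ∈ L := by
    intro x hx v hv w hw
    have h1 := hG x hx w (hKF w hw) (v - w) (hKKF v hv w hw)
    rw [add_sub_cancel] at h1
    rw [← hS x hx _ (hKKF v hv w hw), ← h1]
    exact (P w).injective.eq_iff
  let B : ℕ → X → Finset X := fun t x => (ball E t).image (fun v => P v x)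
  have hstep : ∀ x ∈ Y, ∀ t ≤ M, ∀ v ∈ ball E t, ∀ a ∈ E,
      P a (P v x) = P (a + v) x ∧ a + v ∈ ball E (t + 1) := by
    intro x hx t ht v hv a ha
    refine ⟨hG x hx a (hKF _ (hEK a ha)) v (hKF _ (hVK t (by omega) v hv)), ?_⟩
    exact Finset.mem_image₂.2 ⟨a, ha, v, hv, rfl⟩
  obtain ⟨c, r, hc1, hc2, hc3⟩ := carve B (ε / 2 / E.card) (by positivity) M
    (fun x => Finset.mem_image.2 ⟨0, by simp [ball], by simp [hP0]⟩)
    (fun t x => Finset.image_subset_image (ball_mono_succ E h0E t))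
    (fun x => lt_of_le_of_lt (by exact_mod_cast Finset.card_image_le) hM) Y.card Y rfl
  -- interior points
  have hinter : ∀ y ∈ Y, y ∉ Z → (∀ a ∈ E, c (P a y) ≠ none) → ∃ x, c y = some x ∧
      ∀ a ∈ E, c (P a y) = some x := by
    intro y hy hyZ hnone
    have h0 := hnone 0 h0E
    rw [hP0, Equiv.Perm.one_apply] at h0
    obtain ⟨x, hx⟩ := Option.ne_none_iff_exists'.1 h0
    refine ⟨x, hx, fun a ha => ?_⟩
    obtain ⟨x', hx'⟩ := Option.ne_none_iff_exists'.1 (hnone a ha)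
    obtain ⟨-, b2, b3, b4⟩ := hc1 y x hx
    obtain ⟨d1, d2, d3, d4⟩ := hc1 _ x' hx'
    have : x = x' := by
      apply hc2 y x (P a y) x' hx hx'
      · obtain ⟨v, hv, hvy⟩ := Finset.mem_image.1 b3
        obtain ⟨s1, s2⟩ := hstep x b2 (r x) b4.le v hv a ha
        refine Finset.mem_image.2 ⟨a + v, s2, ?_⟩
        rw [← hvy, s1]
      · obtain ⟨v, hv, hvy⟩ := Finset.mem_image.1 d3
        obtain ⟨s1, s2⟩ := hstep x' d2 (r x') d4.le v hv (-a) (hnegE a ha)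
        refine Finset.mem_image.2 ⟨-a + v, s2, ?_⟩
        rw [← s1, hvy, hG y hy (-a) (hKF _ (hEK _ (hnegE a ha))) a (hKF _ (hEK _ ha))]
        simp [hP0]
    rw [hx', this]
  let J := {xc : X × (A ⧸ L) // xc.2 ∈ W ∧ ρ xc.2 = 0 ∧
    ∀ h, c (P (σ (xc.2 + τ h)) xc.1) = some xc.1}
  let Φ : J × H → X := fun s => P (σ (s.1.1.2 + τ s.2)) s.1.1.1
  have hJY : ∀ j : J, j.1.1 ∈ Y := fun j => (hc1 _ _ (j.2.2.2 0)).2.1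
  have hΦ : Function.Injective Φ := by
    rintro ⟨⟨⟨x, d⟩, hd1, hd2, hd3⟩, h⟩ ⟨⟨⟨x', d'⟩, hd1', hd2', hd3'⟩, h'⟩ heq
    dsimp only [Φ] at heq
    dsimp only at hd1 hd2 hd3 hd1' hd2' hd3'
    have hxx : x = x' := by
      have h1 := hd3 h
      rw [heq, hd3' h'] at h1
      exact (Option.some.inj h1).symm
    subst hxx
    have hxY : x ∈ Y := (hc1 _ _ (hd3 0)).2.1
    rw [hinj x hxY _ (hRK d hd1 h) _ (hRK d' hd1' h')] at heq
    have h2 := hLπ _ _ heq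
    rw [hσ, hσ] at h2
    have h3 := congrArg ρ h2
    rw [map_add, map_add, hd2, hd2', hρτ, hρτ, zero_add, zero_add] at h3
    subst h3
    have h4 := add_right_cancel h2
    subst h4
    rfl
  have hΦY : ∀ s, Φ s ∈ Y := fun s => (hc1 _ _ (s.1.2.2.2 s.2)).1
  have : Finite (J × H) := Finite.of_injective Φ hΦ
  have : Finite J := Finite.of_injective (fun j : J => (j, (0 : H)))
    (fun a b h => (Prod.mk.inj h).1)
  have : Fintype J := Fintype.ofFinite J
  let N0 := Y.filter (fun y => c y = none)
  refine ⟨J × H, fun i => Equiv.prodCongr (Equiv.refl J) (Equiv.addRight (ρ (π (e i)))), Φ,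
    Z ∪ (E.biUnion fun a => N0.image (P a).symm) ∪ (Finset.univ ×ˢ U).image Φ, hΦ, ?_, hΦY, ?_, ?_⟩
  · intro i j
    exact Equiv.ext fun s => Prod.ext rfl (add_right_comm _ _ _)
  · intro y hy hyD
    simp only [Finset.mem_union, not_or] at hyD
    obtain ⟨⟨hyZ, hyN⟩, hyU⟩ := hyD
    obtain ⟨x, hx, hxa⟩ := hinter y hy hyZ (by
      intro a ha hnone
      apply hyN
      refine Finset.mem_biUnion.2 ⟨a, ha, Finset.mem_image.2 ⟨P a y, ?_, by simp⟩⟩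
      exact Finset.mem_filter.2 ⟨hZ y hy hyZ a (hKF _ (hEK a ha)), hnone⟩)
    obtain ⟨-, b2, b3, b4⟩ := hc1 y x hx
    obtain ⟨v, hv, hvy⟩ := Finset.mem_image.1 b3
    have hvM : v ∈ ball E M := ball_mono E h0E b4.le hv
    let h := ρ (π v)
    let d := π v - τ h
    have hd : d ∈ W := by
      rw [hW]
      exact Finset.mem_image.2 ⟨v, hvM, rfl⟩
    have hcoord : ∀ a ∈ E, ∀ h', π (a + v) = d + τ h' → P a y = P (σ (d + τ h')) x := by
      intro a ha h' hah
      obtain ⟨s1, s2⟩ := hstep x b2 M le_rfl v hvM a ha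
      rw [← hvy, s1, hinj x b2 _ (hVK _ le_rfl _ s2) _ (hRK d hd h')]
      apply hπL
      rw [hσ, hah]
    have hfull : ∀ h', c (P (σ (d + τ h')) x) = some x := by
      intro h'
      rw [← hcoord (σ (τ h' - τ h)) (hτE h h') h' ?_]
      · exact hxa _ (hτE h h')
      · rw [map_add, hσ]
        simp only [d]
        abel
    let j : J := ⟨(x, d), hd, by simp [d, h, hρτ], hfull⟩
    have hjy : Φ (j, h) = y := by
      have := hcoord 0 h0E h (by simp [d])
      rw [hP0, Equiv.Perm.one_apply] at this
      exact this.symm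
    refine ⟨(j, h), hjy, ?_⟩
    intro i
    have hhU : h ∉ U := by
      intro hh
      apply hyU
      exact Finset.mem_image.2 ⟨(j, h), by simp [hh], hjy⟩
    have h1 := hU h hhU i
    refine hcoord (e i) (heE i) (h + ρ (π (e i))) ?_
    rw [h1, map_add]
    simp only [d]
    abel
  · have c1 : ((E.biUnion fun a => N0.image (P a).symm).card : ℝ) ≤ ε / 2 * Y.card := by
      have : (E.biUnion fun a => N0.image (P a).symm).card ≤ E.card * N0.card :=
        Finset.card_biUnion_le_card_mul _ _ _ (fun a _ => Finset.card_image_le)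
      have h1 : ((E.biUnion fun a => N0.image (P a).symm).card : ℝ) ≤ E.card * N0.card := by
        exact_mod_cast this
      refine h1.trans ((mul_le_mul_of_nonneg_left hc3 hEpos.le).trans (le_of_eq ?_))
      exact hfs _ _ _ hEpos
    have c2 : (((Finset.univ ×ˢ U : Finset (J × H)).image Φ).card : ℝ) ≤ ε / 2 * Y.card := by
      have h1 : ((Finset.univ ×ˢ U : Finset (J × H)).image Φ).card ≤ Fintype.card J * U.card := by
        refine Finset.card_image_le.trans ?_
        rw [Finset.card_product, Finset.card_univ]
      have h2 : Fintype.card J * Fintype.card H ≤ Y.card := by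
        rw [← Fintype.card_prod, ← Finset.card_univ]
        exact Finset.card_le_card_of_injOn Φ (fun s _ => hΦY s) hΦ.injOn
      have h1' : (((Finset.univ ×ˢ U : Finset (J × H)).image Φ).card : ℝ) ≤
        Fintype.card J * U.card := by exact_mod_cast h1
      have h2' : (Fintype.card J : ℝ) * Fintype.card H ≤ Y.card := by exact_mod_cast h2
      have h3 : (0 : ℝ) ≤ Fintype.card J := by positivity
      nlinarith [mul_le_mul_of_nonneg_left hUc h3]
    have c3 := Finset.card_union_le (Z ∪ (E.biUnion fun a => N0.image (P a).symm))
      ((Finset.univ ×ˢ U : Finset (J × H)).image Φ)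
    have c4 := Finset.card_union_le Z (E.biUnion fun a => N0.image (P a).symm)
    have c5 : ((Z ∪ (E.biUnion fun a => N0.image (P a).symm) ∪
        (Finset.univ ×ˢ U : Finset (J × H)).image Φ).card : ℝ) ≤
        Z.card + (E.biUnion fun a => N0.image (P a).symm).card +
        ((Finset.univ ×ˢ U : Finset (J × H)).image Φ).card := by exact_mod_cast c3.trans (by omega)
    linarith

lemma local_set {k : ℕ} {A : Type} [AddCommGroup A] [AddGroup.FG A] (e : Fin k → A)
    (ε : ℝ) (hε : 0 < ε) (S : A → Bool) :
    ∃ F : Finset A, ∀ (X : Type) [Fintype X] (P : A → Equiv.Perm X), P 0 = 1 →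
      ∀ Y Z : Finset X, (∀ y ∈ Y, Good F P y) → (∀ y ∈ Y, ∀ a ∈ F, P a y = y ↔ S a = true) →
        (∀ y ∈ Y, y ∉ Z → ∀ v ∈ F, P v y ∈ Y) → Covers P e Y (ε * Y.card + Z.card) := by
  classical
  by_cases h0 : S 0 = true
  swap
  · refine ⟨{0}, fun X _ P hP0 Y Z hG hS _ => ?_⟩
    have hY : Y = ∅ := by
      rw [Finset.eq_empty_iff_forall_notMem]
      intro y hy
      exact h0 ((hS y hy 0 (by simp)).1 (by simp [hP0]))
    subst hY
    exact ⟨Empty, fun _ => 1, Empty.elim, ∅, fun a => a.elim, by simp, fun a => a.elim, by simp,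
      by simp⟩
  by_cases hsub : ∀ a b, S a = true → S b = true → S (a - b) = true
  · obtain ⟨F, hF⟩ := local_subgroup e
      (AddSubgroup.ofSub {a | S a = true} ⟨0, h0⟩ (by
        intro a ha b hb
        have := hsub a b ha hb
        rw [sub_eq_add_neg] at this
        exact this)) ε hε
    exact ⟨F, hF⟩
  · push Not at hsub
    obtain ⟨a, b, ha, hb, hab⟩ := hsub
    refine ⟨{a, b, a - b}, fun X _ P hP0 Y Z hG hS _ => ?_⟩
    have hY : Y = ∅ := by
      rw [Finset.eq_empty_iff_forall_notMem]
      intro y hy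
      have h1 := (hS y hy a (by simp)).2 ha
      have h2 := (hS y hy b (by simp)).2 hb
      have h3 := hG y hy b (by simp) (a - b) (by simp)
      rw [add_sub_cancel, h1] at h3
      exact hab ((hS y hy (a - b) (by simp)).1 ((P b).injective (h3.trans h2.symm)))
    subst hY
    exact ⟨Empty, fun _ => 1, Empty.elim, ∅, fun a => a.elim, by simp, fun a => a.elim, by simp,
      by simp⟩

set_option maxHeartbeats 1000000 in
lemma global {k : ℕ} {A : Type} [AddCommGroup A] [AddGroup.FG A] (e : Fin k → A)
    (ε : ℝ) (hε : 0 < ε) :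
    ∃ (F : Finset A) (C : ℝ), 0 ≤ C ∧ ∀ (X : Type) [Fintype X] (P : A → Equiv.Perm X), P 0 = 1 →
      ∀ Bad : Finset X, (∀ x ∉ Bad, Good F P x) →
        Covers P e Finset.univ (ε * Fintype.card X + C * Bad.card) := by
  classical
  choose F hF using local_set e ε hε
  obtain ⟨t, ht⟩ := CompactSpace.elim_nhds_subcover
    (fun S : A → Bool => {S' | ∀ a ∈ F S, S' a = S a}) (by
      intro S
      apply IsOpen.mem_nhds
      · have : {S' : A → Bool | ∀ a ∈ F S, S' a = S a} =
            (↑(F S) : Set A).pi (fun a => {S a}) := by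
          ext S'
          simp [Set.mem_pi]
        rw [this]
        exact isOpen_set_pi (F S).finite_toSet (fun a _ => isOpen_discrete _)
      · intro a _
        rfl)
  have hch : ∀ S' : A → Bool, ∃ S ∈ t, ∀ a ∈ F S, S' a = S a := by
    intro S'
    have h1 : S' ∈ (⊤ : Set (A → Bool)) := trivial
    rw [← ht] at h1
    simpa using h1
  choose f hft hfa using hch
  refine ⟨t.biUnion F, 1 + ∑ S ∈ t, ((F S).card : ℝ), by positivity, ?_⟩
  intro X _ P hP0 Bad hBad
  let trunc : X → A → Bool := fun x a => decide (a ∈ t.biUnion F ∧ P a x = x)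
  let Y : (A → Bool) → Finset X := fun S =>
    (Finset.univ \ Bad).filter (fun x => f (trunc x) = S)
  let Z : (A → Bool) → Finset X := fun S => (F S).biUnion (fun v => Bad.image (P v).symm)
  have hFF : ∀ S ∈ t, ∀ a ∈ F S, a ∈ t.biUnion F := fun S hS a ha =>
    Finset.mem_biUnion.2 ⟨S, hS, ha⟩
  have hcov : ∀ S : t, Covers P e (Y S) (ε * (Y S).card + (Z S).card) := by
    rintro ⟨S, hS⟩
    apply hF S X P hP0
    · intro y hy v hv w hw
      simp only [Y, Finset.mem_filter, Finset.mem_sdiff, Finset.mem_univ, true_and] at hy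
      exact hBad y hy.1 v (hFF S hS v hv) w (hFF S hS w hw)
    · intro y hy a ha
      simp only [Y, Finset.mem_filter, Finset.mem_sdiff, Finset.mem_univ, true_and] at hy
      have h1 := hfa (trunc y) a (by rw [hy.2]; exact ha)
      rw [hy.2] at h1
      rw [← h1]
      simp only [trunc, decide_eq_true_eq]
      exact ⟨fun h => ⟨hFF S hS a ha, h⟩, fun h => h.2⟩
    · intro y hy hyZ v hv
      simp only [Y, Finset.mem_filter, Finset.mem_sdiff, Finset.mem_univ, true_and] at hy ⊢
      refine ⟨fun hb => hyZ ?_, ?_⟩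
      · exact Finset.mem_biUnion.2 ⟨v, hv, Finset.mem_image.2 ⟨P v y, hb, by simp⟩⟩
      · rw [← hy.2]
        congr 1
        funext a
        simp only [trunc]
        rw [decide_eq_decide]
        apply and_congr_right
        intro ha
        rw [hBad y hy.1 a ha v (hFF S hS v hv), add_comm, ← hBad y hy.1 v (hFF S hS v hv) a ha]
        exact (P v).injective.eq_iff
  choose T g Φ D hΦ hg hΦY hcv hD using hcov
  refine ⟨Σ S : t, T S, fun i => Equiv.Perm.sigmaCongrRight (fun S => g S i),
    fun s => Φ s.1 s.2, Bad ∪ Finset.univ.biUnion D, ?_, ?_, fun _ => Finset.mem_univ _, ?_, ?_⟩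
  · rintro ⟨S, s⟩ ⟨S', s'⟩ h
    dsimp only at h
    have h1 := hΦY S s
    have h2 := hΦY S' s'
    rw [← h] at h2
    have h3 := (Finset.mem_filter.1 h1).2
    have h4 := (Finset.mem_filter.1 h2).2
    obtain rfl : S = S' := Subtype.ext (h3.symm.trans h4)
    rw [hΦ S h]
  · intro i j
    refine Equiv.ext fun s => ?_
    have := Equiv.ext_iff.1 (hg s.1 i j) s.2
    exact congrArg (Sigma.mk s.1) this
  · intro y _ hy
    simp only [Finset.mem_union, not_or, Finset.mem_biUnion, Finset.mem_univ, true_and,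
      not_exists] at hy
    let S : t := ⟨f (trunc y), hft _⟩
    obtain ⟨s, hs1, hs2⟩ := hcv S y (by simp [Y, S, hy.1]) (hy.2 S)
    exact ⟨⟨S, s⟩, hs1, hs2⟩
  · have c1 : ((Bad ∪ Finset.univ.biUnion D).card : ℝ) ≤ Bad.card + ∑ S : t, ((D S).card : ℝ) := by
      have h1 := (Finset.card_union_le Bad (Finset.univ.biUnion D)).trans
        (Nat.add_le_add_left Finset.card_biUnion_le _)
      exact_mod_cast h1
    have c2 : ∑ S : t, ((D S).card : ℝ) ≤ ∑ S : t, (ε * (Y S).card + (Z S).card) :=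
      Finset.sum_le_sum (fun S _ => hD S)
    have c3 : ∑ S : t, (ε * ((Y S).card : ℝ) + (Z S).card) =
        ε * ∑ S ∈ t, ((Y S).card : ℝ) + ∑ S ∈ t, ((Z S).card : ℝ) := by
      rw [Finset.sum_coe_sort t (fun S => ε * ((Y S).card : ℝ) + (Z S).card),
        Finset.sum_add_distrib, Finset.mul_sum]
    have c4 : ∑ S ∈ t, ((Y S).card : ℝ) ≤ Fintype.card X := by
      have h1 := Finset.card_eq_sum_card_fiberwise (s := Finset.univ \ Bad) (t := t)
        (f := fun x => f (trunc x)) (fun x _ => hft _)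
      have h2 : (Finset.univ \ Bad).card ≤ Fintype.card X := Finset.card_le_univ _
      rw [h1] at h2
      exact_mod_cast h2
    have c5 : ∑ S ∈ t, ((Z S).card : ℝ) ≤ (∑ S ∈ t, ((F S).card : ℝ)) * Bad.card := by
      rw [Finset.sum_mul]
      apply Finset.sum_le_sum
      intro S _
      have : (Z S).card ≤ (F S).card * Bad.card :=
        Finset.card_biUnion_le_card_mul _ _ _ (fun a _ => Finset.card_image_le)
      exact_mod_cast this
    have c6 := mul_le_mul_of_nonneg_left c4 hε.le
    rw [c3] at c2
    linarith

/-- The ordered word `g₁ ^ v₁ ⋯ gₖ ^ vₖ`. -/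
def word {k : ℕ} {G : Type*} [Group G] (g : Fin k → G) (v : Fin k → ℤ) : G :=
  (List.ofFn (fun i => g i ^ v i)).prod

lemma word_zero {k : ℕ} {G : Type*} [Group G] (g : Fin k → G) : word g 0 = 1 := by
  simp [word]

lemma word_single {k : ℕ} {G : Type*} [Group G] (g : Fin k → G) (i : Fin k) :
    word g (Pi.single i 1) = g i := by
  unfold word
  induction k with
  | zero => exact i.elim0
  | succ k ih =>
    rw [List.ofFn_succ, List.prod_cons]
    refine Fin.cases ?_ (fun j => ?_) i
    · simp
    · have h1 := ih (fun j => g j.succ) j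
      simp only [Pi.single_apply, Fin.succ_inj] at h1 ⊢
      rw [h1, if_neg (Fin.succ_ne_zero j).symm]
      simp

lemma word_map {k : ℕ} {G G' : Type*} [Group G] [Group G'] (φ : G →* G') (g : Fin k → G)
    (v : Fin k → ℤ) : φ (word g v) = word (fun i => φ (g i)) v := by
  unfold word
  rw [map_list_prod, List.map_ofFn]
  congr 2
  funext i
  simp

open scoped IsMulCommutative in
lemma word_add {k : ℕ} {G : Type*} [Group G] (g : Fin k → G) (hg : ∀ i j, g i * g j = g j * g i)
    (v w : Fin k → ℤ) : word g v * word g w = word g (v + w) := by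
  have hc : IsMulCommutative (Subgroup.closure (Set.range g)) :=
    Subgroup.isMulCommutative_closure (by
      rintro _ ⟨i, rfl⟩ _ ⟨j, rfl⟩
      exact hg i j)
  let g' : Fin k → Subgroup.closure (Set.range g) := fun i =>
    ⟨g i, Subgroup.subset_closure ⟨i, rfl⟩⟩
  have h1 : word g' v * word g' w = word g' (v + w) := by
    unfold word
    simp only [List.prod_ofFn]
    rw [← Finset.prod_mul_distrib]
    apply Finset.prod_congr rfl
    intro i _
    rw [Pi.add_apply, zpow_add]
  have h2 := congrArg (Subgroup.subtype _) h1
  rw [map_mul, word_map, word_map, word_map] at h2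
  exact h2

/-- All almost commuting tuples together with their sets of bad points. -/
structure Idx (k : ℕ) : Type 1 where
  X : Type
  p : Fin k → Equiv.Perm X
  D : Finset X
  h : ∀ i j, ∀ x ∉ D, p i (p j x) = p j (p i x)

/-- The families of permutations whose supports are linearly bounded by the bad sets. -/
def smallSub (k : ℕ) : Subgroup (∀ a : Idx k, Equiv.Perm a.X) where
  carrier := {g | ∃ C : ℕ, ∀ a, ∃ D' : Finset a.X, D'.card ≤ C * a.D.card ∧ ∀ x ∉ D', g a x = x}
  one_mem' := ⟨0, fun a => ⟨∅, by simp, by simp⟩⟩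
  mul_mem' := by
    classical
    rintro g h ⟨C, hC⟩ ⟨C', hC'⟩
    refine ⟨C + C', fun a => ?_⟩
    obtain ⟨D, hD, hg⟩ := hC a
    obtain ⟨D', hD', hh⟩ := hC' a
    refine ⟨D ∪ D', (Finset.card_union_le _ _).trans (by rw [add_mul]; omega), ?_⟩
    intro x hx
    rw [Finset.mem_union, not_or] at hx
    rw [Pi.mul_apply, Equiv.Perm.mul_apply, hh x hx.2, hg x hx.1]
  inv_mem' := by
    rintro g ⟨C, hC⟩
    refine ⟨C, fun a => ?_⟩
    obtain ⟨D, hD, hg⟩ := hC a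
    refine ⟨D, hD, fun x hx => ?_⟩
    rw [Pi.inv_apply, Equiv.Perm.inv_eq_iff_eq]
    exact (hg x hx).symm

lemma smallSub_normal (k : ℕ) : (smallSub k).Normal := by
  classical
  constructor
  rintro g ⟨C, hC⟩ h
  refine ⟨C, fun a => ?_⟩
  obtain ⟨D, hD, hg⟩ := hC a
  refine ⟨D.image (h a), Finset.card_image_le.trans hD, fun x hx => ?_⟩
  have h1 : (h a)⁻¹ x ∉ D := by
    intro hc
    exact hx (Finset.mem_image.2 ⟨_, hc, by simp⟩)
  simp only [Pi.mul_apply, Pi.inv_apply, Equiv.Perm.mul_apply]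
  rw [hg _ h1]
  simp

lemma word_rel {k : ℕ} (v w : Fin k → ℤ) : ∃ C : ℕ, ∀ (X : Type) (p : Fin k → Equiv.Perm X)
    (D : Finset X), (∀ i j, ∀ x ∉ D, p i (p j x) = p j (p i x)) →
    ∃ D' : Finset X, D'.card ≤ C * D.card ∧
      ∀ x ∉ D', word p v (word p w x) = word p (v + w) x := by
  have := smallSub_normal k
  let P : Fin k → (∀ a : Idx k, Equiv.Perm a.X) := fun i a => a.p i
  let φ := QuotientGroup.mk' (smallSub k)
  have hcomm : ∀ i j, φ (P i) * φ (P j) = φ (P j) * φ (P i) := by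
    intro i j
    rw [← map_mul, ← map_mul]
    refine QuotientGroup.eq.2 ⟨1, fun a => ⟨a.D, by simp, fun x hx => ?_⟩⟩
    simp only [Pi.mul_apply, Pi.inv_apply, Equiv.Perm.mul_apply]
    rw [Equiv.Perm.inv_eq_iff_eq]
    simp only [Equiv.Perm.mul_apply]
    exact (a.h i j x hx).symm
  have h1 := word_add (fun i => φ (P i)) hcomm v w
  rw [← word_map, ← word_map, ← word_map, ← map_mul] at h1
  obtain ⟨C, hC⟩ := QuotientGroup.eq.1 h1.symm
  refine ⟨C, fun X p D h => ?_⟩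
  obtain ⟨D', hD', hx⟩ := hC ⟨X, p, D, h⟩
  refine ⟨D', hD', fun x hxD => ?_⟩
  have h2 := hx x hxD
  have h3 : ∀ u, word P u ⟨X, p, D, h⟩ = word p u := by
    intro u
    exact word_map (Pi.evalMonoidHom (fun a : Idx k => Equiv.Perm a.X) ⟨X, p, D, h⟩) P u
  simp only [Pi.mul_apply, Pi.inv_apply, Equiv.Perm.mul_apply] at h2
  rw [Equiv.Perm.inv_eq_iff_eq] at h2
  simp only [h3] at h2
  exact h2

lemma stable (k : ℕ) (ε : ℝ) (hε : 0 < ε) : ∃ δ : ℝ, 0 < δ ∧ ∀ (X : Type) [Fintype X]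
    (p : Fin k → Equiv.Perm X) (D : Finset X), (∀ i j, ∀ x ∉ D, p i (p j x) = p j (p i x)) →
    (D.card : ℝ) ≤ δ * Fintype.card X →
    ∃ (q : Fin k → Equiv.Perm X) (D' : Finset X), (∀ i j, q i * q j = q j * q i) ∧
      (D'.card : ℝ) ≤ ε * Fintype.card X ∧ ∀ i, ∀ x ∉ D', p i x = q i x := by
  classical
  choose c hc using @word_rel k
  have : AddGroup.FG (Fin k → ℤ) := Module.Finite.iff_addGroup_fg.1 inferInstance
  obtain ⟨F, C, hC0, hC⟩ := global (fun i : Fin k => (Pi.single i 1 : Fin k → ℤ)) (ε / 2)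
    (by positivity)
  set C' : ℕ := ∑ vw ∈ F ×ˢ F, c vw.1 vw.2 with hC'
  refine ⟨ε / 2 / (C * C' + 1), by positivity, ?_⟩
  intro X _ p D hD hDc
  choose d hd1 hd2 using fun v w => hc v w X p D hD
  let Bad := (F ×ˢ F).biUnion (fun vw => d vw.1 vw.2)
  have hBad : ∀ x ∉ Bad, Good F (word p) x := by
    intro x hx v hv w hw
    apply hd2 v w x
    intro h
    exact hx (Finset.mem_biUnion.2 ⟨(v, w), Finset.mem_product.2 ⟨hv, hw⟩, h⟩)
  have hBc : (Bad.card : ℝ) ≤ C' * D.card := by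
    have h1 : Bad.card ≤ C' * D.card := by
      rw [hC', Finset.sum_mul]
      exact Finset.card_biUnion_le.trans (Finset.sum_le_sum fun vw _ => hd1 _ _)
    exact_mod_cast h1
  obtain ⟨S, f, Φ, D', hΦ, hf, -, hcov, hDc'⟩ := hC X (word p) (word_zero p) Bad hBad
  refine ⟨fun i => (f i).viaEmbedding ⟨Φ, hΦ⟩, D', ?_, ?_, ?_⟩
  · intro i j
    simp only [← Equiv.Perm.viaEmbeddingHom_apply, ← map_mul, hf i j]
  · refine hDc'.trans ?_
    have h1 : C * Bad.card ≤ ε / 2 * Fintype.card X := by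
      have h2 : C * Bad.card ≤ C * (C' * (ε / 2 / (C * C' + 1) * Fintype.card X)) := by
        gcongr
        exact hBc.trans (by gcongr)
      refine h2.trans ?_
      have h3 : C * (C' * (ε / 2 / (C * C' + 1) * Fintype.card X)) =
          (C * C' / (C * C' + 1)) * (ε / 2 * Fintype.card X) := by ring
      rw [h3]
      have h4 : C * C' / (C * C' + 1) ≤ 1 := by
        rw [div_le_one (by positivity)]
        linarith
      exact mul_le_of_le_one_left (by positivity) h4
    linarith
  · intro i x hx
    obtain ⟨s, rfl, hs2⟩ := hcov x (Finset.mem_univ _) hx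
    have h1 := hs2 i
    rw [word_single] at h1
    rw [h1]
    exact (Equiv.Perm.viaEmbedding_apply (f i) ⟨Φ, hΦ⟩ s).symm

lemma even_option (k : ℕ) (ε : ℝ) (hε : 0 < ε) : ∃ δ : ℝ, 0 < δ ∧ ∃ N : ℕ, ∀ m : ℕ, N ≤ m →
    ∀ (p : Fin k → Equiv.Perm (Option (Option (Fin m)))) (D : Finset (Option (Option (Fin m)))),
    (∀ i j, ∀ x ∉ D, p i (p j x) = p j (p i x)) → (D.card : ℝ) ≤ δ * m →
    ∃ (q : Fin k → Equiv.Perm (Option (Option (Fin m)))),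
      (∀ i, Equiv.Perm.sign (q i) = 1) ∧ (∀ i j, q i * q j = q j * q i) ∧
      ∀ i, ∃ D' : Finset (Option (Option (Fin m))),
        (D'.card : ℝ) ≤ ε * m ∧ ∀ x ∉ D', p i x = q i x := by
  obtain ⟨δ, hδ, hst⟩ := stable k (ε / 2) (by positivity)
  obtain ⟨N1, hN1⟩ := exists_nat_gt ((2 * k + 2 * k * k) / (δ / 2))
  obtain ⟨N2, hN2⟩ := exists_nat_gt (4 / (ε / 2))
  rw [div_lt_iff₀ (by positivity)] at hN1 hN2
  refine ⟨δ / 2, by positivity, max N1 N2, ?_⟩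
  intro m hm p D hD hDc
  have hm1 : (N1 : ℝ) ≤ m := by exact_mod_cast (le_max_left _ _).trans hm
  have hm2 : (N2 : ℝ) ≤ m := by exact_mod_cast (le_max_right _ _).trans hm
  let T : Finset (Option (Option (Fin m))) := {none, some none}
  have hT : T.card ≤ 2 := Finset.card_le_two
  have hTs : ∀ x, x ∉ T → ∃ z, x = some (some z) := by
    intro x hx
    rcases x with _ | _ | z
    · simp [T] at hx
    · simp [T] at hx
    · exact ⟨z, rfl⟩
  let r : Fin k → Equiv.Perm (Fin m) := fun i => Equiv.removeNone (Equiv.removeNone (p i))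
  have hr : ∀ i z z', p i (some (some z)) = some (some z') → r i z = z' := by
    intro i z z' h
    have h1 : Equiv.removeNone (p i) (some z) = some z' := by
      have := Equiv.removeNone_some (p i) ⟨_, h⟩
      rw [h] at this
      exact Option.some.inj this
    have := Equiv.removeNone_some (Equiv.removeNone (p i)) ⟨_, h1⟩
    rw [h1] at this
    exact Option.some.inj this
  let E1 := Finset.univ.biUnion (fun i => T.image (p i).symm)
  let E2 := (Finset.univ : Finset (Fin k × Fin k)).biUnion
    (fun ij => T.image (p ij.1 * p ij.2).symm)
  let Dr : Finset (Fin m) := Finset.univ.filter (fun z => some (some z) ∈ D ∪ E1 ∪ E2)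
  have hE1 : ∀ x, x ∉ E1 → ∀ i, p i x ∉ T := by
    intro x hx i h
    exact hx (Finset.mem_biUnion.2 ⟨i, Finset.mem_univ _, Finset.mem_image.2 ⟨_, h, by simp⟩⟩)
  have hE2 : ∀ x, x ∉ E2 → ∀ i j, p i (p j x) ∉ T := by
    intro x hx i j h
    refine hx (Finset.mem_biUnion.2 ⟨(i, j), Finset.mem_univ _, Finset.mem_image.2 ⟨_, h, ?_⟩⟩)
    rw [Equiv.symm_apply_eq]
    rfl
  have hDr : (Dr.card : ℝ) ≤ δ * Fintype.card (Fin m) := by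
    have h1 : Dr.card ≤ (D ∪ E1 ∪ E2).card := by
      apply Finset.card_le_card_of_injOn (fun z => some (some z))
      · intro z hz
        exact (Finset.mem_filter.1 hz).2
      · intro a _ b _ h
        simpa using h
    have h2 : E1.card ≤ k * 2 := by
      have := Finset.card_biUnion_le_card_mul (Finset.univ : Finset (Fin k))
        (fun i => T.image (p i).symm) 2 (fun i _ => Finset.card_image_le.trans hT)
      simpa using this
    have h3 : E2.card ≤ k * k * 2 := by
      have := Finset.card_biUnion_le_card_mul (Finset.univ : Finset (Fin k × Fin k))
        (fun ij => T.image (p ij.1 * p ij.2).symm) 2 (fun i _ => Finset.card_image_le.trans hT)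
      simpa using this
    have h4 := Finset.card_union_le (D ∪ E1) E2
    have h5 := Finset.card_union_le D E1
    have h6 : Dr.card ≤ D.card + k * 2 + k * k * 2 := by omega
    have h7 : (Dr.card : ℝ) ≤ D.card + k * 2 + k * k * 2 := by exact_mod_cast h6
    rw [Fintype.card_fin]
    nlinarith
  obtain ⟨q, D', hq, hD', hpq⟩ := hst (Fin m) r Dr (by
    intro i j z hz
    have hz' : some (some z) ∉ D ∪ E1 ∪ E2 := fun h =>
      hz (Finset.mem_filter.2 ⟨Finset.mem_univ _, h⟩)
    simp only [Finset.mem_union, not_or] at hz'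
    obtain ⟨⟨a1, a2⟩, a3⟩ := hz'
    obtain ⟨zi, hzi⟩ := hTs _ (hE1 _ a2 i)
    obtain ⟨zj, hzj⟩ := hTs _ (hE1 _ a2 j)
    obtain ⟨zij, hzij⟩ := hTs _ (hE2 _ a3 i j)
    have hzji := hD i j _ a1
    rw [hzij] at hzji
    rw [hzj] at hzij
    rw [hzi] at hzji
    rw [hr j z zj hzj, hr i z zi hzi, hr i zj zij hzij, hr j zi zij hzji.symm]) hDr
  rw [Fintype.card_fin] at hD'
  let s : Equiv.Perm (Option (Option (Fin m))) := Equiv.swap none (some none)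
  have hssign : Equiv.Perm.sign s = -1 := Equiv.Perm.sign_swap (by simp)
  let o : Fin k → Equiv.Perm (Option (Option (Fin m))) := fun i =>
    Equiv.optionCongr (Equiv.optionCongr (q i))
  have hos : ∀ i, o i * s = s * o i := by
    intro i
    ext1 x
    rcases x with _ | _ | z
    · simp [o, s]
    · simp [o, s]
    · simp [o, s, Equiv.swap_apply_of_ne_of_ne]
  have hoo : ∀ i j, o i * o j = o j * o i := by
    intro i j
    ext1 x
    rcases x with _ | _ | z
    · simp [o]
    · simp [o]
    · have := Equiv.ext_iff.1 (hq i j) z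
      simp only [Equiv.Perm.mul_apply] at this
      simp [o, this]
  let c : Fin k → Equiv.Perm (Option (Option (Fin m))) := fun i =>
    if Equiv.Perm.sign (q i) = 1 then 1 else s
  refine ⟨fun i => o i * c i, ?_, ?_, ?_⟩
  · intro i
    have h1 : Equiv.Perm.sign (o i) = Equiv.Perm.sign (q i) := by
      simp only [o]
      rw [Equiv.optionCongr_sign, Equiv.optionCongr_sign]
    rw [map_mul, h1]
    simp only [c]
    rcases Int.units_eq_one_or (Equiv.Perm.sign (q i)) with h | h
    · simp [h]
    · simp [h, hssign]
  · intro i j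
    have hoc : ∀ i j, Commute (o i) (c j) := by
      intro i j
      simp only [c]
      split_ifs
      · exact Commute.one_right _
      · exact hos i
    have hcc : ∀ i j, Commute (c i) (c j) := by
      intro i j
      simp only [c]
      split_ifs
      · exact Commute.one_right _
      · exact Commute.one_left _
      · exact Commute.one_right _
      · exact Commute.refl _
    exact Commute.mul_left (Commute.mul_right (hoo i j) (hoc i j))
      (Commute.mul_right (hoc j i).symm (hcc i j))
  · intro i
    refine ⟨T ∪ T.image (p i).symm ∪ D'.image (fun z => some (some z)), ?_, ?_⟩
    · have h1 := Finset.card_union_le (T ∪ T.image (p i).symm) (D'.image (fun z => some (some z)))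
      have h2 := Finset.card_union_le T (T.image (p i).symm)
      have h3 : (T.image (p i).symm).card ≤ 2 := Finset.card_image_le.trans hT
      have h4 : (D'.image (fun z => some (some z))).card ≤ D'.card := Finset.card_image_le
      have h5 : (T ∪ T.image (p i).symm ∪ D'.image (fun z => some (some z))).card ≤
        4 + D'.card := by omega
      have h6 : ((T ∪ T.image (p i).symm ∪ D'.image (fun z => some (some z))).card : ℝ) ≤
        4 + D'.card := by exact_mod_cast h5
      nlinarith
    · intro x hx
      simp only [Finset.mem_union, not_or] at hx
      obtain ⟨⟨a1, a2⟩, a3⟩ := hx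
      obtain ⟨z, rfl⟩ := hTs x a1
      have a4 : p i (some (some z)) ∉ T := fun h =>
        a2 (Finset.mem_image.2 ⟨_, h, by simp⟩)
      obtain ⟨z', hz'⟩ := hTs _ a4
      have a5 : z ∉ D' := fun h => a3 (Finset.mem_image.2 ⟨z, h, rfl⟩)
      have h1 := hpq i z a5
      rw [hr i z z' hz'] at h1
      have hcz : c i (some (some z)) = some (some z) := by
        simp only [c]
        split_ifs
        · rfl
        · exact Equiv.swap_apply_of_ne_of_ne (by simp) (by simp)
      rw [Equiv.Perm.mul_apply, hcz, hz', h1]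
      simp [o]

end ACE

/-- For any `k ≥ 2`, every `k` even permutations that almost commute are near `k`
commuting even permutations. -/
theorem almost_commuting_even_tuples_near_commuting_even (k : ℕ) (hk : 2 ≤ k) :
    ∀ ε : ℝ, 0 < ε → ∃ δ : ℝ, 0 < δ ∧
      ∀ (n : ℕ) (p : Fin k → Equiv.Perm (Fin n)),
        (∀ i, Equiv.Perm.sign (p i) = 1) →
        (∀ i j, dH (p i * p j) (p j * p i) < δ) →
        ∃ q : Fin k → Equiv.Perm (Fin n),
          (∀ i, Equiv.Perm.sign (q i) = 1) ∧
          (∀ i j, q i * q j = q j * q i) ∧ ∀ i, dH (p i) (q i) < ε := by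
  intro ε hε
  obtain ⟨δ, hδ, N, hN⟩ := ACE.even_option k (ε / 2) (by positivity)
  have hk0 : (0 : ℝ) < k := by
    have : 0 < k := by omega
    exact_mod_cast this
  refine ⟨min (1 / ((N : ℝ) + 4)) (δ / (2 * k * k)), by positivity, ?_⟩
  intro n p hp hpc
  have hcard : ∀ i j, 0 < n → ((Finset.univ.filter
      fun x => (p i * p j) x ≠ (p j * p i) x).card : ℝ) <
        min (1 / ((N : ℝ) + 4)) (δ / (2 * k * k)) * n := by
    intro i j hn
    have h1 := hpc i j
    unfold dH at h1
    rwa [div_lt_iff₀ (by exact_mod_cast hn)] at h1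
  by_cases hn : n < N + 4
  · refine ⟨p, hp, ?_, ?_⟩
    · intro i j
      ext1 x
      by_contra hx
      have hn0 : 0 < n := lt_of_le_of_lt (Nat.zero_le _) x.2
      have h1 := hcard i j hn0
      have h2 : min (1 / ((N : ℝ) + 4)) (δ / (2 * k * k)) * n ≤ 1 := by
        have h3 : (n : ℝ) ≤ N + 4 := by exact_mod_cast hn.le
        calc min (1 / ((N : ℝ) + 4)) (δ / (2 * k * k)) * n ≤ 1 / ((N : ℝ) + 4) * (N + 4) := by
              gcongr
              exact min_le_left _ _
          _ = 1 := by field_simp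
      have h3 : 0 < (Finset.univ.filter fun x => (p i * p j) x ≠ (p j * p i) x).card :=
        Finset.card_pos.2 ⟨x, Finset.mem_filter.2 ⟨Finset.mem_univ _, hx⟩⟩
      have h4 : (1 : ℝ) ≤ (Finset.univ.filter fun x => (p i * p j) x ≠ (p j * p i) x).card := by
        exact_mod_cast h3
      linarith
    · intro i
      simpa [dH] using hε
  obtain ⟨m, rfl⟩ : ∃ m, n = m + 2 := ⟨n - 2, by omega⟩
  have hm2 : (2 : ℝ) ≤ m := by
    have : 2 ≤ m := by omega
    exact_mod_cast this
  let E : Fin (m + 2) ≃ Option (Option (Fin m)) :=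
    (finSuccEquiv (m + 1)).trans (finSuccEquiv m).optionCongr
  let D0 : Fin k × Fin k → Finset (Fin (m + 2)) := fun ij =>
    Finset.univ.filter fun x => (p ij.1 * p ij.2) x ≠ (p ij.2 * p ij.1) x
  let D : Finset (Fin (m + 2)) := Finset.univ.biUnion D0
  have hDc : ((D.image E).card : ℝ) ≤ δ * m := by
    have h1 : (D.image E).card ≤ ∑ ij, (D0 ij).card :=
      Finset.card_image_le.trans Finset.card_biUnion_le
    have h2 : ((D.image E).card : ℝ) ≤ ∑ ij, ((D0 ij).card : ℝ) := by exact_mod_cast h1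
    have h3 : ∀ ij, ((D0 ij).card : ℝ) ≤ δ / (2 * k * k) * ((m + 2 : ℕ) : ℝ) := by
      intro ij
      refine (hcard ij.1 ij.2 (by omega)).le.trans ?_
      gcongr
      exact min_le_right _ _
    have h4 := h2.trans (Finset.sum_le_sum fun ij _ => h3 ij)
    rw [Finset.sum_const, Finset.card_univ, Fintype.card_prod, Fintype.card_fin,
      nsmul_eq_mul] at h4
    push_cast at h4
    have h5 : (k : ℝ) * k * (δ / (2 * k * k) * (m + 2)) = δ / 2 * (m + 2) := by field_simp
    rw [h5] at h4
    nlinarith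
  obtain ⟨q, hq1, hq2, hq3⟩ := hN m (by omega) (fun i => E.permCongr (p i)) (D.image E) (by
    intro i j x hx
    have h1 : E.symm x ∉ D := fun h => hx (Finset.mem_image.2 ⟨_, h, by simp⟩)
    have h2 : p i (p j (E.symm x)) = p j (p i (E.symm x)) := by
      by_contra hne
      exact h1 (Finset.mem_biUnion.2 ⟨(i, j), Finset.mem_univ _,
        Finset.mem_filter.2 ⟨Finset.mem_univ _, hne⟩⟩)
    simp [Equiv.permCongr_apply, h2]) hDc
  refine ⟨fun i => E.symm.permCongr (q i), ?_, ?_, ?_⟩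
  · intro i
    rw [Equiv.Perm.sign_permCongr]
    exact hq1 i
  · intro i j
    ext1 x
    have := Equiv.ext_iff.1 (hq2 i j) (E x)
    simp only [Equiv.Perm.mul_apply] at this
    simp [Equiv.permCongr_apply, this]
  · intro i
    obtain ⟨D', hD', hpq⟩ := hq3 i
    unfold dH
    have hpos : (0 : ℝ) < ((m + 2 : ℕ) : ℝ) := by positivity
    rw [div_lt_iff₀ hpos]
    have h1 : (Finset.univ.filter fun x => p i x ≠ E.symm.permCongr (q i) x).card ≤ D'.card := by
      apply Finset.card_le_card_of_injOn E
      · intro x hx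
        by_contra hxD
        apply (Finset.mem_filter.1 hx).2
        have := hpq (E x) hxD
        rw [Equiv.permCongr_apply, Equiv.symm_apply_apply] at this
        rw [Equiv.permCongr_apply, Equiv.symm_symm, ← this, Equiv.symm_apply_apply]
      · exact E.injective.injOn
    have h2 : ((Finset.univ.filter fun x => p i x ≠ E.symm.permCongr (q i) x).card : ℝ) ≤
      D'.card := by exact_mod_cast h1
    refine (h2.trans hD').trans_lt ?_
    push_cast
    nlinarith
end
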